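/- Assume the Riemann Hypothesis. Then for every α > 0 and every absolutely continuous function h : 𝕋 → ℂ on the torus 𝕋 = ℝ/ℤ, lim_{T→∞} [ (1/T) ∑_{0<γ≤T} h(αγ mod 1) − (N(T)/T) ∫₀¹ h(u) du ] = ∫₀¹ h(u) g_α(u) du. -/

import Mathlib

open Filter MeasureTheory Real Complex Set

open Classical in
/-- Multiplicity of a point as a zero of the Riemann zeta function. -/
noncomputable def zetaZeroMult (ρ : ℂ) : ℕ :=
  if h : AnalyticAt ℂ riemannZeta ρ then (analyticOrderAt riemannZeta ρ).toNat else 0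

/-- Nontrivial zeros with imaginary part in `(0, T]`. -/
def zetaZerosUpTo (T : ℝ) : Set ℂ :=
  {ρ : ℂ | riemannZeta ρ = 0 ∧ 0 < ρ.re ∧ ρ.re < 1 ∧ 0 < ρ.im ∧ ρ.im ≤ T}

/-- `N(T)`: number of nontrivial zeros with `0 < γ ≤ T`, counted with multiplicity. -/
noncomputable def zetaN (T : ℝ) : ℕ := ∑ᶠ ρ ∈ zetaZerosUpTo T, zetaZeroMult ρ

/-- Explicit density `g` when `α = a log p / (2 π q)`. -/
noncomputable def gPAQ (p a q : ℕ) (t : ℝ) : ℝ :=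
  -(((p : ℝ) ^ ((a : ℝ) / 2) * Real.cos (2 * π * q * t) - 1) * Real.log p) /
    (π * ((p : ℝ) ^ (a : ℝ) - 2 * (p : ℝ) ^ ((a : ℝ) / 2) * Real.cos (2 * π * q * t) + 1))

/-- `α` has the special form `a log p / (2 π q)` with `p` prime, `a, q` coprime positive. -/
def IsSpecialForm (α : ℝ) (p a q : ℕ) : Prop :=
  p.Prime ∧ 0 < a ∧ 0 < q ∧ Nat.Coprime a q ∧ α = a * Real.log p / (2 * π * q)

/-- `g` is the density `g_α` associated with `α`. -/
def IsDensityOf (α : ℝ) (g : ℝ → ℝ) : Prop :=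
  (∀ p a q : ℕ, IsSpecialForm α p a q → g = gPAQ p a q) ∧
    ((¬ ∃ p a q : ℕ, IsSpecialForm α p a q) → g = 0)

/-- Sum of `h(αγ)` over zeros with `0 < γ ≤ T`, with multiplicity; `h` is `1`-periodic so this
equals the sum of `h({αγ})`. -/
noncomputable def zetaZeroSum (α : ℝ) (h : ℝ → ℂ) (T : ℝ) : ℂ :=
  ∑ᶠ ρ ∈ zetaZerosUpTo T, (zetaZeroMult ρ : ℂ) * h (α * ρ.im)

/-- `h` is (a lift of) an absolutely continuous function on `𝕋 = ℝ/ℤ`, with derivative `h'`. -/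
def IsAbsContTorus (h h' : ℝ → ℂ) : Prop :=
  Function.Periodic h 1 ∧ Function.Periodic h' 1 ∧
    (∀ a b : ℝ, IntervalIntegrable h' volume a b) ∧
    ∀ y : ℝ, h y = h 0 + ∫ t in (0:ℝ)..y, h' t

/-- `L¹` modulus of continuity on the torus. -/
noncomputable def modCont (f : ℝ → ℂ) (δ : ℝ) : ℝ :=
  sSup ((fun u => ∫ t in (0:ℝ)..1, ‖f (t + u) - f t‖) '' Set.Icc (-δ) δ)

/-- `M_α(y;T)`. -/
noncomputable def Mfun (α y T : ℝ) : ℝ :=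
  (1 / T) * (∑ᶠ ρ ∈ {ρ : ℂ | riemannZeta ρ = 0 ∧ 0 < ρ.re ∧ ρ.re < 1 ∧ 0 < ρ.im ∧ ρ.im ≤ T ∧
      Int.fract (α * ρ.im) < y}, (zetaZeroMult ρ : ℝ)) - y * (zetaN T) / T

/-- Normalized discrepancy `D*_α(T)`. -/
noncomputable def Dstar (α T : ℝ) : ℝ :=
  sSup ((fun y => (T / (zetaN T)) * |Mfun α y T|) '' Set.Icc (0:ℝ) 1)

namespace FZ

lemma logDeriv_lip {g : ℂ → ℂ} {c : ℂ} {R K : ℝ} (hR : 0 < R) (hK : 0 < K)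
    (hg : DifferentiableOn ℂ g (Metric.ball c R)) (hne : ∀ z ∈ Metric.ball c R, g z ≠ 0)
    (hb : ∀ z ∈ Metric.ball c R, ‖g z‖ ≤ Real.exp K * ‖g c‖)
    {z₁ z₂ : ℂ} (h1 : z₁ ∈ Metric.closedBall c (R/8)) (h2 : z₂ ∈ Metric.closedBall c (R/8)) :
    ‖logDeriv g z₁ - logDeriv g z₂‖ ≤ 64 * K / R^2 * ‖z₁ - z₂‖ := by
  have hopen : IsOpen (Metric.ball c R) := Metric.isOpen_ball
  have hcm : c ∈ Metric.ball c R := Metric.mem_ball_self hR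
  have hld : DifferentiableOn ℂ (logDeriv g) (Metric.ball c R) := by
    have : DifferentiableOn ℂ (fun z => deriv g z / g z) (Metric.ball c R) :=
      (hg.deriv hopen).div hg hne
    exact this
  obtain ⟨φ₀, hφ₀⟩ := hld.isExactOn_ball
  set φ : ℂ → ℂ := fun z => φ₀ z - φ₀ c with hφ
  have hφd : ∀ z ∈ Metric.ball c R, HasDerivAt φ (logDeriv g z) z := fun z hz =>
    (hφ₀ z hz).sub_const _
  have hφD : DifferentiableOn ℂ φ (Metric.ball c R) := fun z hz =>
    (hφd z hz).differentiableAt.differentiableWithinAt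
  have hexp : ∀ z ∈ Metric.ball c R, g z = g c * Complex.exp (φ z) := by
    intro z hz
    have hder : ∀ w ∈ Metric.ball c R, HasDerivWithinAt (fun w => g w * Complex.exp (- φ w)) 0
        (Metric.ball c R) w := by
      intro w hw
      have hgw := (hg.differentiableAt (hopen.mem_nhds hw)).hasDerivAt
      have := (hgw.mul ((hφd w hw).neg.cexp))
      refine (this.congr_deriv ?_).hasDerivWithinAt
      rw [logDeriv_apply]
      have := hne w hw
      field_simp
      simp
    have := (convex_ball c R).is_const_of_fderivWithin_eq_zero (𝕜 := ℂ)
      (f := fun w => g w * Complex.exp (- φ w))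
      (fun w hw => (hder w hw).differentiableWithinAt)
      (fun w hw => by
        have := (hder w hw).hasFDerivWithinAt.fderivWithin (hopen.uniqueDiffWithinAt hw)
        rw [this]; ext; simp) hz hcm
    have hφc : φ c = 0 := by simp [hφ]
    simp only [hφc, neg_zero, Complex.exp_zero, mul_one] at this
    rw [← this, mul_assoc, ← Complex.exp_add]; simp
  have hre : ∀ z ∈ Metric.ball c R, (φ z).re ≤ K := by
    intro z hz
    have h := hb z hz
    rw [hexp z hz, norm_mul, Complex.norm_exp, mul_comm] at h
    have hgc : 0 < ‖g c‖ := norm_pos_iff.2 (hne c hcm)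
    exact Real.exp_le_exp.1 (le_of_mul_le_mul_right h hgc)
  have hφb : ∀ z ∈ Metric.closedBall c (R/2), ‖φ z‖ ≤ 2 * K := by
    intro z hz
    have hz' : ‖z - c‖ ≤ R/2 := by simpa [dist_eq_norm] using hz
    have := Complex.borelCaratheodory_zero (f := fun w => φ (w + c)) (M := K) (R := R) (z := z - c) hK
      (by
        refine hφD.comp (by fun_prop) ?_
        intro w hw; simpa [dist_eq_norm] using hw)
      (by
        intro w hw
        exact hre _ (by simpa [dist_eq_norm] using hw)) hR
      (by simp; linarith) (by simp [hφ])
    simp only [sub_add_cancel] at this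
    refine this.trans ?_
    rw [div_le_iff₀ (by linarith)]
    nlinarith
  have sub_ball : ∀ {r s : ℝ} {z : ℂ}, z ∈ Metric.closedBall c r → r + s < R →
      Metric.closedBall z s ⊆ Metric.ball c R := by
    intro r s z hz h w hw
    simp only [Metric.mem_closedBall, Metric.mem_ball] at *
    linarith [dist_triangle w z c]
  have hd1 : ∀ z ∈ Metric.closedBall c (R/4), ‖logDeriv g z‖ ≤ 8 * K / R := by
    intro z hz
    have hsub := sub_ball (s := R/4) hz (by linarith)
    have hzm : z ∈ Metric.ball c R := hsub (Metric.mem_closedBall_self (by positivity))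
    rw [← (hφd z hzm).deriv]
    have := Complex.norm_deriv_le_of_forall_mem_sphere_norm_le (c := z) (R := R/4) (C := 2*K) (f := φ)
      (by positivity)
      ((hφD.mono hsub).diffContOnCl_ball subset_rfl)
      (fun w hw => hφb w (by
        simp only [Metric.mem_closedBall, Metric.mem_sphere] at *
        linarith [dist_triangle w z c]))
    refine this.trans (le_of_eq ?_)
    field_simp; norm_num
  have hd2 : ∀ z ∈ Metric.closedBall c (R/8), ‖deriv (logDeriv g) z‖ ≤ 64 * K / R^2 := by
    intro z hz
    have hsub := sub_ball (s := R/8) hz (by linarith)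
    have := Complex.norm_deriv_le_of_forall_mem_sphere_norm_le (c := z) (R := R/8) (C := 8*K/R)
      (f := logDeriv g) (by positivity)
      ((hld.mono hsub).diffContOnCl_ball subset_rfl)
      (fun w hw => hd1 w (by
        simp only [Metric.mem_closedBall, Metric.mem_sphere] at *
        linarith [dist_triangle w z c]))
    refine this.trans (le_of_eq ?_)
    field_simp; norm_num
  exact (convex_closedBall c (R/8)).norm_image_sub_le_of_norm_deriv_le
    (fun z hz => hld.differentiableAt (hopen.mem_nhds
      (Metric.closedBall_subset_ball (by linarith) hz))) hd2 h2 h1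

lemma order_ne_top {f : ℂ → ℂ} (hf : Differentiable ℂ f) {c : ℂ} (hc : f c ≠ 0) (z : ℂ) :
    analyticOrderAt f z ≠ ⊤ := by
  rw [Ne, analyticOrderAt_eq_top]
  intro h
  have han : AnalyticOnNhd ℂ f univ := fun w _ => hf.analyticAt w
  have := han.eqOn_zero_of_preconnected_of_eventuallyEq_zero isPreconnected_univ (mem_univ z) h
  exact hc (this (mem_univ c))

lemma factor_one {f : ℂ → ℂ} (hf : Differentiable ℂ f) {c : ℂ} (hc : f c ≠ 0) (ρ : ℂ) :
    ∃ g : ℂ → ℂ, Differentiable ℂ g ∧ g ρ ≠ 0 ∧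
      ∀ z, f z = (z - ρ) ^ (analyticOrderNatAt f ρ) * g z := by
  classical
  obtain ⟨g, hga, hg0, hfg⟩ := (hf.analyticAt ρ).analyticOrderAt_ne_top.1 (order_ne_top hf hc ρ)
  set n := analyticOrderNatAt f ρ
  refine ⟨fun z => if z = ρ then g ρ else f z / (z - ρ)^n, ?_, by simpa using hg0, ?_⟩
  · intro z
    by_cases hz : z = ρ
    · subst hz
      refine hga.differentiableAt.congr_of_eventuallyEq ?_
      filter_upwards [hfg] with w hw
      split_ifs with h
      · rw [h]
      · rw [hw, smul_eq_mul, mul_div_cancel_left₀]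
        exact pow_ne_zero _ (sub_ne_zero.2 h)
    · have : DifferentiableAt ℂ (fun z => f z / (z-ρ)^n) z :=
        (hf z).div (by fun_prop) (pow_ne_zero _ (sub_ne_zero.2 hz))
      refine this.congr_of_eventuallyEq ?_
      filter_upwards [isOpen_ne.mem_nhds hz] with w hw
      simp [show w ≠ ρ from hw]
  · intro z
    by_cases hz : z = ρ
    · subst hz
      simpa using hfg.self_of_nhds
    · simp only [hz, if_false]
      rw [mul_div_cancel₀]
      exact pow_ne_zero _ (sub_ne_zero.2 hz)

lemma factor_zeros {f : ℂ → ℂ} (hf : Differentiable ℂ f) {c : ℂ} (hc : f c ≠ 0) (Z : Finset ℂ) :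
    ∃ g : ℂ → ℂ, Differentiable ℂ g ∧ (∀ ρ ∈ Z, g ρ ≠ 0) ∧
      ∀ z, f z = (∏ ρ ∈ Z, (z - ρ) ^ (analyticOrderNatAt f ρ)) * g z := by
  classical
  induction Z using Finset.induction_on with
  | empty => exact ⟨f, hf, by simp, by simp⟩
  | insert a Z ha ih =>
    obtain ⟨g, hg, hgZ, hfg⟩ := ih
    have hgc : g c ≠ 0 := fun h => hc (by rw [hfg c, h, mul_zero])
    obtain ⟨k, hk, hka, hgk⟩ := factor_one hg hgc a
    have hord : analyticOrderNatAt g a = analyticOrderNatAt f a := by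
      have hP : Differentiable ℂ (fun z : ℂ => ∏ ρ ∈ Z, (z - ρ) ^ (analyticOrderNatAt f ρ)) := by
        fun_prop
      have e : f = (fun z : ℂ => ∏ ρ ∈ Z, (z - ρ) ^ (analyticOrderNatAt f ρ)) * g := by
        ext z; exact hfg z
      have h0 : analyticOrderAt (fun z : ℂ => ∏ ρ ∈ Z, (z - ρ) ^ (analyticOrderNatAt f ρ)) a = 0 := by
        rw [(hP.analyticAt a).analyticOrderAt_eq_zero]
        refine Finset.prod_ne_zero_iff.2 fun ρ hρ => pow_ne_zero _ (sub_ne_zero.2 ?_)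
        rintro rfl; exact ha hρ
      unfold analyticOrderNatAt
      conv_rhs => rw [e]
      rw [analyticOrderAt_mul (hP.analyticAt a) (hg.analyticAt a), h0, zero_add]
    refine ⟨k, hk, ?_, ?_⟩
    · intro ρ hρ
      rcases Finset.mem_insert.1 hρ with rfl | h
      · exact hka
      · intro h0; exact hgZ ρ h (by rw [hgk, h0, mul_zero])
    · intro z
      rw [Finset.prod_insert ha, hfg z, hgk z, hord]; ring

lemma hadamard_local {f : ℂ → ℂ} (hf : Differentiable ℂ f) {c : ℂ} (hc : f c ≠ 0) {R K : ℝ}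
    (hR : 0 < R) (hK : 0 < K)
    (hb : ∀ z, ‖z - c‖ ≤ 3 * R → ‖f z‖ ≤ Real.exp K * ‖f c‖) (Z : Finset ℂ)
    (hZ : ∀ ρ, ρ ∈ Z ↔ f ρ = 0 ∧ ‖ρ - c‖ ≤ R) {z₁ z₂ : ℂ} (h1 : ‖z₁ - c‖ ≤ R/8)
    (h2 : ‖z₂ - c‖ ≤ R/8) (hf1 : f z₁ ≠ 0) (hf2 : f z₂ ≠ 0) :
    ‖(logDeriv f z₁ - ∑ ρ ∈ Z, (analyticOrderNatAt f ρ : ℂ) / (z₁ - ρ)) -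
      (logDeriv f z₂ - ∑ ρ ∈ Z, (analyticOrderNatAt f ρ : ℂ) / (z₂ - ρ))‖
      ≤ 64 * K / R^2 * ‖z₁ - z₂‖ := by
  classical
  obtain ⟨g, hg, hgZ, hfg⟩ := factor_zeros hf hc Z
  have key : ∀ z, f z ≠ 0 →
      logDeriv f z - ∑ ρ ∈ Z, (analyticOrderNatAt f ρ : ℂ) / (z - ρ) = logDeriv g z := by
    intro z hz
    have hP0 : ∏ ρ ∈ Z, (z - ρ) ^ (analyticOrderNatAt f ρ) ≠ 0 := fun h => hz (by rw [hfg z, h, zero_mul])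
    have hg0 : g z ≠ 0 := fun h => hz (by rw [hfg z, h, mul_zero])
    have hzρ : ∀ ρ ∈ Z, z - ρ ≠ 0 := by
      intro ρ hρ h
      rw [sub_eq_zero] at h; subst h
      exact hz ((hZ z).1 hρ).1
    have e : f = fun z => (∏ ρ ∈ Z, (z - ρ) ^ (analyticOrderNatAt f ρ)) * g z := funext hfg
    conv_lhs => enter [1]; rw [e]
    rw [logDeriv_mul z hP0 hg0 (by fun_prop) (hg z)]
    rw [logDeriv_prod (f := fun ρ z => (z - ρ) ^ (analyticOrderNatAt f ρ))
      (fun ρ hρ => pow_ne_zero _ (hzρ ρ hρ)) (fun ρ hρ => by fun_prop)]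
    have : ∀ ρ ∈ Z, logDeriv (fun z => (z - ρ) ^ (analyticOrderNatAt f ρ)) z
        = (analyticOrderNatAt f ρ : ℂ) / (z - ρ) := by
      intro ρ hρ
      rw [logDeriv_fun_pow (f := fun z => z - ρ) (by fun_prop)]
      simp [logDeriv_apply, div_eq_mul_inv]
    rw [Finset.sum_congr rfl this]
    ring
  rw [key _ hf1, key _ hf2]
  have hgb : ∀ z, ‖z - c‖ ≤ 3 * R → ‖g z‖ ≤ Real.exp K * ‖g c‖ := by
    intro z hz
    refine Complex.norm_le_of_forall_mem_frontier_norm_le (U := Metric.ball c (3*R))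
      Metric.isBounded_ball hg.diffContOnCl ?_ (by
        rw [closure_ball _ (by positivity)]; simpa [dist_eq_norm] using hz)
    intro w hw
    rw [frontier_ball _ (by positivity)] at hw
    have hw' : ‖w - c‖ = 3 * R := by simpa [dist_eq_norm] using hw
    have hfw := hb w hw'.le
    rw [hfg w, hfg c, norm_mul, norm_mul, norm_prod, norm_prod] at hfw
    have hcρ : ∀ ρ ∈ Z, 0 < ‖c - ρ‖ := by
      intro ρ hρ
      rw [norm_pos_iff]; intro h
      rw [sub_eq_zero] at h; subst h
      exact hc ((hZ c).1 hρ).1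
    have hle : ∏ ρ ∈ Z, ‖(c - ρ) ^ (analyticOrderNatAt f ρ)‖ ≤ ∏ ρ ∈ Z, ‖(w - ρ) ^ (analyticOrderNatAt f ρ)‖ := by
      refine Finset.prod_le_prod (fun _ _ => norm_nonneg _) ?_
      intro ρ hρ
      rw [norm_pow, norm_pow]
      have h3 := ((hZ ρ).1 hρ).2
      have h4 : ‖w - c‖ ≤ ‖w - ρ‖ + ‖ρ - c‖ := by
        simpa using norm_add_le (w - ρ) (ρ - c)
      rw [norm_sub_rev c ρ]
      gcongr
      linarith
    have hpos : 0 < ∏ ρ ∈ Z, ‖(c - ρ) ^ (analyticOrderNatAt f ρ)‖ :=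
      Finset.prod_pos fun ρ hρ => by rw [norm_pow]; exact pow_pos (hcρ ρ hρ) _
    have : (∏ ρ ∈ Z, ‖(c - ρ) ^ (analyticOrderNatAt f ρ)‖) * ‖g w‖ ≤
        (∏ ρ ∈ Z, ‖(c - ρ) ^ (analyticOrderNatAt f ρ)‖) * (Real.exp K * ‖g c‖) := by
      calc _ ≤ (∏ ρ ∈ Z, ‖(w - ρ) ^ (analyticOrderNatAt f ρ)‖) * ‖g w‖ := by gcongr
        _ ≤ _ := hfw
        _ = _ := by ring
    exact le_of_mul_le_mul_left this hpos
  refine logDeriv_lip hR hK hg.differentiableOn ?_ ?_ (by simpa [dist_eq_norm] using h1)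
    (by simpa [dist_eq_norm] using h2)
  · intro z hz h0
    have hz' : ‖z - c‖ < R := by simpa [dist_eq_norm] using hz
    have : z ∈ Z := (hZ z).2 ⟨by rw [hfg z, h0, mul_zero], hz'.le⟩
    exact hgZ z this h0
  · intro z hz
    have hz' : ‖z - c‖ < R := by simpa [dist_eq_norm] using hz
    exact hgb z (by linarith)

end FZ

namespace FZ

/-- The entire function `s(1-s)Λ(s)`. -/
noncomputable def X (s : ℂ) : ℂ := s * (1 - s) * completedRiemannZeta₀ s - 1

lemma X_diff : Differentiable ℂ X := by
  unfold X
  have := differentiable_completedZeta₀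
  fun_prop

lemma X_one_sub (s : ℂ) : X (1 - s) = X s := by
  unfold X
  rw [completedRiemannZeta₀_one_sub]; ring

lemma X_zero : X 0 = -1 := by simp [X]
lemma X_one : X 1 = -1 := by simp [X]

lemma X_eq_completed {s : ℂ} (h0 : s ≠ 0) (h1 : s ≠ 1) :
    X s = s * (1 - s) * completedRiemannZeta s := by
  have h2 : 1 - s ≠ 0 := sub_ne_zero.mpr h1.symm
  rw [completedRiemannZeta_eq, X]
  field_simp
  ring

lemma X_eq {s : ℂ} (h0 : 0 < s.re) (h1 : s ≠ 1) :
    X s = s * (1 - s) * (Gammaℝ s * riemannZeta s) := by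
  have hs : s ≠ 0 := by rintro rfl; simp at h0
  rw [X_eq_completed hs h1, riemannZeta_def_of_ne_zero hs]
  have := Gammaℝ_ne_zero_of_re_pos h0
  field_simp

lemma X_ne_zero_of_one_le {s : ℂ} (h : 1 ≤ s.re) : X s ≠ 0 := by
  by_cases h1 : s = 1
  · rw [h1, X_one]; simp
  · rw [X_eq (by linarith) h1]
    have h2 : 1 - s ≠ 0 := sub_ne_zero.mpr (Ne.symm h1)
    have hs : s ≠ 0 := by rintro rfl; simp at h; linarith
    have := Gammaℝ_ne_zero_of_re_pos (s := s) (by linarith)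
    have := riemannZeta_ne_zero_of_one_le_re h
    simp_all

lemma X_zero_strip {s : ℂ} (h : X s = 0) : 0 < s.re ∧ s.re < 1 := by
  constructor
  · by_contra hc
    have : X (1 - s) = 0 := by rw [X_one_sub, h]
    exact X_ne_zero_of_one_le (by simp; linarith) this
  · by_contra hc
    exact X_ne_zero_of_one_le (by linarith) h

lemma X_zero_iff {s : ℂ} : X s = 0 ↔ riemannZeta s = 0 ∧ 0 < s.re ∧ s.re < 1 := by
  constructor
  · intro h
    obtain ⟨h0, h1⟩ := X_zero_strip h
    refine ⟨?_, h0, h1⟩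
    have h1' : s ≠ 1 := by rintro rfl; simp at h1
    have hs : s ≠ 0 := by rintro rfl; simp at h0
    have h2 : 1 - s ≠ 0 := sub_ne_zero.mpr (Ne.symm h1')
    rw [X_eq h0 h1'] at h
    have := Gammaℝ_ne_zero_of_re_pos h0
    simp_all
  · rintro ⟨h, h0, h1⟩
    have h1' : s ≠ 1 := by rintro rfl; simp at h1
    rw [X_eq h0 h1', h]; simp

lemma X_zero_re (hRH : RiemannHypothesis) {s : ℂ} (h : X s = 0) : s.re = 1 / 2 := by
  obtain ⟨hz, h0, h1⟩ := X_zero_iff.mp h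
  refine hRH s hz ?_ ?_
  · rintro ⟨n, rfl⟩
    simp at h0
    have : (0:ℝ) ≤ n := n.cast_nonneg
    linarith
  · rintro rfl; simp at h1

lemma Gammaℝ_analyticAt {s : ℂ} (h : 0 < s.re) : AnalyticAt ℂ Gammaℝ s := by
  have hopen : IsOpen {z : ℂ | 0 < z.re} := isOpen_lt continuous_const continuous_re
  have : DifferentiableOn ℂ Gammaℝ {z : ℂ | 0 < z.re} := by
    intro z hz
    have hz' : 0 < z.re := hz
    have : DifferentiableAt ℂ Gammaℝ z := by
      have e : Gammaℝ = fun s => (π:ℂ) ^ (-s / 2) * Complex.Gamma (s / 2) := by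
        ext s; exact Gammaℝ_def s
      rw [e]
      have hg : DifferentiableAt ℂ (fun s : ℂ => Complex.Gamma (s/2)) z := by
        refine DifferentiableAt.comp z (g := Complex.Gamma) (f := fun s => s / 2) ?_ (by fun_prop)
        refine Complex.differentiableAt_Gamma _ ?_
        intro m hm
        have := congrArg Complex.re hm
        simp at this
        have : (0:ℝ) ≤ m := m.cast_nonneg
        linarith
      refine DifferentiableAt.mul ?_ hg
      refine DifferentiableAt.const_cpow (by fun_prop) ?_
      left; exact_mod_cast Real.pi_ne_zero
    exact this.differentiableWithinAt
  exact this.analyticAt (hopen.mem_nhds h)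

lemma zeta_analyticAt {s : ℂ} (h : s ≠ 1) : AnalyticAt ℂ riemannZeta s := by
  have : DifferentiableOn ℂ riemannZeta {1}ᶜ := fun z hz =>
    (differentiableAt_riemannZeta (by simpa using hz)).differentiableWithinAt
  exact this.analyticAt (isOpen_compl_singleton.mem_nhds h)

lemma X_order {s : ℂ} (h0 : 0 < s.re) (h1 : s.re < 1) :
    analyticOrderNatAt X s = zetaZeroMult s := by
  have h1' : s ≠ 1 := by rintro rfl; simp at h1
  have hs : s ≠ 0 := by rintro rfl; simp at h0
  have h2 : 1 - s ≠ 0 := sub_ne_zero.mpr (Ne.symm h1')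
  have hz := zeta_analyticAt h1'
  unfold zetaZeroMult analyticOrderNatAt
  rw [dif_pos hz]
  congr 1
  set G : ℂ → ℂ := fun z => z * (1 - z) * Gammaℝ z
  have hG : AnalyticAt ℂ G s := by
    have := Gammaℝ_analyticAt h0
    have hi : AnalyticAt ℂ (fun z : ℂ => z * (1 - z)) s := by
      apply Differentiable.analyticAt; fun_prop
    exact hi.mul this
  have hG0 : G s ≠ 0 := by
    have := Gammaℝ_ne_zero_of_re_pos h0
    simp [G, *]
  have e : X =ᶠ[nhds s] G * riemannZeta := by
    have hopen : IsOpen {z : ℂ | 0 < z.re ∧ z ≠ 1} :=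
      (isOpen_lt continuous_const continuous_re).inter isOpen_ne
    filter_upwards [hopen.mem_nhds ⟨h0, h1'⟩] with z hz
    rw [X_eq hz.1 hz.2]
    simp [G]; ring
  rw [analyticOrderAt_congr e, analyticOrderAt_mul hG hz,
    hG.analyticOrderAt_eq_zero.mpr hG0, zero_add]

/-- Conjugation symmetry. -/
lemma X_conj (s : ℂ) : X (starRingEnd ℂ s) = starRingEnd ℂ (X s) := by
  have key : ∀ s : ℂ, 0 < s.re → X (starRingEnd ℂ s) = starRingEnd ℂ (X s) := by
    intro s hs
    by_cases h1 : s = 1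
    · subst h1; simp [X_one]
    · have h1' : starRingEnd ℂ s ≠ 1 := by
        intro h; apply h1
        have := congrArg (starRingEnd ℂ) h
        simpa using this
      rw [X_eq hs h1, X_eq (by simpa using hs) h1', riemannZeta_conj]
      have : Gammaℝ (starRingEnd ℂ s) = starRingEnd ℂ (Gammaℝ s) := by
        have hc := cpow_conj (π : ℂ) (-s/2)
          (by rw [Complex.arg_ofReal_of_nonneg Real.pi_nonneg]; exact Real.pi_ne_zero.symm)
        rw [Gammaℝ_def, Gammaℝ_def, map_mul, ← Complex.Gamma_conj]
        simp only [map_div₀, map_neg, Complex.conj_ofReal, Complex.conj_ofNat] at hc ⊢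
        rw [hc]
      rw [this]; simp
  rcases lt_or_ge 0 s.re with h | h
  · exact key s h
  · have := key (1 - s) (by simp; linarith)
    rw [X_one_sub, map_sub, map_one, X_one_sub] at this
    exact this

end FZ

namespace FZ

lemma norm_Gamma_le {s : ℂ} (h : 0 < s.re) : ‖Complex.Gamma s‖ ≤ Real.Gamma s.re := by
  rw [Complex.Gamma_eq_integral h, Real.Gamma_eq_integral h, Complex.GammaIntegral]
  refine (norm_integral_le_integral_norm _).trans (le_of_eq ?_)
  refine setIntegral_congr_fun measurableSet_Ioi fun x hx => ?_
  have hx' : (0:ℝ) < x := hx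
  have he : ‖cexp (-(x:ℂ))‖ = rexp (-x) := by rw [Complex.norm_exp]; simp
  simp [norm_cpow_eq_rpow_re_of_pos hx', he]

lemma Gamma_growth {y : ℝ} (hy : 1 ≤ y) :
    Real.Gamma y ≤ Real.exp (2 * (y + 1) ^ (3 / 2 : ℝ)) := by
  have hy0 : 0 < y := by linarith
  have h1 : Real.Gamma y ≤ Real.Gamma (y + 1) := by
    rw [Real.Gamma_add_one hy0.ne']
    have := Real.Gamma_pos_of_pos hy0
    nlinarith
  set n := ⌈y⌉₊
  have hn1 : y ≤ n := Nat.le_ceil y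
  have hn2 : (n:ℝ) ≤ y + 1 := (Nat.ceil_lt_add_one hy0.le).le
  have h2 : Real.Gamma (y + 1) ≤ Real.Gamma (n + 1) :=
    Real.Gamma_strictMonoOn_Ici.monotoneOn (by simp; linarith) (by simp; linarith) (by linarith)
  rw [Real.Gamma_nat_eq_factorial] at h2
  have h3 : ((n.factorial : ℕ) : ℝ) ≤ (n:ℝ) ^ n := by exact_mod_cast Nat.factorial_le_pow n
  have hn0 : (0:ℝ) < n := by linarith
  have h4 : (n:ℝ)^n = Real.exp (n * Real.log n) := by
    rw [← Real.rpow_natCast, Real.rpow_def_of_pos hn0, mul_comm]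
  have h5 : Real.log n ≤ 2 * (n:ℝ) ^ (1/2 : ℝ) := by
    have := Real.log_le_rpow_div (x := n) (ε := 1/2) hn0.le (by norm_num)
    linarith
  have h6 : (n:ℝ) * Real.log n ≤ 2 * (y + 1) ^ (3 / 2 : ℝ) := by
    calc (n:ℝ) * Real.log n ≤ n * (2 * (n:ℝ) ^ (1/2 : ℝ)) := by gcongr
      _ = 2 * (n:ℝ) ^ (3/2 : ℝ) := by
        rw [show (3/2 : ℝ) = 1 + 1/2 by norm_num, Real.rpow_add hn0, Real.rpow_one]; ring
      _ ≤ _ := by gcongr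
  calc _ ≤ _ := h1
    _ ≤ _ := h2
    _ ≤ _ := h3
    _ ≤ _ := by rw [h4]; exact Real.exp_le_exp.mpr h6

lemma norm_Gammaℝ_le {s : ℂ} (h : 2 ≤ s.re) :
    ‖Gammaℝ s‖ ≤ Real.exp (2 * (s.re + 1) ^ (3 / 2 : ℝ)) := by
  rw [Gammaℝ_def, norm_mul, norm_cpow_eq_rpow_re_of_pos Real.pi_pos]
  have h1 : π ^ ((-s/2).re) ≤ 1 := by
    apply Real.rpow_le_one_of_one_le_of_nonpos
    · linarith [Real.pi_gt_three]
    · simp; linarith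
  have hre : (s/2).re = s.re/2 := by simp
  have h2 := norm_Gamma_le (s := s/2) (by rw [hre]; linarith)
  have h3 := Gamma_growth (y := (s/2).re) (by rw [hre]; linarith)
  rw [hre] at h2 h3
  have h4 : Real.exp (2 * (s.re/2 + 1) ^ (3 / 2 : ℝ)) ≤ Real.exp (2 * (s.re + 1) ^ (3 / 2 : ℝ)) := by
    apply Real.exp_le_exp.mpr
    gcongr
    linarith
  calc _ ≤ 1 * Real.exp (2 * (s.re + 1) ^ (3 / 2 : ℝ)) := by
        gcongr
        linarith
    _ = _ := one_mul _

lemma norm_zeta_le : ∃ B : ℝ, 0 < B ∧ ∀ s : ℂ, 2 ≤ s.re → ‖riemannZeta s‖ ≤ B := by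
  have hsum : Summable fun n : ℕ => 1 / ((n:ℝ)^ (2:ℝ)) := Real.summable_one_div_nat_rpow.mpr (by norm_num)
  refine ⟨∑' n : ℕ, 1 / ((n:ℝ)^ (2:ℝ)) + 1, by positivity, fun s hs => ?_⟩
  rw [zeta_eq_tsum_one_div_nat_cpow (by linarith)]
  refine (tsum_of_norm_bounded hsum.hasSum fun n => ?_).trans (by linarith)
  rcases Nat.eq_zero_or_pos n with rfl | hn
  · have : s ≠ 0 := by rintro rfl; simp at hs; linarith
    simp [Complex.zero_cpow this]
  · rw [norm_div, norm_one, norm_natCast_cpow_of_pos hn]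
    gcongr
    exact_mod_cast hn

lemma strip_bound : ∃ B : ℝ, 0 < B ∧ ∀ s : ℂ, -1 ≤ s.re → s.re ≤ 2 →
    ‖completedRiemannZeta₀ s‖ ≤ B := by
  set P := HurwitzZeta.hurwitzEvenFEPair 0
  have hc : ∀ s : ℂ, MellinConvergent P.f_modif s := by
    intro s
    obtain ⟨r, hr⟩ := exists_gt s.re
    obtain ⟨r', hr'⟩ := exists_lt s.re
    have hS := P.isStrongFEPair_toStrongFEPair
    have e : P.toStrongFEPair.f = P.f_modif := rfl
    have a1 := hS.hf_top (-r)
    have a2 := hS.hf_zero (-r')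
    rw [e] at a1 a2
    exact mellinConvergent_of_isBigO_rpow P.hf_modif_int a1 hr a2 hr'
  have h1 := (hc (-1/2 : ℂ)).norm
  have h2 := (hc (1 : ℂ)).norm
  set B := ∫ x in Ioi (0:ℝ), (‖(x:ℂ) ^ ((-1/2 : ℂ) - 1) • P.f_modif x‖ + ‖(x:ℂ) ^ ((1 : ℂ) - 1) • P.f_modif x‖)
  have hB : 0 ≤ B := by positivity
  refine ⟨B + 1, by positivity, fun s hs1 hs2 => ?_⟩
  have e : completedRiemannZeta₀ s = mellin P.f_modif (s/2) / 2 := rfl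
  have key : ‖mellin P.f_modif (s/2)‖ ≤ B := by
    unfold mellin
    refine (norm_integral_le_integral_norm _).trans ?_
    refine setIntegral_mono_on (hc _).norm (h1.add h2) measurableSet_Ioi fun x hx => ?_
    have hx' : (0:ℝ) < x := hx
    simp only [norm_smul, norm_cpow_eq_rpow_re_of_pos hx']
    rw [← add_mul]
    gcongr
    have e1 : (s/2 - 1).re = s.re/2 - 1 := by simp
    have e2 : ((-1/2:ℂ) - 1).re = -1/2 - 1 := by
      rw [show ((-1/2:ℂ) - 1) = ((-1/2 - 1 : ℝ) : ℂ) by push_cast; ring, ofReal_re]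
    have e3 : ((1:ℂ) - 1).re = 1 - 1 := by simp
    rw [e1, e2, e3]
    rcases le_total 1 x with h | h
    · have := Real.rpow_le_rpow_of_exponent_le h (show s.re/2 - 1 ≤ 1 - 1 by linarith)
      have : 0 ≤ x ^ ((-1/2 - 1 : ℝ)) := by positivity
      linarith
    · have := Real.rpow_le_rpow_of_exponent_ge hx' h (show -1/2 - 1 ≤ s.re/2 - 1 by linarith)
      exact this.trans (le_add_of_nonneg_right (by positivity))
  rw [e, norm_div]
  simp
  linarith

lemma X_growth : ∃ C : ℝ, 0 < C ∧ ∀ s : ℂ, ‖X s‖ ≤ Real.exp (C * (1 + ‖s‖) ^ (3 / 2 : ℝ)) := by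
  obtain ⟨B₁, hB₁, hs⟩ := strip_bound
  obtain ⟨B₂, hB₂, hz⟩ := norm_zeta_le
  -- polynomial bound helper
  have hpoly : ∀ y : ℝ, 1 ≤ y → y ^ 2 ≤ Real.exp (2 * y ^ (3/2:ℝ)) := by
    intro y hy
    have h1 : y ≤ y ^ (3/2:ℝ) := by
      calc y = y ^ (1:ℝ) := (Real.rpow_one y).symm
        _ ≤ _ := Real.rpow_le_rpow_of_exponent_le hy (by norm_num)
    have h2 : y ≤ Real.exp y := by linarith [Real.add_one_le_exp y]
    calc y ^ 2 ≤ (Real.exp y)^2 := by gcongr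
      _ = Real.exp (2 * y) := by rw [← Real.exp_nat_mul]; simp
      _ ≤ _ := by apply Real.exp_le_exp.mpr; linarith
  have hnn : ∀ s : ℂ, ‖s‖ * ‖1 - s‖ ≤ (1 + ‖s‖)^2 := by
    intro s
    have : ‖1 - s‖ ≤ 1 + ‖s‖ := by simpa using norm_sub_le (1:ℂ) s
    nlinarith [norm_nonneg s]
  have hexp1 : ∀ b y : ℝ, 0 ≤ b → 1 ≤ y → b + 1 ≤ Real.exp (b * y ^ (3/2:ℝ)) := by
    intro b y hb hy
    have : 1 ≤ y ^ (3/2:ℝ) := Real.one_le_rpow hy (by norm_num)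
    calc b + 1 ≤ Real.exp b := Real.add_one_le_exp b
      _ ≤ _ := Real.exp_le_exp.mpr (by nlinarith)
  have hright : ∀ s : ℂ, -1 ≤ s.re → ‖X s‖ ≤ Real.exp ((4 + B₁ + B₂) * (1 + ‖s‖) ^ (3 / 2 : ℝ)) := by
    intro s h
    set y := 1 + ‖s‖
    have hy : 1 ≤ y := by have := norm_nonneg s; simp only [y]; linarith
    have hp := hpoly y hy
    have hn := hnn s
    rcases le_total s.re 2 with h2 | h2
    · have := hs s h h2
      have e : ‖X s‖ ≤ y^2 * B₁ + 1 := by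
        unfold X
        calc _ ≤ ‖s * (1-s) * completedRiemannZeta₀ s‖ + ‖(1:ℂ)‖ := norm_sub_le _ _
          _ ≤ y^2 * B₁ + 1 := by
            rw [norm_mul, norm_mul, norm_one]; gcongr
      have hy2 : 1 ≤ y ^ 2 := by nlinarith
      calc ‖X s‖ ≤ y^2 * (B₁ + 1) := by linarith
        _ ≤ Real.exp (2 * y ^ (3/2:ℝ)) * Real.exp (B₁ * y ^ (3/2:ℝ)) := by
            gcongr
            exact hexp1 _ _ hB₁.le hy
        _ = Real.exp ((2 + B₁) * y ^ (3/2:ℝ)) := by rw [← Real.exp_add]; ring_nf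
        _ ≤ _ := by
            apply Real.exp_le_exp.mpr
            exact mul_le_mul_of_nonneg_right (by linarith) (by positivity)
    · have h1 : s ≠ 1 := by rintro rfl; norm_num at h2
      rw [X_eq (by linarith) h1, norm_mul, norm_mul, norm_mul]
      have g1 := norm_Gammaℝ_le h2
      have g2 := hz s h2
      have g3 : s.re + 1 ≤ y := by have := Complex.re_le_norm s; simp only [y]; linarith
      calc _ ≤ y^2 * (Real.exp (2 * (s.re + 1) ^ (3 / 2 : ℝ)) * B₂) := by gcongr
        _ ≤ Real.exp (2 * y ^ (3/2:ℝ)) * (Real.exp (2 * y ^ (3 / 2 : ℝ)) * Real.exp (B₂ * y ^ (3/2:ℝ))) := by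
            gcongr
            linarith [hexp1 B₂ y hB₂.le hy]
        _ = Real.exp ((4 + B₂) * y ^ (3/2:ℝ)) := by rw [← Real.exp_add, ← Real.exp_add]; ring_nf
        _ ≤ _ := by
            apply Real.exp_le_exp.mpr
            exact mul_le_mul_of_nonneg_right (by linarith) (by positivity)
  refine ⟨(4 + B₁ + B₂) * 2 ^ (3/2:ℝ), by positivity, fun s => ?_⟩
  have hnn2 : 0 ≤ ‖s‖ := norm_nonneg s
  have hfin : Real.exp ((4 + B₁ + B₂) * (2 * (1 + ‖s‖)) ^ (3 / 2 : ℝ)) =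
      Real.exp ((4 + B₁ + B₂) * 2 ^ (3/2:ℝ) * (1 + ‖s‖) ^ (3 / 2 : ℝ)) := by
    rw [Real.mul_rpow (by norm_num) (by positivity)]; ring_nf
  rw [← hfin]
  rcases le_total (-1) s.re with h | h
  · refine (hright s h).trans ?_
    apply Real.exp_le_exp.mpr; gcongr; linarith
  · have := hright (1 - s) (by simp; linarith)
    rw [X_one_sub] at this
    refine this.trans ?_
    apply Real.exp_le_exp.mpr; gcongr
    have : ‖1 - s‖ ≤ 1 + ‖s‖ := by simpa using norm_sub_le (1:ℂ) s
    linarith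

end FZ

namespace FZ

/-- The index type of zeros of `X`. -/
abbrev ZI := {ρ : ℂ // X ρ = 0}

/-- multiplicity -/
noncomputable def mlt (ρ : ZI) : ℝ := (analyticOrderNatAt X ρ.1 : ℝ)

lemma mlt_nonneg (ρ : ZI) : 0 ≤ mlt ρ := Nat.cast_nonneg _

/-- `Re logarithmic derivative of X at (1/2+a+it)`. -/
noncomputable def FF (a t : ℝ) : ℝ := (logDeriv X (1 / 2 + a + t * I)).re

/-- Poisson kernel. -/
noncomputable def pk (a x : ℝ) : ℝ := a / (a ^ 2 + x ^ 2)

lemma pk_nonneg {a : ℝ} (ha : 0 ≤ a) (x : ℝ) : 0 ≤ pk a x := by unfold pk; positivity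

lemma zeros_finite (c : ℂ) (R : ℝ) : {ρ : ℂ | X ρ = 0 ∧ ‖ρ - c‖ ≤ R}.Finite := by
  refine ((isCompact_closedBall c R).inter_riemannZetaZeros_finite).subset ?_
  rintro ρ ⟨h1, h2⟩
  refine ⟨by simpa [dist_eq_norm] using h2, ?_⟩
  exact (X_zero_iff.mp h1).1

lemma logDeriv_X_refl (s : ℂ) :
    logDeriv X (1 - starRingEnd ℂ s) = - starRingEnd ℂ (logDeriv X s) := by
  have e1 : ∀ w, logDeriv X (1 - w) = - logDeriv X w := by
    intro w
    have h := logDeriv_comp (f := X) (g := fun z => 1 - z) (x := w) X_diff.differentiableAt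
      (by fun_prop)
    have e : X ∘ (fun z => 1 - z) = X := by ext z; exact X_one_sub z
    rw [e] at h
    simp at h
    rw [h]; ring
  have e2 : deriv X (starRingEnd ℂ s) = starRingEnd ℂ (deriv X s) := by
    have e : (starRingEnd ℂ ∘ X ∘ starRingEnd ℂ) = X := by
      ext z; simp [X_conj]
    have h := congrFun (deriv_conj_conj (𝕜 := ℂ) (f := X)) (starRingEnd ℂ s)
    rw [e] at h
    simpa using h
  rw [e1, logDeriv_apply, logDeriv_apply, e2, X_conj, map_div₀]

lemma re_one_div (a t : ℝ) (ρ : ℂ) (h : ρ.re = 1 / 2) :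
    (1 / ((1 / 2 + a + t * I : ℂ) - ρ)).re = pk a (t - ρ.im) := by
  rw [one_div, Complex.inv_re, Complex.normSq_apply]
  simp [h, pk]
  ring_nf

lemma re_one_div2 (a t : ℝ) (ρ : ℂ) (h : ρ.re = 1 / 2) :
    (1 / ((1 - starRingEnd ℂ (1 / 2 + a + t * I : ℂ)) - ρ)).re = - pk a (t - ρ.im) := by
  rw [one_div, Complex.inv_re, Complex.normSq_apply]
  simp [h, pk]
  ring_nf

lemma poisson_hasSum (hRH : RiemannHypothesis) {a : ℝ} (ha : 0 < a) (t : ℝ) :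
    HasSum (fun ρ : ZI => mlt ρ * pk a (t - ρ.1.im)) (FF a t) := by
  obtain ⟨C, hC, hgrow⟩ := X_growth
  set s : ℂ := 1 / 2 + a + t * I with hs
  set s' : ℂ := 1 - starRingEnd ℂ s with hs'
  have hsre : s.re = 1/2 + a := by simp [hs]
  have hXs : X s ≠ 0 := fun h => by have := X_zero_re hRH h; linarith
  have hXs' : X s' ≠ 0 := fun h => by
    have := X_zero_re hRH h; simp [hs', hsre] at this; linarith
  have hX2 : X 2 ≠ 0 := X_ne_zero_of_one_le (by norm_num)
  have hX2p : 0 < ‖X 2‖ := norm_pos_iff.mpr hX2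
  set C' := C * 6 ^ (3/2:ℝ) + |Real.log ‖X 2‖| with hC'
  have hC'0 : 0 < C' := by positivity
  -- truncated sums
  have hZfin : ∀ R : ℝ, {ρ : ZI | ‖ρ.1 - 2‖ ≤ R}.Finite := by
    intro R
    have := (zeros_finite 2 R).preimage (f := fun ρ : ZI => ρ.1) Subtype.val_injective.injOn
    refine this.subset ?_
    intro ρ hρ
    exact ⟨ρ.2, hρ⟩
  set Z : ℕ → Finset ZI := fun n => (hZfin n).toFinset with hZ
  have hZmono : Monotone Z := by
    intro m n hmn ρ hρ
    simp only [hZ, Set.Finite.mem_toFinset, mem_ofPred_eq] at hρ ⊢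
    have : (m:ℝ) ≤ n := by exact_mod_cast hmn
    linarith
  have hZtop : Tendsto Z atTop atTop := by
    refine tendsto_atTop_finset_of_monotone hZmono fun ρ => ?_
    obtain ⟨n, hn⟩ := exists_nat_ge ‖ρ.1 - 2‖
    exact ⟨n, by simp [hZ, hn]⟩
  set f := fun ρ : ZI => mlt ρ * pk a (t - ρ.1.im) with hf
  have hfnn : ∀ ρ, 0 ≤ f ρ := fun ρ => mul_nonneg (mlt_nonneg _) (pk_nonneg ha.le _)
  have hbound : ∀ᶠ n : ℕ in atTop, |2 * (FF a t - ∑ ρ ∈ Z n, f ρ)| ≤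
      64 * C' * ‖s - s'‖ * (n:ℝ) ^ (-(1/2) : ℝ) := by
    filter_upwards [eventually_ge_atTop 1, (tendsto_natCast_atTop_atTop (R := ℝ)).eventually_ge_atTop (8 * ‖s - 2‖),
      (tendsto_natCast_atTop_atTop (R := ℝ)).eventually_ge_atTop (8 * ‖s' - 2‖)] with n hn h1 h2
    have hn1 : (1:ℝ) ≤ n := by exact_mod_cast hn
    have hn0 : (0:ℝ) < n := by linarith
    have hK : 0 < C' * (n:ℝ) ^ (3/2:ℝ) := by positivity
    have hb : ∀ z : ℂ, ‖z - 2‖ ≤ 3 * n → ‖X z‖ ≤ Real.exp (C' * (n:ℝ) ^ (3/2:ℝ)) * ‖X 2‖ := by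
      intro z hz
      have hz' : 1 + ‖z‖ ≤ 6 * n := by
        have : ‖z‖ ≤ ‖z - 2‖ + ‖(2:ℂ)‖ := by simpa using norm_add_le (z - 2) 2
        simp at this; linarith
      have hn32 : 1 ≤ (n:ℝ) ^ (3/2:ℝ) := Real.one_le_rpow hn1 (by norm_num)
      calc ‖X z‖ ≤ Real.exp (C * (1 + ‖z‖) ^ (3 / 2 : ℝ)) := hgrow z
        _ ≤ Real.exp (C * (6 * n) ^ (3/2:ℝ)) := by gcongr
        _ = Real.exp (C * 6 ^ (3/2:ℝ) * (n:ℝ) ^ (3/2:ℝ)) := by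
            rw [Real.mul_rpow (by norm_num) hn0.le]; ring_nf
        _ = Real.exp (C * 6 ^ (3/2:ℝ) * (n:ℝ) ^ (3/2:ℝ)) * (Real.exp (-Real.log ‖X 2‖) * ‖X 2‖) := by
            rw [Real.exp_neg, Real.exp_log hX2p, inv_mul_cancel₀ hX2p.ne', mul_one]
        _ = Real.exp (C * 6 ^ (3/2:ℝ) * (n:ℝ) ^ (3/2:ℝ) + (-Real.log ‖X 2‖)) * ‖X 2‖ := by
            rw [Real.exp_add]; ring
        _ ≤ _ := by
            gcongr
            rw [hC', add_mul]
            gcongr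
            have := neg_le_abs (Real.log ‖X 2‖)
            nlinarith [abs_nonneg (Real.log ‖X 2‖)]
    have hl := hadamard_local (f := X) (c := 2) (R := n) (K := C' * (n:ℝ) ^ (3/2:ℝ)) (z₁ := s) (z₂ := s')
      X_diff hX2 hn0 hK hb ((zeros_finite 2 n).toFinset) (by intro ρ; simp) (by linarith) (by linarith)
      hXs hXs'
    have hsum : ∀ φ : ℂ → ℂ, ∑ ρ ∈ (zeros_finite 2 n).toFinset, φ ρ = ∑ ρ ∈ Z n, φ ρ.1 := by
      intro φ
      symm
      refine Finset.sum_nbij (fun ρ => ρ.1) ?_ ?_ ?_ ?_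
      · intro ρ hρ
        simp only [hZ, Set.Finite.mem_toFinset, mem_ofPred_eq] at hρ ⊢
        exact ⟨ρ.2, hρ⟩
      · exact Subtype.val_injective.injOn
      · intro ρ hρ
        simp only [Set.Finite.coe_toFinset, mem_ofPred_eq] at hρ
        exact ⟨⟨ρ, hρ.1⟩, by simp [hZ, hρ.2], rfl⟩
      · intros; rfl
    rw [hsum, hsum] at hl
    have hre := (Complex.abs_re_le_norm _).trans hl
    have e1 : (∑ ρ ∈ Z n, (analyticOrderNatAt X ρ.1 : ℂ) / (s - ρ.1)).re = ∑ ρ ∈ Z n, f ρ := by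
      rw [Complex.re_sum]
      refine Finset.sum_congr rfl fun ρ _ => ?_
      rw [div_eq_mul_one_div, ← Complex.ofReal_natCast, Complex.re_ofReal_mul,
        re_one_div a t _ (X_zero_re hRH ρ.2)]
      rfl
    have e2 : (∑ ρ ∈ Z n, (analyticOrderNatAt X ρ.1 : ℂ) / (s' - ρ.1)).re = - ∑ ρ ∈ Z n, f ρ := by
      rw [Complex.re_sum, ← Finset.sum_neg_distrib]
      refine Finset.sum_congr rfl fun ρ _ => ?_
      rw [div_eq_mul_one_div, ← Complex.ofReal_natCast, Complex.re_ofReal_mul,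
        re_one_div2 a t _ (X_zero_re hRH ρ.2)]
      simp [hf, mlt]
    have e3 : (logDeriv X s').re = - FF a t := by
      rw [hs', logDeriv_X_refl]; simp [FF, hs]
    have e4 : (logDeriv X s).re = FF a t := rfl
    simp only [Complex.sub_re, e1, e2, e3, e4] at hre
    have e5 : 64 * (C' * (n:ℝ) ^ (3/2:ℝ)) / (n:ℝ)^2 * ‖s - s'‖ =
        64 * C' * ‖s - s'‖ * (n:ℝ) ^ (-(1/2) : ℝ) := by
      have : (n:ℝ) ^ (3/2:ℝ) = (n:ℝ)^2 * (n:ℝ) ^ (-(1/2) : ℝ) := by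
        rw [← Real.rpow_natCast, ← Real.rpow_add hn0]; norm_num
      rw [this]; field_simp
    rw [e5] at hre
    rw [show 2 * (FF a t - ∑ ρ ∈ Z n, f ρ) = FF a t - ∑ ρ ∈ Z n, f ρ - (-FF a t - -∑ ρ ∈ Z n, f ρ) by ring]
    exact hre
  have hlim : Tendsto (fun n => ∑ ρ ∈ Z n, f ρ) atTop (nhds (FF a t)) := by
    have h0 : Tendsto (fun n : ℕ => 64 * C' * ‖s - s'‖ * (n:ℝ) ^ (-(1/2) : ℝ)) atTop (nhds 0) := by
      have := (tendsto_rpow_neg_atTop (y := 1/2) (by norm_num)).comp tendsto_natCast_atTop_atTop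
      simpa using this.const_mul (64 * C' * ‖s - s'‖)
    have h1 : Tendsto (fun n => 2 * (FF a t - ∑ ρ ∈ Z n, f ρ)) atTop (nhds 0) :=
      squeeze_zero_norm' (by simpa [Real.norm_eq_abs] using hbound) h0
    have h2 := (h1.const_mul (1/2)).const_sub (FF a t)
    simp only [mul_zero, sub_zero] at h2
    refine h2.congr fun n => by ring
  have hsummable : Summable f := by
    refine summable_of_sum_le hfnn (c := FF a t) fun u => ?_
    refine ge_of_tendsto hlim ?_
    filter_upwards [hZtop.eventually_ge_atTop u] with n hn
    exact Finset.sum_le_sum_of_subset_of_nonneg hn fun _ _ _ => hfnn _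
  have := hsummable.hasSum.comp hZtop
  rw [tendsto_nhds_unique hlim this]
  exact hsummable.hasSum

end FZ

namespace FZ

lemma deriv_tendsto_of_bounded {U : Set ℂ} (hU : IsOpen U) {f : ℕ → ℂ → ℂ} {g : ℂ → ℂ} {c : ℂ} {R B : ℝ}
    (hR : 0 < R) (hc : Metric.closedBall c R ⊆ U) (hf : ∀ᶠ n in atTop, DifferentiableOn ℂ (f n) U)
    (hg : DifferentiableOn ℂ g U) (hB : ∀ᶠ n in atTop, ∀ z ∈ Metric.closedBall c R, ‖f n z‖ ≤ B)
    (hlim : ∀ z ∈ U, Tendsto (fun n => f n z) atTop (nhds (g z))) :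
    Tendsto (fun n => deriv (f n) c) atTop (nhds (deriv g c)) := by
  have hsph : ∀ θ, circleMap c R θ ∈ Metric.closedBall c R := fun θ =>
    Metric.sphere_subset_closedBall (circleMap_mem_sphere c hR.le θ)
  have hmain : Tendsto (fun n => ∮ z in C(c, R), ((z - c) ^ 2)⁻¹ • f n z) atTop
      (nhds (∮ z in C(c, R), ((z - c) ^ 2)⁻¹ • g z)) := by
    unfold circleIntegral
    refine intervalIntegral.tendsto_integral_filter_of_dominated_convergence (fun _ => R * ((R^2)⁻¹ * B)) ?_ ?_ ?_ ?_
    · filter_upwards [hf] with n hn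
      have : Continuous fun θ => f n (circleMap c R θ) :=
        hn.continuousOn.comp_continuous (continuous_circleMap c R) fun θ => hc (hsph θ)
      have h2 : Continuous fun θ => ((circleMap c R θ - c) ^ 2)⁻¹ := by
        refine Continuous.inv₀ (by fun_prop) fun θ => ?_
        simp [hR.ne']
      have h3 : Continuous fun θ => deriv (circleMap c R) θ := by
        simp only [deriv_circleMap]; fun_prop
      exact (h3.smul (h2.smul this)).aestronglyMeasurable
    · filter_upwards [hB] with n hn
      refine ae_of_all _ fun θ _ => ?_
      have := hn _ (hsph θ)
      simp only [norm_smul, deriv_circleMap, norm_mul, norm_inv, norm_pow, norm_circleMap_zero,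
        Complex.norm_I, circleMap_sub_center, abs_of_pos hR, mul_one]
      gcongr
    · simp
    · refine ae_of_all _ fun θ _ => ?_
      have := hlim _ (hc (hsph θ))
      exact (this.const_smul _).const_smul _
  have e := fun (F : ℂ → ℂ) (hF : DifferentiableOn ℂ F U) =>
    two_pi_I_inv_smul_circleIntegral_sub_sq_inv_smul_of_differentiable hU hc hF (Metric.mem_ball_self hR)
  rw [← e g hg]
  refine (hmain.const_smul _).congr' ?_
  filter_upwards [hf] with n hn
  exact e _ hn

lemma norm_GammaSeq_le {s : ℂ} (hs : 0 < s.re) {n : ℕ} (hn : n ≠ 0) :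
    ‖Complex.GammaSeq s n‖ ≤ Real.Gamma s.re := by
  rw [Complex.GammaSeq_eq_approx_Gamma_integral hs hn]
  have hintg := Real.GammaIntegral_convergent hs
  have hn0 : (0:ℝ) ≤ n := n.cast_nonneg
  have hsub : Ioc (0:ℝ) n ⊆ Ioi 0 := Ioc_subset_Ioi_self
  calc _ ≤ ∫ x in (0:ℝ)..n, Real.exp (-x) * x ^ (s.re - 1) := by
        refine intervalIntegral.norm_integral_le_of_norm_le hn0 ?_ ?_
        · refine ae_of_all _ fun x hx => ?_
          have hx0 : 0 < x := hx.1
          rw [norm_mul, norm_cpow_eq_rpow_re_of_pos hx0, Complex.norm_real, Real.norm_eq_abs, abs_of_nonneg]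
          · have : (s - 1).re = s.re - 1 := by simp
            rw [this]
            gcongr
            exact Real.one_sub_div_pow_le_exp_neg hx.2
          · apply pow_nonneg
            have : x / n ≤ 1 := div_le_one_of_le₀ hx.2 hn0
            linarith
        · rw [intervalIntegrable_iff_integrableOn_Ioc_of_le hn0]
          exact hintg.mono_set hsub
    _ = ∫ x in Ioc (0:ℝ) n, Real.exp (-x) * x ^ (s.re - 1) := intervalIntegral.integral_of_le hn0
    _ ≤ ∫ x in Ioi (0:ℝ), Real.exp (-x) * x ^ (s.re - 1) := by
        refine setIntegral_mono_set hintg ?_ (LE.le.eventuallyLE hsub)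
        filter_upwards [ae_restrict_mem measurableSet_Ioi] with x hx
        have : 0 < x := hx
        simp only [Pi.zero_apply]
        positivity
    _ = _ := (Real.Gamma_eq_integral hs).symm

lemma add_nat_ne {z : ℂ} (hz : 0 < z.re) (j : ℕ) : z + j ≠ 0 := by
  intro h
  have := congrArg Complex.re h
  simp at this
  have : (0:ℝ) ≤ j := j.cast_nonneg
  linarith

lemma GammaSeq_diff {z : ℂ} (hz : 0 < z.re) {n : ℕ} (hn : n ≠ 0) :
    DifferentiableAt ℂ (fun s => Complex.GammaSeq s n) z ∧ Complex.GammaSeq z n ≠ 0 ∧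
    logDeriv (fun s => Complex.GammaSeq s n) z = Real.log n - ∑ j ∈ Finset.range (n + 1), 1 / (z + j) := by
  have hn' : (n:ℂ) ≠ 0 := by exact_mod_cast hn
  have hf : ((Nat.factorial n : ℕ) : ℂ) ≠ 0 := by exact_mod_cast n.factorial_ne_zero
  have hprod : ∏ j ∈ Finset.range (n + 1), (z + j) ≠ 0 :=
    Finset.prod_ne_zero_iff.mpr fun j _ => add_nat_ne hz j
  have d1 : HasDerivAt (fun s : ℂ => (n:ℂ) ^ s) ((n:ℂ)^z * Complex.log n * 1) z :=
    (hasDerivAt_id z).const_cpow (Or.inl hn')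
  have d2 : DifferentiableAt ℂ (fun s : ℂ => (n:ℂ) ^ s * (Nat.factorial n : ℂ)) z :=
    d1.differentiableAt.mul_const _
  have d3 : DifferentiableAt ℂ (fun s : ℂ => ∏ j ∈ Finset.range (n + 1), (s + j)) z := by
    fun_prop
  have hnz : (n:ℂ)^z ≠ 0 := by simp [Complex.cpow_eq_zero_iff, hn']
  refine ⟨d2.div d3 hprod, ?_, ?_⟩
  · unfold Complex.GammaSeq
    exact div_ne_zero (mul_ne_zero hnz hf) hprod
  · have : (fun s => Complex.GammaSeq s n) =
      fun s : ℂ => ((n:ℂ) ^ s * (Nat.factorial n : ℂ)) / (∏ j ∈ Finset.range (n + 1), (s + j)) := rfl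
    rw [this, logDeriv_div (f := fun s : ℂ => (n:ℂ) ^ s * (Nat.factorial n : ℂ)) z (mul_ne_zero hnz hf) hprod d2 d3,
      logDeriv_prod (f := fun (j : ℕ) (s : ℂ) => s + j) (fun j _ => add_nat_ne hz j) (fun j _ => by fun_prop)]
    congr 1
    · rw [logDeriv_mul_const z _ hf, logDeriv_apply, d1.deriv, mul_one, mul_div_cancel_left₀ _ hnz]
      simp
    · refine Finset.sum_congr rfl fun j _ => ?_
      rw [logDeriv_apply]; simp

/-- the approximants to the digamma function -/
lemma digamma_tendsto {z : ℂ} (hz : 0 < z.re) :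
    Tendsto (fun n : ℕ => (Real.log n : ℂ) - ∑ j ∈ Finset.range (n + 1), 1 / (z + j)) atTop
      (nhds (Complex.digamma z)) := by
  set U : Set ℂ := {w | 0 < w.re}
  have hU : IsOpen U := isOpen_lt continuous_const continuous_re
  have hre : ∀ w ∈ Metric.closedBall z (z.re/2), w.re ∈ Icc (z.re/2) (3*z.re/2) := by
    intro w hw
    rw [Metric.mem_closedBall, dist_eq_norm] at hw
    have := (Complex.abs_re_le_norm (w - z)).trans hw
    rw [abs_le] at this
    simp at this
    constructor <;> linarith
  have hGc : ContinuousOn Real.Gamma (Icc (z.re/2) (3*z.re/2)) := by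
    intro x hx
    refine (Real.differentiableAt_Gamma fun m => ?_).continuousAt.continuousWithinAt
    have : (0:ℝ) ≤ m := m.cast_nonneg
    have := hx.1
    intro h; linarith
  obtain ⟨B, hB⟩ := (isCompact_Icc.image_of_continuousOn hGc).bddAbove
  have hgd : DifferentiableOn ℂ Complex.Gamma U := by
    intro w hw
    refine (Complex.differentiableAt_Gamma w fun m h => ?_).differentiableWithinAt
    have hw' : 0 < w.re := hw
    rw [h] at hw'
    simp at hw'
    have : (0:ℝ) ≤ m := m.cast_nonneg
    linarith
  have hd := deriv_tendsto_of_bounded (f := fun n s => Complex.GammaSeq s n) (g := Complex.Gamma) (c := z)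
    (R := z.re/2) (B := B) hU (by linarith)
    (by intro w hw; have := (hre w hw).1; change 0 < w.re; linarith)
    (by
      filter_upwards [eventually_ne_atTop 0] with n hn
      intro w hw
      exact (GammaSeq_diff hw hn).1.differentiableWithinAt)
    hgd
    (by
      filter_upwards [eventually_ne_atTop 0] with n hn
      intro w hw
      have h1 := hre w hw
      exact (norm_GammaSeq_le (by linarith [h1.1]) hn).trans (hB ⟨_, h1, rfl⟩))
    (fun w _ => Complex.GammaSeq_tendsto_Gamma w)
  have hG0 : Complex.Gamma z ≠ 0 := Complex.Gamma_ne_zero_of_re_pos hz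
  have := hd.div (Complex.GammaSeq_tendsto_Gamma z) hG0
  have e : Complex.digamma z = deriv Complex.Gamma z / Complex.Gamma z := by
    rw [Complex.digamma_def, logDeriv_apply]
  rw [e]
  refine this.congr' ?_
  filter_upwards [eventually_ne_atTop 0] with n hn
  have := (GammaSeq_diff hz hn).2.2
  rw [logDeriv_apply] at this
  simpa using this

lemma digamma_re_tendsto {z : ℂ} (hz : 0 < z.re) :
    Tendsto (fun n : ℕ => Real.log n - ∑ j ∈ Finset.range (n + 1), (z.re + j) / ((z.re + j)^2 + z.im^2)) atTop
      (nhds (Complex.digamma z).re) := by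
  have := (Complex.continuous_re.tendsto _).comp (digamma_tendsto hz)
  refine this.congr fun n => ?_
  simp only [Function.comp, Complex.sub_re, Complex.ofReal_re, Complex.re_sum]
  congr 1
  refine Finset.sum_congr rfl fun j _ => ?_
  rw [one_div, Complex.inv_re, Complex.normSq_apply]
  simp
  ring_nf

lemma digamma_re_mono {x y y' : ℝ} (hx : 0 < x) (hy : 0 ≤ y) (hyy : y ≤ y') :
    (Complex.digamma (x + y * I)).re ≤ (Complex.digamma (x + y' * I)).re := by
  have h1 := digamma_re_tendsto (z := x + y * I) (by simpa using hx)
  have h2 := digamma_re_tendsto (z := x + y' * I) (by simpa using hx)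
  refine le_of_tendsto_of_tendsto' h1 h2 fun n => ?_
  have hre : ∀ y : ℝ, ((x:ℂ) + y * I).re = x := fun y => by simp
  have him : ∀ y : ℝ, ((x:ℂ) + y * I).im = y := fun y => by simp
  simp only [hre, him]
  refine sub_le_sub_left (Finset.sum_le_sum (fun j _ => ?_)) _
  gcongr

lemma digamma_re_le {z : ℂ} (hz : 1/2 ≤ z.re) :
    (Complex.digamma z).re ≤ 8 + Real.log (1 + ‖z‖) := by
  have hz0 : 0 < z.re := by linarith
  have hzn : 0 < ‖z‖ := lt_of_lt_of_le hz0 (Complex.re_le_norm z)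
  set N := ⌈‖z‖⌉₊
  have hN1 : ‖z‖ ≤ N := Nat.le_ceil _
  have hN2 : (N:ℝ) ≤ 1 + ‖z‖ := by have := (Nat.ceil_lt_add_one hzn.le).le; linarith
  have hN0 : N ≠ 0 := by
    intro h
    rw [h] at hN1; simp at hN1; rw [hN1] at hzn; simp at hzn
  refine le_of_tendsto (digamma_re_tendsto hz0) ?_
  filter_upwards [eventually_gt_atTop N] with n hn
  set u : ℕ → ℝ := fun j => (z.re + j) / ((z.re + j)^2 + z.im^2)
  have hu : ∀ j, 0 ≤ u j := fun j => by
    have : (0:ℝ) ≤ j := j.cast_nonneg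
    simp only [u]; positivity
  have hharm : ∀ k : ℕ, ((harmonic k : ℚ) : ℝ) = ∑ j ∈ Finset.range k, 1 / ((j:ℝ) + 1) := by
    intro k; simp [harmonic]
  have h1 : Real.log n ≤ ∑ j ∈ Finset.range n, 1 / ((j:ℝ) + 1) := by
    rw [← hharm]
    have h0 := log_add_one_le_harmonic n
    have : Real.log n ≤ Real.log (n+1) := by
      apply Real.log_le_log
      · have : 0 < n := by omega
        exact_mod_cast this
      · linarith
    push_cast at h0
    linarith
  have hterm : ∀ j : ℕ, 1 / ((j:ℝ) + 1) - u j ≤ 3 * ‖z‖ * (((j:ℝ) + 1) ^ 2)⁻¹ := by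
    intro j
    have hj : (0:ℝ) ≤ j := j.cast_nonneg
    set v := z.re + j with hv
    have hv0 : 0 < v := by positivity
    have hvj : ((j:ℝ) + 1) / 2 ≤ v := by rw [hv]; linarith
    have hx : z.re ≤ ‖z‖ := Complex.re_le_norm z
    have hy : |z.im| ≤ ‖z‖ := Complex.abs_im_le_norm z
    set D := v^2 + z.im^2 with hD
    have hD0 : 0 < D := by positivity
    have e : 1 / ((j:ℝ) + 1) - u j = (D - v * ((j:ℝ)+1)) / (((j:ℝ)+1) * D) := by
      change 1 / ((j:ℝ) + 1) - v / D = _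
      field_simp
    rw [e]
    have e2 : D - v * ((j:ℝ)+1) ≤ ‖z‖ * (v + |z.im|) := by
      have : z.im^2 = |z.im| * |z.im| := by rw [← sq, sq_abs]
      rw [hD, this]
      have h4 : v * v - v * (j+1) ≤ ‖z‖ * v := by
        have : v - (j+1) ≤ ‖z‖ := by rw [hv]; linarith
        nlinarith
      nlinarith [abs_nonneg z.im]
    have e3 : (v + |z.im|) * ((j:ℝ)+1) ≤ 3 * D := by
      have : z.im^2 = |z.im| * |z.im| := by rw [← sq, sq_abs]
      rw [hD, this]
      nlinarith [abs_nonneg z.im, sq_nonneg (v - |z.im|)]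
    rw [div_le_iff₀ (by positivity)]
    have e4 : 3 * ‖z‖ * (((j:ℝ) + 1) ^ 2)⁻¹ * (((j:ℝ) + 1) * D) = ‖z‖ * (3 * D) / ((j:ℝ) + 1) := by
      field_simp
    rw [e4, le_div_iff₀ (by positivity)]
    calc _ ≤ ‖z‖ * (v + |z.im|) * ((j:ℝ)+1) := by gcongr
      _ = ‖z‖ * ((v + |z.im|) * ((j:ℝ)+1)) := by ring
      _ ≤ _ := by gcongr
  have hsplit : ∑ j ∈ Finset.range n, (1 / ((j:ℝ) + 1) - u j) ≤
      ∑ j ∈ Finset.range N, 1 / ((j:ℝ) + 1) + ∑ j ∈ Finset.Ico N n, 3 * ‖z‖ * (((j:ℝ) + 1) ^ 2)⁻¹ := by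
    rw [← Finset.sum_range_add_sum_Ico _ hn.le]
    gcongr with j _ j _
    · linarith [hu j]
    · exact hterm j
  have hH : ∑ j ∈ Finset.range N, 1 / ((j:ℝ) + 1) ≤ 1 + Real.log (1 + ‖z‖) := by
    rw [← hharm]
    refine (harmonic_le_one_add_log N).trans ?_
    gcongr
  have hT : ∑ j ∈ Finset.Ico N n, 3 * ‖z‖ * (((j:ℝ) + 1) ^ 2)⁻¹ ≤ 6 := by
    rw [← Finset.mul_sum]
    have h5 : ∑ j ∈ Finset.Ico N n, (((j:ℝ) + 1) ^ 2)⁻¹ = ∑ i ∈ Finset.Ioo N (n+1), ((i:ℝ)^2)⁻¹ := by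
      rw [show Finset.Ioo N (n+1) = Finset.Ico (N+1) (n+1) by ext; simp]
      rw [← Finset.sum_Ico_add' (fun i : ℕ => ((i:ℝ)^2)⁻¹) N n 1]
      simp
    have h6 := sum_Ioo_inv_sq_le (α := ℝ) N (n+1)
    rw [h5]
    calc 3 * ‖z‖ * ∑ i ∈ Finset.Ioo N (n+1), ((i:ℝ)^2)⁻¹ ≤ 3 * ‖z‖ * (2 / (N + 1)) := by
          exact mul_le_mul_of_nonneg_left h6 (by positivity)
      _ ≤ 6 := by
        rw [← mul_div_assoc, div_le_iff₀ (by positivity)]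
        linarith
  have h7 : ∑ j ∈ Finset.range (n+1), u j = ∑ j ∈ Finset.range n, u j + u n := Finset.sum_range_succ _ _
  rw [Finset.sum_sub_distrib] at hsplit
  change Real.log n - ∑ j ∈ Finset.range (n+1), u j ≤ _
  rw [h7]
  linarith [hu n]

end FZ

namespace FZ

lemma logDeriv_Gammaℝ {s : ℂ} (hs : 0 < s.re) :
    logDeriv Gammaℝ s = -(Real.log π : ℂ) / 2 + Complex.digamma (s / 2) / 2 := by
  have hpi : (π:ℂ) ≠ 0 := by exact_mod_cast Real.pi_ne_zero
  have e : Gammaℝ = fun s => (π:ℂ) ^ (-s / 2) * Complex.Gamma (s / 2) := by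
    ext s; exact Gammaℝ_def s
  have hs2 : 0 < (s/2).re := by simpa using hs
  have hG : DifferentiableAt ℂ Complex.Gamma (s/2) := by
    refine Complex.differentiableAt_Gamma _ ?_
    intro m hm
    rw [hm] at hs2
    simp at hs2
    have : (0:ℝ) ≤ m := m.cast_nonneg
    linarith
  have d1 : HasDerivAt (fun s : ℂ => (π:ℂ) ^ (-s/2)) ((π:ℂ)^(-s/2) * Complex.log π * (-1/2)) s :=
    ((hasDerivAt_neg s).div_const 2).const_cpow (Or.inl hpi)
  have hnz : (π:ℂ)^(-s/2) ≠ 0 := by simp [Complex.cpow_eq_zero_iff, hpi]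
  have hGz : Complex.Gamma (s/2) ≠ 0 := Complex.Gamma_ne_zero_of_re_pos hs2
  have hdc : DifferentiableAt ℂ (fun s : ℂ => Complex.Gamma (s/2)) s :=
    DifferentiableAt.comp s (g := Complex.Gamma) (f := fun s => s / 2) hG (by fun_prop)
  rw [e, logDeriv_mul (f := fun s : ℂ => (π:ℂ) ^ (-s/2)) (g := fun s : ℂ => Complex.Gamma (s/2)) s hnz hGz d1.differentiableAt hdc]
  congr 1
  · rw [logDeriv_apply, d1.deriv, Complex.ofReal_log Real.pi_nonneg]
    field_simp
  · have := logDeriv_comp (f := Complex.Gamma) (g := fun s : ℂ => s/2) (x := s) hG (by fun_prop)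
    have e2 : (fun s : ℂ => Complex.Gamma (s/2)) = Complex.Gamma ∘ (fun s => s/2) := rfl
    rw [e2, this, Complex.digamma_def]
    simp; ring

lemma logDeriv_X {s : ℂ} (hs : 1 < s.re) :
    logDeriv X s = 1 / s + 1 / (s - 1) + (-(Real.log π : ℂ) / 2 + Complex.digamma (s / 2) / 2)
      - LSeries (fun n => (ArithmeticFunction.vonMangoldt n : ℂ)) s := by
  have h1 : s ≠ 1 := by rintro rfl; simp at hs
  have hs0 : s ≠ 0 := by rintro rfl; simp at hs; linarith
  have h2 : 1 - s ≠ 0 := sub_ne_zero.mpr (Ne.symm h1)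
  have hz := riemannZeta_ne_zero_of_one_le_re hs.le
  have hG := Gammaℝ_ne_zero_of_re_pos (s := s) (by linarith)
  have e : X =ᶠ[nhds s] fun z => (z * (1 - z)) * (Gammaℝ z * riemannZeta z) := by
    have hopen : IsOpen {z : ℂ | 0 < z.re ∧ z ≠ 1} :=
      (isOpen_lt continuous_const continuous_re).inter isOpen_ne
    filter_upwards [hopen.mem_nhds ⟨by linarith, h1⟩] with z hz
    rw [X_eq hz.1 hz.2]
  have dG := (Gammaℝ_analyticAt (s := s) (by linarith)).differentiableAt
  have dz := differentiableAt_riemannZeta h1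
  rw [(logDeriv_congr_nhds e).eq_of_nhds,
    logDeriv_mul (f := fun z : ℂ => z * (1 - z)) (g := fun z => Gammaℝ z * riemannZeta z) s
      (mul_ne_zero hs0 h2) (mul_ne_zero hG hz) (by fun_prop) (dG.mul dz),
    logDeriv_mul (f := Gammaℝ) (g := riemannZeta) s hG hz dG dz,
    logDeriv_mul (f := fun z : ℂ => z) (g := fun z : ℂ => 1 - z) s hs0 h2 (by fun_prop) (by fun_prop),
    logDeriv_Gammaℝ (by linarith)]
  have e1 : logDeriv (fun z : ℂ => z) s = 1 / s := by rw [logDeriv_apply]; simp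
  have e2 : logDeriv (fun z : ℂ => 1 - z) s = 1 / (s - 1) := by
    rw [logDeriv_apply]
    simp
    rw [← neg_sub s 1, neg_div_neg_eq, one_div]
  have e3 := ArithmeticFunction.LSeries_vonMangoldt_eq_deriv_riemannZeta_div hs
  rw [e1, e2, logDeriv_apply, e3]
  ring

/-- von Mangoldt as a real function. -/
noncomputable abbrev vM (n : ℕ) : ℝ := ArithmeticFunction.vonMangoldt n

lemma vM_nonneg (n : ℕ) : 0 ≤ vM n := ArithmeticFunction.vonMangoldt_nonneg

lemma LS_hasSum {σ t : ℝ} (hσ : 1 < σ) :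
    HasSum (fun n : ℕ => vM n * (n:ℝ) ^ (-σ) * Real.cos (t * Real.log n))
      (LSeries (fun n => (ArithmeticFunction.vonMangoldt n : ℂ)) (σ + t * I)).re := by
  have hs := ArithmeticFunction.LSeriesSummable_vonMangoldt (s := σ + t * I) (by simpa using hσ)
  have := Complex.hasSum_re hs.LSeriesHasSum
  convert this using 1
  ext n
  rcases eq_or_ne n 0 with rfl | hn
  · simp
  · have hn' : (n:ℂ) ≠ 0 := by exact_mod_cast hn
    have hn0 : (0:ℝ) < n := by exact_mod_cast Nat.pos_of_ne_zero hn
    rw [LSeries.term_of_ne_zero hn, div_eq_mul_inv, ← Complex.cpow_neg, Complex.re_ofReal_mul,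
      Complex.cpow_def_of_ne_zero hn', Complex.exp_re, ← Complex.ofReal_natCast,
      ← Complex.ofReal_log hn0.le, Real.rpow_def_of_pos hn0, mul_assoc]
    have q1 : (((Real.log n : ℝ) : ℂ) * -((σ:ℂ) + t * I)).re = Real.log n * -σ := by
      rw [Complex.re_ofReal_mul]; simp
    have q2 : (((Real.log n : ℝ) : ℂ) * -((σ:ℂ) + t * I)).im = -(t * Real.log n) := by
      rw [Complex.im_ofReal_mul]; simp; ring
    rw [q1, q2, Real.cos_neg]

lemma vM_summable : Summable (fun n : ℕ => vM n * (n:ℝ) ^ (-(3/2) : ℝ)) := by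
  have := (LS_hasSum (σ := 3/2) (t := 0) (by norm_num)).summable
  simpa using this


lemma vM_summable' {σ : ℝ} (hσ : 1 < σ) : Summable (fun n : ℕ => vM n * (n:ℝ) ^ (-σ)) := by
  have := (LS_hasSum (σ := σ) (t := 0) hσ).summable
  simpa using this

lemma FF_le : ∃ C : ℝ, 1 ≤ C ∧ ∀ a t : ℝ, 1 ≤ a → FF a t ≤ C * (1 + Real.log (1 + a + |t|)) := by
  set V := ∑' n : ℕ, vM n * (n:ℝ) ^ (-(3/2) : ℝ)
  have hV : 0 ≤ V := tsum_nonneg fun n => mul_nonneg (vM_nonneg n) (by positivity)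
  refine ⟨10 + V, by linarith, fun a t ha => ?_⟩
  set s : ℂ := 1 / 2 + a + t * I with hs
  have hsre : s.re = 1/2 + a := by simp [hs]
  have hsim : s.im = t := by simp [hs]
  have hre : ∀ z : ℂ, 1/2 ≤ z.re → (1 / z).re ≤ 2 := by
    intro z hz
    have h1 : 1/2 ≤ ‖z‖ := hz.trans (Complex.re_le_norm z)
    calc (1/z).re ≤ ‖1/z‖ := Complex.re_le_norm _
      _ = 1 / ‖z‖ := by simp
      _ ≤ 1 / (1/2) := by gcongr
      _ = 2 := by norm_num
  have h1 := hre s (by linarith)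
  have h2 := hre (s - 1) (by simp [hsre]; linarith)
  have h3 : (Complex.digamma (s/2)).re ≤ 8 + Real.log (1 + a + |t|) := by
    refine (digamma_re_le (by simp [hsre]; linarith)).trans ?_
    have : ‖s/2‖ ≤ a + |t| := by
      rw [norm_div]
      have := Complex.norm_le_abs_re_add_abs_im s
      rw [hsre, hsim, abs_of_pos (by linarith : 0 < 1/2 + a)] at this
      simp
      have := abs_nonneg t
      linarith
    have : Real.log (1 + ‖s/2‖) ≤ Real.log (1 + a + |t|) := by
      apply Real.log_le_log (by positivity)
      linarith
    linarith
  have h4 : - (LSeries (fun n => (ArithmeticFunction.vonMangoldt n : ℂ)) s).re ≤ V := by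
    have hh := LS_hasSum (σ := 1/2 + a) (t := t) (by linarith)
    have es : ((1/2 + a : ℝ) : ℂ) + t * I = s := by rw [hs]; push_cast; ring
    rw [es] at hh
    have hg := (vM_summable.hasSum).neg
    have : -V ≤ (LSeries (fun n => (ArithmeticFunction.vonMangoldt n : ℂ)) s).re := by
      refine hasSum_le (fun n => ?_) hg hh
      rcases Nat.eq_zero_or_pos n with rfl | hn
      · simp
      have hn1 : (1:ℝ) ≤ n := by exact_mod_cast hn
      have h5 : (n:ℝ) ^ (-(1/2 + a)) ≤ (n:ℝ) ^ (-(3/2) : ℝ) :=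
        Real.rpow_le_rpow_of_exponent_le hn1 (by linarith)
      have h6 : 0 ≤ (n:ℝ) ^ (-(1/2 + a)) := by positivity
      have h7 := vM_nonneg n
      have h8 := Real.neg_one_le_cos (t * Real.log n)
      have h9 : vM n * (n:ℝ) ^ (-(1/2 + a)) ≤ vM n * (n:ℝ) ^ (-(3/2) : ℝ) := by gcongr
      have h10 : 0 ≤ vM n * (n:ℝ) ^ (-(1/2 + a)) := by positivity
      nlinarith
    linarith
  have hlog : 0 ≤ Real.log (1 + a + |t|) := Real.log_nonneg (by have := abs_nonneg t; linarith)
  have hlp : 0 ≤ Real.log π := Real.log_nonneg (by linarith [Real.pi_gt_three])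
  have e : FF a t = (1/s).re + (1/(s-1)).re + (-Real.log π / 2 + (Complex.digamma (s/2)).re/2)
      - (LSeries (fun n => (ArithmeticFunction.vonMangoldt n : ℂ)) s).re := by
    have : FF a t = (logDeriv X s).re := rfl
    rw [this, logDeriv_X (by linarith)]
    simp
  rw [e]
  nlinarith

/-- archimedean part -/
noncomputable def AA (t : ℝ) : ℝ := -Real.log π / 2 + (Complex.digamma (3/4 + (t/2 : ℝ) * I)).re / 2

lemma FF_one (t : ℝ) : FF 1 t = pk (3/2) t + pk (1/2) t + AA t
    - ∑' n : ℕ, vM n * (n:ℝ) ^ (-(3/2) : ℝ) * Real.cos (t * Real.log n) := by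
  set s : ℂ := 1 / 2 + (1:ℝ) + t * I with hs
  have hsre : s.re = 3/2 := by simp [hs]; norm_num
  have hsim : s.im = t := by simp [hs]
  have : FF 1 t = (logDeriv X s).re := rfl
  rw [this, logDeriv_X (by rw [hsre]; norm_num)]
  have hh := LS_hasSum (σ := 3/2) (t := t) (by norm_num)
  have es : ((3/2 : ℝ) : ℂ) + t * I = s := by rw [hs]; push_cast; ring
  rw [es] at hh
  rw [hh.tsum_eq]
  have e1 : (1/s).re = pk (3/2) t := by
    rw [one_div, Complex.inv_re, Complex.normSq_apply, hsre, hsim, pk]; ring_nf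
  have e2 : (1/(s-1)).re = pk (1/2) t := by
    rw [one_div, Complex.inv_re, Complex.normSq_apply, pk]
    simp [hsre, hsim]; norm_num; ring_nf
  have e3 : s/2 = 3/4 + (t/2 : ℝ) * I := by rw [hs]; push_cast; ring
  simp only [Complex.sub_re, Complex.add_re, e1, e2, e3, AA]
  simp

lemma AA_mono : MonotoneOn AA (Ici 0) := by
  intro t ht t' _ h
  have ht0 : 0 ≤ t := ht
  have := digamma_re_mono (x := 3/4) (y := t/2) (y' := t'/2) (by norm_num) (by linarith) (by linarith)
  unfold AA
  have e : ((3/4 : ℝ) : ℂ) = 3/4 := by push_cast; rfl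
  rw [e] at this
  linarith

lemma digamma_analyticAt {z : ℂ} (hz : 0 < z.re) : AnalyticAt ℂ Complex.digamma z := by
  have hU : IsOpen {w : ℂ | 0 < w.re} := isOpen_lt continuous_const continuous_re
  have hgd : DifferentiableOn ℂ Complex.Gamma {w : ℂ | 0 < w.re} := by
    intro w hw
    refine (Complex.differentiableAt_Gamma w fun m h => ?_).differentiableWithinAt
    have hw' : 0 < w.re := hw
    rw [h] at hw'
    simp at hw'
    have : (0:ℝ) ≤ m := m.cast_nonneg
    linarith
  have h1 : AnalyticAt ℂ Complex.Gamma z := hgd.analyticAt (hU.mem_nhds hz)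
  rw [Complex.digamma_def]
  exact h1.deriv.div h1 (Complex.Gamma_ne_zero_of_re_pos hz)

lemma AA_contDiff : ContDiff ℝ 1 AA := by
  rw [contDiff_iff_contDiffAt]
  intro t
  unfold AA
  have h1 : ContDiffAt ℂ 1 Complex.digamma (3/4 + (t/2 : ℝ) * I) :=
    (digamma_analyticAt (by simp)).contDiffAt
  have h2 : ContDiffAt ℝ 1 Complex.digamma (3/4 + (t/2 : ℝ) * I) := h1.restrict_scalars ℝ
  have h3 : ContDiffAt ℝ 1 (fun t : ℝ => (3/4 + (t/2 : ℝ) * I : ℂ)) t := by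
    have : ContDiff ℝ 1 (fun t : ℝ => ((t/2 : ℝ) : ℂ)) :=
      Complex.ofRealCLM.contDiff.comp (contDiff_id.div_const 2)
    exact (contDiff_const.add (this.mul contDiff_const)).contDiffAt
  have h4 := h2.comp t h3
  have h5 : ContDiffAt ℝ 1 (fun t : ℝ => (Complex.digamma (3/4 + (t/2 : ℝ) * I)).re) t :=
    (Complex.reCLM.contDiff.contDiffAt).comp t h4
  exact contDiffAt_const.add (h5.div_const 2)

lemma AA_le : ∀ t : ℝ, 0 ≤ t → AA t ≤ 4 + Real.log (2 + t) := by
  intro t ht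
  have h := digamma_re_le (z := 3/4 + (t/2 : ℝ) * I) (by simp; norm_num)
  have hn : ‖(3/4 + (t/2 : ℝ) * I : ℂ)‖ ≤ 1 + t := by
    refine (Complex.norm_le_abs_re_add_abs_im _).trans ?_
    simp
    norm_num
    rw [abs_of_nonneg (by linarith)]
    linarith
  have h2 : Real.log (1 + ‖(3/4 + (t/2 : ℝ) * I : ℂ)‖) ≤ Real.log (2 + t) := by
    apply Real.log_le_log (by positivity); linarith
  have hlp : 0 ≤ Real.log π := Real.log_nonneg (by linarith [Real.pi_gt_three])
  have hl : 0 ≤ Real.log (2 + t) := Real.log_nonneg (by linarith)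
  unfold AA
  linarith

end FZ

namespace FZ
open scoped FourierTransform

lemma kernel_fourier (w : ℝ) :
    𝓕 (fun x : ℝ => (Real.exp (-(2 * π) * |x|) : ℂ)) w = ((1 / π * (1 + w^2)⁻¹ : ℝ) : ℂ) ∧
    Integrable (fun x : ℝ => (Real.exp (-(2 * π) * |x|) : ℂ)) := by
  have hpi := Real.pi_pos
  set G : ℝ → ℝ → ℂ := fun w x => cexp (↑(-2 * π * x * w) * I) • (Real.exp (-(2 * π) * |x|) : ℂ) with hG
  have e1 : ∀ w, EqOn (G w) (fun x : ℝ => cexp ((-(2*π) * (1 + w * I) : ℂ) * x)) (Ioi 0) := by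
    intro w x hx
    simp only [hG]
    rw [abs_of_pos hx, smul_eq_mul, Complex.ofReal_exp, ← Complex.exp_add]
    congr 1; push_cast; ring
  have e2 : ∀ w, EqOn (G w) (fun x : ℝ => cexp (((2*π) * (1 - w * I) : ℂ) * x)) (Iic 0) := by
    intro w x hx
    simp only [hG]
    rw [abs_of_nonpos hx, smul_eq_mul, Complex.ofReal_exp, ← Complex.exp_add]
    congr 1; push_cast; ring
  have r1 : ∀ w : ℝ, ((-(2*π) * (1 + w * I) : ℂ)).re < 0 := by intro w; simp [hpi]
  have r2 : ∀ w : ℝ, 0 < (((2*π) * (1 - w * I) : ℂ)).re := by intro w; simp [hpi]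
  have i1 : ∀ w, IntegrableOn (G w) (Ioi 0) := fun w =>
    (integrableOn_exp_mul_complex_Ioi (r1 w) 0).congr_fun (e1 w).symm measurableSet_Ioi
  have i2 : ∀ w, IntegrableOn (G w) (Iic 0) := fun w =>
    (integrableOn_exp_mul_complex_Iic (r2 w) 0).congr_fun (e2 w).symm measurableSet_Iic
  have i3 : ∀ w, Integrable (G w) := by
    intro w
    have := (i2 w).union (i1 w)
    rwa [Iic_union_Ioi, integrableOn_univ] at this
  constructor
  · rw [Real.fourier_real_eq_integral_exp_smul]
    change ∫ v, G w v = _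
    rw [← intervalIntegral.integral_Iic_add_Ioi (i2 w) (i1 w), setIntegral_congr_fun measurableSet_Ioi (e1 w),
      setIntegral_congr_fun measurableSet_Iic (e2 w), integral_exp_mul_complex_Ioi (r1 w),
      integral_exp_mul_complex_Iic (r2 w)]
    have hpi' : (π:ℂ) ≠ 0 := by exact_mod_cast hpi.ne'
    have n1 : (1 + w * I : ℂ) ≠ 0 := by
      intro h; have := congrArg Complex.re h; simp at this
    have n2 : (1 - w * I : ℂ) ≠ 0 := by
      intro h; have := congrArg Complex.re h; simp at this
    have n3 : (1 + w^2 : ℂ) = (1 + w * I) * (1 - w * I) := by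
      linear_combination ((w:ℂ)^2) * Complex.I_sq
    push_cast
    rw [n3]
    simp only [mul_zero, Complex.exp_zero]
    field_simp
    ring
  · refine (i3 0).congr ?_
    filter_upwards with x
    simp [hG]

lemma kernel0 {L : ℝ} (hL : 0 ≤ L) :
    ∫ t : ℝ, cexp (L * t * I) * ((1 + t^2)⁻¹ : ℝ) = π * Real.exp (-L) := by
  have hpi := Real.pi_pos
  have hF : 𝓕 (fun x : ℝ => (Real.exp (-(2 * π) * |x|) : ℂ)) = fun w => ((1 / π * (1 + w^2)⁻¹ : ℝ) : ℂ) := by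
    ext w; exact (kernel_fourier w).1
  have hI : Integrable (𝓕 (fun x : ℝ => (Real.exp (-(2 * π) * |x|) : ℂ))) := by
    rw [hF]; exact (integrable_inv_one_add_sq.const_mul (1/π)).ofReal
  have hc : Continuous (fun x : ℝ => (Real.exp (-(2 * π) * |x|) : ℂ)) := by fun_prop
  have h := congrFun (hc.fourierInv_fourier_eq (kernel_fourier 0).2 hI) (L / (2 * π))
  rw [Real.fourierInv_eq', hF] at h
  simp only [smul_eq_mul] at h
  rw [abs_of_nonneg (by positivity)] at h
  rw [show -(2*π) * (L / (2*π)) = -L by field_simp] at h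
  rw [← h, ← integral_const_mul]
  congr 1
  ext t
  have : inner ℝ t (L / (2*π)) = L / (2*π) * t := by simp [inner]
  rw [this, show 2 * π * (L / (2*π) * t) = L * t by field_simp]
  have hpi' : (π:ℂ) ≠ 0 := by exact_mod_cast hpi.ne'
  push_cast
  field_simp

lemma pk1 (x : ℝ) : pk 1 x = (1 + x^2)⁻¹ := by simp [pk]

lemma kernel1 {L : ℝ} (hL : 0 ≤ L) (γ : ℝ) :
    ∫ t : ℝ, cexp (L * t * I) * (pk 1 (t - γ) : ℝ) = π * Real.exp (-L) * cexp (L * γ * I) := by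
  have h := integral_sub_right_eq_self (μ := volume) (fun t : ℝ => cexp (L * (t + γ : ℝ) * I) * (pk 1 t : ℝ)) γ
  simp only [sub_add_cancel] at h
  rw [h, ← kernel0 hL, ← integral_mul_const]
  congr 1; ext t
  rw [pk1]
  have : cexp (L * (t + γ : ℝ) * I) = cexp (L * t * I) * cexp (L * γ * I) := by
    rw [← Complex.exp_add]; push_cast; ring_nf
  rw [this]; ring

lemma pk1_cont : Continuous (pk 1) := by
  have : pk 1 = fun x : ℝ => (1 + x^2)⁻¹ := by ext x; exact pk1 x
  rw [this]
  refine Continuous.inv₀ (by fun_prop) (fun x => by positivity)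

lemma pk1_integrable (γ : ℝ) : Integrable (fun t => pk 1 (t - γ)) := by
  have : Integrable (pk 1) := by
    refine integrable_inv_one_add_sq.congr ?_
    filter_upwards with x; rw [pk1]
  exact this.comp_sub_right γ

lemma pk1_Iic (γ a : ℝ) : ∫ t in Iic a, pk 1 (t - γ) = π/2 + Real.arctan (a - γ) := by
  have := integral_Iic_inv_one_add_sq (i := a - γ)
  have h2 : ∫ t in Iic a, pk 1 (t - γ) = ∫ t in Iic (a - γ), pk 1 t := by
    rw [← integral_indicator measurableSet_Iic, ← integral_indicator measurableSet_Iic,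
      ← integral_sub_right_eq_self (μ := volume) ((Iic (a-γ)).indicator (pk 1)) γ]
    congr 1; ext t; simp [indicator]
  rw [h2]; simp only [pk1]; rw [this]; ring

lemma pk1_Ioi (γ a : ℝ) : ∫ t in Ioi a, pk 1 (t - γ) = π/2 - Real.arctan (a - γ) := by
  have h2 : ∫ t in Ioi a, pk 1 (t - γ) = ∫ t in Ioi (a - γ), pk 1 t := by
    rw [← integral_indicator measurableSet_Ioi, ← integral_indicator measurableSet_Ioi,
      ← integral_sub_right_eq_self (μ := volume) ((Ioi (a-γ)).indicator (pk 1)) γ]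
    congr 1; ext t; simp [indicator]
  rw [h2]; simp only [pk1]; rw [integral_Ioi_inv_one_add_sq]

lemma pk1_interval (γ T : ℝ) : ∫ t in (0:ℝ)..T, pk 1 (t - γ) = Real.arctan (T - γ) + Real.arctan γ := by
  rw [intervalIntegral.integral_comp_sub_right (pk 1)]
  simp only [pk1, integral_inv_one_add_sq]
  simp

lemma arctan_le_self' {x : ℝ} (hx : 0 ≤ x) : Real.arctan x ≤ x := by
  have h1 := Convex.image_sub_le_mul_sub_of_deriv_le (C := 1) (convex_Ici (0:ℝ)) Real.continuous_arctan.continuousOn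
        (Real.differentiable_arctan.differentiableOn) (by
          intro y _
          rw [Real.deriv_arctan, div_le_one (by positivity)]
          nlinarith [sq_nonneg y]) 0 (by simp) x hx hx
  simpa using h1

lemma tau_le {d T : ℝ} (hT : 1 ≤ T) (hd : 0 ≤ d) (hdT : d ≤ T) :
    π/2 - Real.arctan d ≤ 2 * π * T / (T + d^2) := by
  have hpi := Real.pi_gt_three
  rcases le_or_gt (d^2) T with h | h
  · have h0 : 0 ≤ Real.arctan d := Real.arctan_nonneg.2 hd
    rw [le_div_iff₀ (by positivity)]
    nlinarith
  · have hd0 : 0 < d := by nlinarith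
    have h1 : π/2 - Real.arctan d ≤ 1/d := by
      rw [← Real.arctan_inv_of_pos hd0, one_div]
      exact arctan_le_self' (by positivity)
    refine h1.trans ?_
    rw [div_le_div_iff₀ hd0 (by positivity)]
    have a1 : d * d ≤ T * d := mul_le_mul_of_nonneg_right hdT hd
    have a2 : 3 * (T * d) ≤ π * (T * d) := mul_le_mul_of_nonneg_right hpi.le (by positivity)
    have a3 : d^2 = d * d := sq d
    linarith

lemma arctan_diff_le {d T : ℝ} (hT : 1 ≤ T) (hd : 0 ≤ d) :
    Real.arctan (T + d) - Real.arctan d ≤ 2 * π * T / (T + d^2) := by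
  have hpi := Real.pi_gt_three
  have hb := Real.arctan_lt_pi_div_two (T + d)
  have h0 : 0 ≤ Real.arctan d := Real.arctan_nonneg.2 hd
  rcases le_or_gt (d^2) T with h | h
  · rw [le_div_iff₀ (by positivity)]
    nlinarith
  · have h1 : Real.arctan (T + d) - Real.arctan d ≤ 1/(1+d^2) * ((T + d) - d) := by
      refine Convex.image_sub_le_mul_sub_of_deriv_le (convex_Ici d) Real.continuous_arctan.continuousOn
        (Real.differentiable_arctan.differentiableOn) ?_ d (by simp) (T+d) (by simp; linarith) (by linarith)
      intro x hx
      rw [interior_Ici] at hx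
      have hx : d < x := hx
      rw [Real.deriv_arctan]
      exact one_div_le_one_div_of_le (by positivity) (by nlinarith)
    refine h1.trans ?_
    rw [add_sub_cancel_right, one_div_mul_eq_div, div_le_div_iff₀ (by positivity) (by positivity)]
    have : T + d^2 ≤ 2 * d^2 := by linarith
    have a2 : 3 * (T * (1 + d^2)) ≤ π * (T * (1 + d^2)) := mul_le_mul_of_nonneg_right hpi.le (by positivity)
    have a3 : T * (T + d^2) ≤ T * (2 * d^2) := mul_le_mul_of_nonneg_left this (by linarith)
    linarith [show 0 ≤ T * d^2 by positivity]

lemma sqrt_pk {T : ℝ} (hT : 1 ≤ T) (x : ℝ) : 2 * π * T / (T + x^2) = 2 * π * √T * pk (√T) x := by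
  unfold pk
  have h := Real.mul_self_sqrt (show 0 ≤ T by linarith)
  rw [Real.sq_sqrt (by linarith), mul_div_assoc', mul_assoc (2*π), h]

lemma bdry {L T γ : ℝ} (hL : 0 ≤ L) (hT : 1 ≤ T) :
    ‖(if 0 < γ ∧ γ ≤ T then (π * Real.exp (-L) * cexp (L * γ * I) : ℂ) else 0)
      - ∫ t in (0:ℝ)..T, cexp (L * t * I) * (pk 1 (t - γ) : ℝ)‖ ≤
      2 * π * √T * (pk (√T) (0 - γ) + pk (√T) (T - γ)) := by
  have hpi := Real.pi_pos
  set G : ℝ → ℂ := fun t => cexp (L * t * I) * (pk 1 (t - γ) : ℝ) with hG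
  have hn : ∀ t, ‖G t‖ = pk 1 (t - γ) := by
    intro t
    rw [hG]; simp only [norm_mul, Complex.norm_real, Real.norm_eq_abs, abs_of_nonneg (pk_nonneg zero_le_one _)]
    rw [show (L * t * I : ℂ) = (L * t : ℝ) * I by push_cast; ring, Complex.norm_exp_ofReal_mul_I, one_mul]
  have hGc : Continuous G := by
    have := pk1_cont
    simp only [hG]; fun_prop
  have hGi : Integrable G := by
    refine (pk1_integrable γ).mono' hGc.aestronglyMeasurable ?_
    filter_upwards with t; rw [hn]
  rw [mul_add, ← sqrt_pk hT, ← sqrt_pk hT, zero_sub, neg_sq]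
  have p1 : 0 ≤ 2 * π * T / (T + γ^2) := by positivity
  have p2 : 0 ≤ 2 * π * T / (T + (T - γ)^2) := by positivity
  split_ifs with h
  · rw [← kernel1 hL γ]
    change ‖(∫ t, G t) - _‖ ≤ _
    rw [← intervalIntegral.integral_Iic_add_Ioi (b := 0) hGi.integrableOn hGi.integrableOn,
      ← intervalIntegral.integral_interval_add_Ioi (a := 0) (b := T) hGi.integrableOn hGi.integrableOn]
    rw [show ((∫ x in Iic 0, G x) + ((∫ x in (0:ℝ)..T, G x) + ∫ x in Ioi T, G x)) - ∫ x in (0:ℝ)..T, G x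
      = (∫ x in Iic 0, G x) + ∫ x in Ioi T, G x by ring]
    refine (norm_add_le _ _).trans (add_le_add ?_ ?_)
    · refine (norm_integral_le_integral_norm _).trans ?_
      simp only [hn]
      rw [pk1_Iic, zero_sub, Real.arctan_neg]
      exact tau_le hT h.1.le h.2
    · refine (norm_integral_le_integral_norm _).trans ?_
      simp only [hn]
      rw [pk1_Ioi]
      exact tau_le hT (by linarith) (by linarith)
  · rw [zero_sub, norm_neg]
    refine (intervalIntegral.norm_integral_le_integral_norm (by linarith)).trans ?_
    rw [show (∫ t in (0:ℝ)..T, ‖G t‖) = ∫ t in (0:ℝ)..T, pk 1 (t - γ) from by simp only [hn]]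
    rw [pk1_interval]
    rcases le_or_gt γ 0 with h1 | h1
    · have := arctan_diff_le hT (d := -γ) (by linarith)
      rw [Real.arctan_neg, neg_sq, ← sub_eq_add_neg, sub_neg_eq_add] at this
      linarith
    · have h2 : T < γ := by by_contra h3; exact h ⟨h1, not_lt.1 h3⟩
      have := arctan_diff_le hT (d := γ - T) (by linarith)
      rw [add_sub_cancel, show γ - T = -(T - γ) by ring, Real.arctan_neg, neg_sq] at this
      linarith

end FZ

namespace FZ

instance ZI_countable : Countable ZI := by
  have : ({ρ : ℂ | X ρ = 0}).Countable := by
    have h : {ρ : ℂ | X ρ = 0} ⊆ ⋃ n : ℕ, {ρ : ℂ | X ρ = 0 ∧ ‖ρ - 0‖ ≤ n} := by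
      intro ρ hρ
      obtain ⟨n, hn⟩ := exists_nat_ge ‖ρ - 0‖
      exact mem_iUnion.2 ⟨n, hρ, hn⟩
    exact (countable_iUnion fun n : ℕ => (zeros_finite 0 (n:ℝ)).countable).mono h
  exact this.to_subtype

lemma ZT_finite (T : ℝ) : {ρ : ZI | 0 < ρ.1.im ∧ ρ.1.im ≤ T}.Finite := by
  refine Finite.subset ((zeros_finite 0 (1 + T)).preimage (Subtype.val_injective.injOn)) ?_
  intro ρ hρ
  refine ⟨ρ.2, ?_⟩
  have h := (X_zero_iff).1 ρ.2
  rw [sub_zero]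
  refine (Complex.norm_le_abs_re_add_abs_im _).trans ?_
  rw [abs_of_pos h.2.1, abs_of_pos hρ.1]
  linarith [h.2.2, hρ.2]

noncomputable def ZT (T : ℝ) : Finset ZI := (ZT_finite T).toFinset

lemma mem_ZT {T : ℝ} {ρ : ZI} : ρ ∈ ZT T ↔ 0 < ρ.1.im ∧ ρ.1.im ≤ T := by simp [ZT]

noncomputable def SL (L T : ℝ) : ℂ := ∑ ρ ∈ ZT T, mlt ρ * cexp (L * ρ.1.im * I)

lemma norm_expI (L t : ℝ) : ‖cexp (L * t * I)‖ = 1 := by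
  rw [show (L * t * I : ℂ) = (L * t : ℝ) * I by push_cast; ring, Complex.norm_exp_ofReal_mul_I]

lemma pk1_shift {t T γ : ℝ} (h0 : 0 ≤ t) (h1 : t ≤ T) : pk 1 (t - γ) ≤ 2 * (1 + T^2) * pk 1 (0 - γ) := by
  rw [pk1, pk1, zero_sub, neg_sq, ← div_eq_mul_inv, ← one_div, div_le_div_iff₀ (by positivity) (by positivity)]
  have : t^2 ≤ T^2 := by nlinarith
  nlinarith [sq_nonneg (2 * t - γ), mul_nonneg (sq_nonneg T) (sq_nonneg (t - γ))]

lemma D3_hasSum (hRH : RiemannHypothesis) (L : ℝ) {T : ℝ} (hT : 0 ≤ T) :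
    HasSum (fun ρ : ZI => (mlt ρ : ℂ) * ∫ t in (0:ℝ)..T, cexp (L * t * I) * (pk 1 (t - ρ.1.im) : ℝ))
      (∫ t in (0:ℝ)..T, cexp (L * t * I) * (FF 1 t : ℝ)) := by
  have h := intervalIntegral.hasSum_integral_of_dominated_convergence (μ := volume) (a := 0) (b := T)
    (F := fun (ρ : ZI) t => cexp (L * t * I) * ((mlt ρ * pk 1 (t - ρ.1.im) : ℝ) : ℂ))
    (f := fun t => cexp (L * t * I) * (FF 1 t : ℝ))
    (fun ρ _ => 2 * (1 + T^2) * (mlt ρ * pk 1 (0 - ρ.1.im))) ?_ ?_ ?_ ?_ ?_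
  · refine h.congr_fun ?_ |> fun x => x
    intro ρ
    rw [← intervalIntegral.integral_const_mul]
    congr 1; ext t; push_cast; ring
  · intro ρ
    have := pk1_cont
    exact Continuous.aestronglyMeasurable (by fun_prop)
  · intro ρ
    filter_upwards with t ht
    rw [uIoc_of_le hT] at ht
    rw [norm_mul, norm_expI, one_mul, Complex.norm_real, Real.norm_eq_abs,
      abs_of_nonneg (mul_nonneg (mlt_nonneg ρ) (pk_nonneg zero_le_one _))]
    have := mul_le_mul_of_nonneg_left (pk1_shift (γ := ρ.1.im) ht.1.le ht.2) (mlt_nonneg ρ)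
    linarith
  · filter_upwards with t ht
    exact ((poisson_hasSum hRH one_pos 0).summable).mul_left _
  · exact intervalIntegrable_const
  · filter_upwards with t ht
    exact ((Complex.hasSum_ofReal.2 (poisson_hasSum hRH one_pos t))).mul_left _

lemma D3_bound0 (hRH : RiemannHypothesis) {L T : ℝ} (hL : 0 ≤ L) (hT : 1 ≤ T) :
    ‖π * Real.exp (-L) * SL L T - ∫ t in (0:ℝ)..T, cexp (L * t * I) * (FF 1 t : ℝ)‖ ≤
      2 * π * √T * (FF √T 0 + FF √T T) := by
  have hs : 0 < √T := Real.sqrt_pos.2 (by linarith)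
  have h1 : HasSum (fun ρ : ZI => (mlt ρ : ℂ) * (if 0 < ρ.1.im ∧ ρ.1.im ≤ T then
      (π * Real.exp (-L) * cexp (L * ρ.1.im * I) : ℂ) else 0)) (π * Real.exp (-L) * SL L T) := by
    have := hasSum_sum_of_ne_finset_zero (L := SummationFilter.unconditional ZI) (s := ZT T) (f := fun ρ : ZI => (mlt ρ : ℂ) * (if 0 < ρ.1.im ∧ ρ.1.im ≤ T then
      (π * Real.exp (-L) * cexp (L * ρ.1.im * I) : ℂ) else 0)) (by
        intro ρ hρ; rw [mem_ZT] at hρ; rw [if_neg hρ, mul_zero])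
    convert this using 1
    rw [SL, Finset.mul_sum]
    refine Finset.sum_congr rfl fun ρ hρ => ?_
    rw [if_pos (mem_ZT.1 hρ)]; ring
  have h2 := h1.sub (D3_hasSum hRH L (show 0 ≤ T by linarith))
  have h3 := (((poisson_hasSum hRH hs 0).add (poisson_hasSum hRH hs T)).mul_left (2 * π * √T))
  refine h2.norm_le_of_bounded h3 ?_
  intro ρ
  rw [← mul_sub, norm_mul, Complex.norm_real, Real.norm_eq_abs, abs_of_nonneg (mlt_nonneg ρ)]
  have := mul_le_mul_of_nonneg_left (bdry (γ := ρ.1.im) hL hT) (mlt_nonneg ρ)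
  refine this.trans (le_of_eq ?_)
  ring

lemma log_bd {T y : ℝ} (hT : 1 ≤ T) (hy : 0 < y) (hyT : y ≤ 3 * T) : 1 + Real.log y ≤ 13 * T ^ (1/4:ℝ) := by
  have h1 : Real.log y ≤ y ^ (1/4:ℝ) / (1/4) := Real.log_le_rpow_div hy.le (by norm_num)
  have h2 : y ^ (1/4:ℝ) ≤ (3 * T) ^ (1/4:ℝ) := Real.rpow_le_rpow hy.le hyT (by norm_num)
  rw [Real.mul_rpow (by norm_num) (by linarith)] at h2
  have h3 : (3:ℝ) ^ (1/4:ℝ) ≤ 3 := by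
    calc (3:ℝ) ^ (1/4:ℝ) ≤ (3:ℝ) ^ (1:ℝ) := Real.rpow_le_rpow_of_exponent_le (by norm_num) (by norm_num)
      _ = 3 := by simp
  have h4 : 1 ≤ T ^ (1/4:ℝ) := Real.one_le_rpow hT (by norm_num)
  nlinarith

lemma D3_bound (hRH : RiemannHypothesis) : ∃ C : ℝ, 1 ≤ C ∧ ∀ L T : ℝ, 0 ≤ L → 1 ≤ T →
    ‖π * Real.exp (-L) * SL L T - ∫ t in (0:ℝ)..T, cexp (L * t * I) * (FF 1 t : ℝ)‖ ≤ C * T ^ (3/4:ℝ) := by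
  obtain ⟨C, hC, hF⟩ := FF_le
  have hpi := Real.pi_gt_three
  refine ⟨2 * π * (26 * C), by nlinarith, fun L T hL hT => (D3_bound0 hRH hL hT).trans ?_⟩
  have hs : 1 ≤ √T := Real.one_le_sqrt.2 hT
  have hs2 : √T * √T = T := Real.mul_self_sqrt (by linarith)
  have hs3 : √T ≤ T := by nlinarith
  have b1 : FF √T 0 ≤ C * (13 * T ^ (1/4:ℝ)) :=
    (hF _ _ hs).trans (mul_le_mul_of_nonneg_left (log_bd hT (by positivity) (by simp; linarith)) (by linarith))
  have b2 : FF √T T ≤ C * (13 * T ^ (1/4:ℝ)) :=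
    (hF _ _ hs).trans (mul_le_mul_of_nonneg_left (log_bd hT (by positivity)
      (by rw [abs_of_nonneg (by linarith)]; linarith)) (by linarith))
  have e : T ^ (3/4:ℝ) = √T * T ^ (1/4:ℝ) := by
    rw [Real.sqrt_eq_rpow, ← Real.rpow_add (by linarith)]; norm_num
  rw [e]
  calc 2 * π * √T * (FF √T 0 + FF √T T) ≤ 2 * π * √T * (C * (13 * T ^ (1/4:ℝ)) + C * (13 * T ^ (1/4:ℝ))) := by
        apply mul_le_mul_of_nonneg_left (add_le_add b1 b2); positivity
    _ = _ := by ring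

/-- total mass bound -/
lemma SL0_bound (hRH : RiemannHypothesis) : ∃ C : ℝ, 1 ≤ C ∧ ∀ T : ℝ, 1 ≤ T →
    ∑ ρ ∈ ZT T, mlt ρ ≤ C * T * (1 + Real.log (1 + T)) := by
  obtain ⟨C, hC, hF⟩ := FF_le
  refine ⟨2 * C, by linarith, fun T hT => ?_⟩
  have hT0 : 0 < T := by linarith
  have h1 := poisson_hasSum hRH hT0 0
  have h2 : ∑ ρ ∈ ZT T, mlt ρ * pk T (0 - ρ.1.im) ≤ FF T 0 :=
    sum_le_hasSum _ (fun ρ _ => mul_nonneg (mlt_nonneg ρ) (pk_nonneg hT0.le _)) h1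
  have h3 : ∑ ρ ∈ ZT T, mlt ρ ≤ ∑ ρ ∈ ZT T, 2 * T * (mlt ρ * pk T (0 - ρ.1.im)) := by
    refine Finset.sum_le_sum fun ρ hρ => ?_
    have hρ := mem_ZT.1 hρ
    have : 1 ≤ 2 * T * pk T (0 - ρ.1.im) := by
      unfold pk
      rw [zero_sub, neg_sq, mul_div_assoc', le_div_iff₀ (by positivity)]
      nlinarith [hρ.1, hρ.2]
    nlinarith [mlt_nonneg ρ]
  rw [← Finset.mul_sum] at h3
  have h4 := hF T 0 hT
  rw [abs_zero, add_zero] at h4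
  calc _ ≤ _ := h3
    _ ≤ 2 * T * (C * (1 + Real.log (1 + T))) := mul_le_mul_of_nonneg_left (h2.trans h4) (by linarith)
    _ = _ := by ring

end FZ

namespace FZ

lemma osc_mono {f : ℝ → ℝ} (hf : ContDiff ℝ 1 f) (hm : MonotoneOn f (Ici 0)) {L T : ℝ} (hL : 0 < L) (hT : 0 ≤ T) :
    ‖∫ t in (0:ℝ)..T, cexp (L * t * I) * (f t : ℝ)‖ ≤ (|f 0| + |f T| + (f T - f 0)) / L := by
  have hLI : (L * I : ℂ) ≠ 0 := by simp [hL.ne']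
  have hd : ∀ x, HasDerivAt f (deriv f x) x := fun x => (hf.differentiable (by norm_num) x).hasDerivAt
  have hdc : Continuous (deriv f) := hf.continuous_deriv (by norm_num)
  have hv : ∀ x : ℝ, HasDerivAt (fun t : ℝ => cexp (L * t * I) / (L * I)) (cexp (L * x * I)) x := by
    intro x
    have h1 : HasDerivAt (fun t : ℝ => (L * t * I : ℂ)) (L * I) x := by
      have := ((hasDerivAt_id x).ofReal_comp.const_mul (L:ℂ)).mul_const I
      simpa using this
    have := h1.cexp.div_const (L * I : ℂ)
    rwa [mul_div_assoc, div_self hLI, mul_one] at this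
  have hi := intervalIntegral.integral_mul_deriv_eq_deriv_mul (a := 0) (b := T)
    (u := fun t => (f t : ℂ)) (v := fun t : ℝ => cexp (L * t * I) / (L * I))
    (u' := fun t => ((deriv f t : ℝ) : ℂ)) (v' := fun t : ℝ => cexp (L * t * I))
    (fun x _ => (hd x).ofReal_comp) (fun x _ => hv x)
    ((Complex.continuous_ofReal.comp hdc).intervalIntegrable _ _)
    (Continuous.intervalIntegrable (by fun_prop) _ _)
  simp only [mul_comm (cexp _)]
  rw [hi]
  have hn : ∀ t : ℝ, ‖cexp (L * t * I) / (L * I)‖ = 1 / L := by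
    intro t; rw [norm_div, norm_expI]; simp [abs_of_pos hL]
  have hintg : ‖∫ x in (0:ℝ)..T, ((deriv f x : ℝ) : ℂ) * (cexp (L * x * I) / (L * I))‖ ≤ (f T - f 0) / L := by
    have h1 : ∫ x in (0:ℝ)..T, deriv f x * (1 / L) = (f T - f 0) / L := by
      rw [intervalIntegral.integral_mul_const, intervalIntegral.integral_eq_sub_of_hasDerivAt (fun x _ => hd x)
        (hdc.intervalIntegrable _ _)]
      ring
    rw [← h1]
    refine intervalIntegral.norm_integral_le_of_norm_le hT ?_ ((hdc.mul continuous_const).intervalIntegrable _ _)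
    filter_upwards with t ht
    rw [norm_mul, hn, Complex.norm_real, Real.norm_eq_abs, abs_of_nonneg]
    have : derivWithin f (Ici 0) t = deriv f t := derivWithin_of_mem_nhds (Ici_mem_nhds ht.1)
    rw [← this]
    exact hm.derivWithin_nonneg
  have e1 : ‖(f T : ℂ) * (cexp (L * T * I) / (L * I))‖ = |f T| / L := by
    rw [norm_mul, hn, Complex.norm_real, Real.norm_eq_abs]; ring
  have e2 : ‖(f 0 : ℂ) * (cexp (L * (0:ℝ) * I) / (L * I))‖ = |f 0| / L := by
    rw [norm_mul, hn, Complex.norm_real, Real.norm_eq_abs]; ring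
  calc _ ≤ |f T| / L + |f 0| / L + (f T - f 0) / L := by
        refine (norm_sub_le _ _).trans (add_le_add ((norm_sub_le _ _).trans ?_) hintg)
        rw [e1, e2]
    _ = _ := by ring

lemma pk_contDiff {a : ℝ} (ha : 0 < a) : ContDiff ℝ 1 (pk a) := by
  unfold pk
  refine ContDiff.div (by fun_prop) (by fun_prop) (fun x => by positivity)

lemma pk_anti {a : ℝ} (ha : 0 < a) : MonotoneOn (fun x => - pk a x) (Ici 0) := by
  intro x hx y hy hxy
  have hx : 0 ≤ x := hx
  simp only [neg_le_neg_iff]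
  unfold pk
  apply div_le_div_of_nonneg_left ha.le (by positivity)
  nlinarith

lemma osc_pk {a L T : ℝ} (ha : 1/2 ≤ a) (hL : 0 < L) (hT : 0 ≤ T) :
    ‖∫ t in (0:ℝ)..T, cexp (L * t * I) * (pk a t : ℝ)‖ ≤ 6 / L := by
  have ha0 : 0 < a := by linarith
  have h := osc_mono (pk_contDiff ha0).neg (pk_anti ha0) hL hT
  simp only [Complex.ofReal_neg, mul_neg, intervalIntegral.integral_neg, norm_neg, abs_neg] at h
  refine h.trans (div_le_div_of_nonneg_right ?_ hL.le)
  have h0 : ∀ x, pk a x ≤ 2 := by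
    intro x; unfold pk; rw [div_le_iff₀ (by positivity)]; nlinarith [sq_nonneg x]
  rw [abs_of_nonneg (pk_nonneg ha0.le _), abs_of_nonneg (pk_nonneg ha0.le _)]
  linarith [h0 0, h0 T, pk_nonneg ha0.le T]

lemma osc_AA : ∃ C : ℝ, 1 ≤ C ∧ ∀ L T : ℝ, 0 < L → 1 ≤ T →
    ‖∫ t in (0:ℝ)..T, cexp (L * t * I) * (AA t : ℝ)‖ ≤ C * T ^ (1/4:ℝ) / L := by
  refine ⟨3 * |AA 0| + 32, by linarith [abs_nonneg (AA 0)], fun L T hL hT => ?_⟩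
  refine (osc_mono AA_contDiff AA_mono hL (by linarith)).trans (div_le_div_of_nonneg_right ?_ hL.le)
  have h1 : AA 0 ≤ AA T := AA_mono (by simp) (by simp; linarith) (by linarith)
  have h2 := AA_le T (by linarith)
  have h3 := log_bd (y := 2 + T) hT (by linarith) (by linarith)
  have h4 : 1 ≤ T ^ (1/4:ℝ) := Real.one_le_rpow hT (by norm_num)
  have h5 : |AA T| ≤ |AA 0| + (3 + 13 * T ^ (1/4:ℝ)) := by
    rw [abs_le]; constructor <;> linarith [neg_abs_le (AA 0), abs_nonneg (AA 0)]
  have h6 : |AA 0| ≤ |AA 0| * T ^ (1/4:ℝ) := le_mul_of_one_le_right (abs_nonneg _) h4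
  linarith [neg_abs_le (AA 0), le_abs_self (AA T)]

noncomputable def vv (n : ℕ) : ℝ := vM n * (n:ℝ)^(-(3/2):ℝ)

lemma vv_nonneg (n : ℕ) : 0 ≤ vv n := mul_nonneg (vM_nonneg n) (by positivity)

noncomputable def cn (L T : ℝ) (n : ℕ) : ℂ := ∫ t in (0:ℝ)..T, cexp (L * t * I) * (Real.cos (t * Real.log n) : ℝ)

noncomputable def EE (μ T : ℝ) : ℂ := ∫ t in (0:ℝ)..T, cexp (μ * t * I)

lemma EE_zero (T : ℝ) : EE 0 T = T := by simp [EE]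

lemma EE_bound {μ : ℝ} (hμ : μ ≠ 0) (T : ℝ) : ‖EE μ T‖ ≤ 2 / |μ| := by
  have hc : (μ * I : ℂ) ≠ 0 := by simp [hμ]
  have : EE μ T = (cexp (μ * T * I) - cexp (μ * (0:ℝ) * I)) / (μ * I) := by
    have := integral_exp_mul_complex (a := 0) (b := T) hc
    rw [EE, show (μ * T * I : ℂ) = μ * I * T by ring, show (μ * (0:ℝ) * I : ℂ) = μ * I * (0:ℝ) by ring, ← this]
    congr 1; ext t; ring_nf
  rw [this, norm_div]
  have h1 : ‖(μ * I : ℂ)‖ = |μ| := by simp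
  rw [h1]
  refine div_le_div_of_nonneg_right ((norm_sub_le _ _).trans ?_) (abs_nonneg _)
  rw [norm_expI, norm_expI]; norm_num

lemma cn_eq (L T : ℝ) (n : ℕ) : cn L T n = (EE (L + Real.log n) T + EE (L - Real.log n) T) / 2 := by
  unfold cn EE
  rw [← intervalIntegral.integral_add (Continuous.intervalIntegrable (by fun_prop) _ _)
    (Continuous.intervalIntegrable (by fun_prop) _ _), ← intervalIntegral.integral_div]
  congr 1; ext t
  have e1 : cexp (((L + Real.log n : ℝ) : ℂ) * t * I) = cexp (L * t * I) * cexp ((t * Real.log n : ℝ) * I) := by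
    rw [← Complex.exp_add]; push_cast; ring_nf
  have e2 : cexp (((L - Real.log n : ℝ) : ℂ) * t * I) = cexp (L * t * I) * cexp (-(t * Real.log n : ℝ) * I) := by
    rw [← Complex.exp_add]; push_cast; ring_nf
  rw [e1, e2, Complex.ofReal_cos, Complex.cos]
  ring

lemma cn_le {T : ℝ} (hT : 0 ≤ T) (L : ℝ) (n : ℕ) : ‖cn L T n‖ ≤ T := by
  have := intervalIntegral.norm_integral_le_of_norm_le_const (a := 0) (b := T) (C := 1)
    (f := fun t : ℝ => cexp (L * t * I) * (Real.cos (t * Real.log n) : ℝ)) (by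
      intro t _
      rw [norm_mul, norm_expI, one_mul, Complex.norm_real, Real.norm_eq_abs]
      exact Real.abs_cos_le_one _)
  rwa [one_mul, sub_zero, abs_of_nonneg hT] at this

lemma cn_le2 {L : ℝ} (hL : 0 < L) (T : ℝ) (n : ℕ) (h : L ≠ Real.log n) : ‖cn L T n‖ ≤ 2 / |L - Real.log n| := by
  have hl : 0 ≤ Real.log n := Real.log_natCast_nonneg n
  have h1 := EE_bound (μ := L + Real.log n) (by linarith) T
  have h2 := EE_bound (μ := L - Real.log n) (sub_ne_zero.2 h) T
  have h3 : 2 / |L + Real.log n| ≤ 2 / |L - Real.log n| := by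
    apply div_le_div_of_nonneg_left (by norm_num) (abs_pos.2 (sub_ne_zero.2 h))
    rw [abs_of_pos (show 0 < L + Real.log n by linarith)]
    rw [abs_le]; constructor <;> linarith
  rw [cn_eq, norm_div]
  have := norm_add_le (EE (L + Real.log n) T) (EE (L - Real.log n) T)
  rw [div_le_iff₀ (by simp)]
  simp only [Complex.norm_ofNat]
  linarith

lemma cn_tendsto {L : ℝ} (hL : 0 < L) (n : ℕ) :
    Tendsto (fun T : ℝ => cn L T n / T) atTop (nhds (if L = Real.log n then 1/2 else 0)) := by
  have hb : ∀ μ : ℝ, μ ≠ 0 → Tendsto (fun T : ℝ => EE μ T / T) atTop (nhds 0) := by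
    intro μ hμ
    refine squeeze_zero_norm' (a := fun T : ℝ => 2 / |μ| * T⁻¹) ?_ (by simpa using tendsto_inv_atTop_zero.const_mul (2 / |μ|))
    filter_upwards [eventually_gt_atTop 0] with T hT
    rw [norm_div, Complex.norm_real, Real.norm_eq_abs, abs_of_pos hT, div_eq_mul_inv]
    exact mul_le_mul_of_nonneg_right (EE_bound hμ T) (by positivity)
  have hl : 0 ≤ Real.log n := Real.log_natCast_nonneg n
  have h1 := hb (L + Real.log n) (by linarith)
  simp only [cn_eq]
  split_ifs with h
  · have h2 : Tendsto (fun T : ℝ => EE (L - Real.log n) T / T) atTop (nhds 1) := by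
      refine tendsto_const_nhds.congr' ?_
      filter_upwards [eventually_gt_atTop 0] with T hT
      rw [sub_eq_zero.2 h, EE_zero, div_self]
      exact_mod_cast hT.ne'
    have := (h1.add h2).div_const 2
    rw [zero_add] at this
    refine this.congr fun T => by ring
  · have h2 := hb (L - Real.log n) (sub_ne_zero.2 h)
    have := (h1.add h2).div_const 2
    rw [zero_add, zero_div] at this
    refine this.congr fun T => by ring

lemma Z_hasSum (L : ℝ) {T : ℝ} (hT : 0 ≤ T) :
    HasSum (fun n : ℕ => (vv n : ℂ) * cn L T n)
      (∫ t in (0:ℝ)..T, cexp (L * t * I) * ((∑' n : ℕ, vM n*(n:ℝ)^(-(3/2):ℝ)*Real.cos (t*Real.log n) : ℝ) : ℂ)) := by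
  have hb : ∀ (n : ℕ) (t : ℝ), ‖vM n*(n:ℝ)^(-(3/2):ℝ)*Real.cos (t*Real.log n)‖ ≤ vv n := by
    intro n t
    rw [norm_mul, Real.norm_eq_abs, Real.norm_eq_abs, abs_of_nonneg (show 0 ≤ vM n*(n:ℝ)^(-(3/2):ℝ) from vv_nonneg n)]
    exact mul_le_of_le_one_right (vv_nonneg n) (Real.abs_cos_le_one _)
  have h := intervalIntegral.hasSum_integral_of_dominated_convergence (μ := volume) (a := 0) (b := T)
    (F := fun (n : ℕ) t => cexp (L * t * I) * ((vM n*(n:ℝ)^(-(3/2):ℝ)*Real.cos (t*Real.log n) : ℝ) : ℂ))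
    (f := fun t => cexp (L * t * I) * ((∑' n : ℕ, vM n*(n:ℝ)^(-(3/2):ℝ)*Real.cos (t*Real.log n) : ℝ) : ℂ))
    (fun n _ => vv n) ?_ ?_ ?_ ?_ ?_
  · refine h.congr_fun ?_ |> fun x => x
    intro n
    rw [cn, ← intervalIntegral.integral_const_mul]
    congr 1; ext t; rw [vv]; push_cast; ring
  · intro n
    exact Continuous.aestronglyMeasurable (by fun_prop)
  · intro n
    filter_upwards with t ht
    rw [norm_mul, norm_expI, one_mul, Complex.norm_real]
    exact hb n t
  · filter_upwards with t ht
    exact vM_summable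
  · exact intervalIntegrable_const
  · filter_upwards with t ht
    exact ((Complex.hasSum_ofReal.2 (Summable.of_norm_bounded vM_summable (fun n => hb n t)).hasSum)).mul_left _

end FZ

namespace FZ

noncomputable def ZZ (L T : ℝ) : ℂ := ∑' n : ℕ, (vv n : ℂ) * cn L T n

lemma int_FF_one (L : ℝ) {T : ℝ} (hT : 0 ≤ T) :
    ∫ t in (0:ℝ)..T, cexp (L * t * I) * (FF 1 t : ℝ) =
      (∫ t in (0:ℝ)..T, cexp (L * t * I) * (pk (3/2) t : ℝ)) + (∫ t in (0:ℝ)..T, cexp (L * t * I) * (pk (1/2) t : ℝ))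
      + (∫ t in (0:ℝ)..T, cexp (L * t * I) * (AA t : ℝ)) - ZZ L T := by
  rw [ZZ, (Z_hasSum L hT).tsum_eq]
  have c1 : Continuous (pk (3/2)) := (pk_contDiff (by norm_num)).continuous
  have c2 : Continuous (pk (1/2)) := (pk_contDiff (by norm_num)).continuous
  have c3 : Continuous AA := AA_contDiff.continuous
  have c4 : Continuous (fun t : ℝ => ∑' n : ℕ, vM n*(n:ℝ)^(-(3/2):ℝ)*Real.cos (t*Real.log n)) := by
    refine continuous_tsum (fun n => by fun_prop) vM_summable ?_
    intro n t
    rw [norm_mul, Real.norm_eq_abs, Real.norm_eq_abs, abs_of_nonneg (show 0 ≤ vM n*(n:ℝ)^(-(3/2):ℝ) from vv_nonneg n)]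
    exact mul_le_of_le_one_right (vv_nonneg n) (Real.abs_cos_le_one _)
  rw [← intervalIntegral.integral_add, ← intervalIntegral.integral_add, ← intervalIntegral.integral_sub]
  · congr 1; ext t; rw [FF_one]; push_cast; ring
  all_goals exact Continuous.intervalIntegrable (by fun_prop) _ _

lemma landau_main (hRH : RiemannHypothesis) : ∃ C : ℝ, 1 ≤ C ∧ ∀ L T : ℝ, 0 < L → 1 ≤ T →
    ‖π * Real.exp (-L) * SL L T + ZZ L T‖ ≤ C * (1 + 1/L) * T ^ (3/4:ℝ) := by
  obtain ⟨C1, hC1, h1⟩ := D3_bound hRH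
  obtain ⟨C2, hC2, h2⟩ := osc_AA
  refine ⟨C1 + C2 + 12, by linarith, fun L T hL hT => ?_⟩
  have a1 := h1 L T hL.le hT
  have a2 := h2 L T hL hT
  have a3 := osc_pk (a := 3/2) (by norm_num) hL (show 0 ≤ T by linarith)
  have a4 := osc_pk (a := 1/2) (by norm_num) hL (show 0 ≤ T by linarith)
  rw [int_FF_one L (by linarith)] at a1
  set P := ∫ t in (0:ℝ)..T, cexp (L * t * I) * (pk (3/2) t : ℝ)
  set Q := ∫ t in (0:ℝ)..T, cexp (L * t * I) * (pk (1/2) t : ℝ)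
  set R := ∫ t in (0:ℝ)..T, cexp (L * t * I) * (AA t : ℝ)
  have e : π * Real.exp (-L) * SL L T + ZZ L T = (π * Real.exp (-L) * SL L T - (P + Q + R - ZZ L T)) + (P + Q + R) := by ring
  rw [e]
  have n1 := norm_add_le (π * Real.exp (-L) * SL L T - (P + Q + R - ZZ L T)) (P + Q + R)
  have n2 := norm_add_le (P + Q) R
  have n3 := norm_add_le P Q
  have t1 : T ^ (1/4:ℝ) ≤ T ^ (3/4:ℝ) := Real.rpow_le_rpow_of_exponent_le hT (by norm_num)
  have t2 : 1 ≤ T ^ (3/4:ℝ) := Real.one_le_rpow hT (by norm_num)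
  set U := T ^ (3/4:ℝ)
  have hL' : 0 < 1/L := by positivity
  have b2 : ‖R‖ ≤ C2 * U * (1/L) := by
    refine a2.trans ?_
    rw [div_eq_mul_one_div]
    exact mul_le_mul_of_nonneg_right (mul_le_mul_of_nonneg_left t1 (by linarith)) hL'.le
  have b3 : 6 / L ≤ 6 * U * (1/L) := by
    rw [div_eq_mul_one_div]
    exact mul_le_mul_of_nonneg_right (by linarith) hL'.le
  have b4 : 0 ≤ C1 * U * (1/L) := by positivity
  have b5 : 0 ≤ (C2 + 12) * U := by positivity
  nlinarith

lemma landau_tendsto (hRH : RiemannHypothesis) {L : ℝ} (hL : 0 < L) :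
    Tendsto (fun T : ℝ => SL L T / T) atTop
      (nhds (-(Real.exp L / π) * ∑' n : ℕ, (vv n : ℂ) * (if L = Real.log n then 1/2 else 0))) := by
  obtain ⟨C, hC, hm⟩ := landau_main hRH
  have hZ : Tendsto (fun T : ℝ => ZZ L T / T) atTop (nhds (∑' n : ℕ, (vv n : ℂ) * (if L = Real.log n then 1/2 else 0))) := by
    have := tendsto_tsum_of_dominated_convergence (𝓕 := atTop) (f := fun (T : ℝ) (n : ℕ) => (vv n : ℂ) * (cn L T n / T))
      (g := fun n : ℕ => (vv n : ℂ) * (if L = Real.log n then 1/2 else 0)) (bound := vv) vM_summable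
      (fun n => (cn_tendsto hL n).const_mul _) (by
        filter_upwards [eventually_gt_atTop 0] with T hT n
        rw [norm_mul, norm_div, Complex.norm_real, Complex.norm_real, Real.norm_eq_abs, Real.norm_eq_abs,
          abs_of_nonneg (vv_nonneg n), abs_of_pos hT]
        exact mul_le_of_le_one_right (vv_nonneg n) ((div_le_one hT).2 (cn_le hT.le L n)))
    refine this.congr fun T => ?_
    rw [ZZ, ← tsum_div_const]
    congr 1; ext n; ring
  have h0 : Tendsto (fun T : ℝ => (π * Real.exp (-L) * SL L T + ZZ L T) / T) atTop (nhds 0) := by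
    refine squeeze_zero_norm' (a := fun T : ℝ => C * (1 + 1/L) * T ^ (-(1/4):ℝ)) ?_ ?_
    · filter_upwards [eventually_ge_atTop 1] with T hT
      have hT0 : 0 < T := by linarith
      rw [norm_div, Complex.norm_real, Real.norm_eq_abs, abs_of_pos hT0, div_le_iff₀ hT0]
      refine (hm L T hL hT).trans (le_of_eq ?_)
      rw [mul_assoc _ _ T]
      congr 1
      nth_rewrite 3 [← Real.rpow_one T]
      rw [← Real.rpow_add hT0]; norm_num
    · simpa using (tendsto_rpow_neg_atTop (y := 1/4) (by norm_num)).const_mul (C * (1 + 1/L))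
  have h1 := (h0.sub hZ).const_mul ((Real.exp L / π : ℂ))
  rw [zero_sub] at h1
  rw [neg_mul, ← mul_neg]
  refine h1.congr fun T => ?_
  have hp : (π : ℂ) ≠ 0 := by exact_mod_cast Real.pi_ne_zero
  have he : (Real.exp L : ℂ) * (Real.exp (-L) : ℂ) = 1 := by
    rw [← Complex.ofReal_mul, ← Real.exp_add]; simp
  rw [add_div, add_sub_cancel_right]
  calc _ = ((Real.exp L : ℂ) * (Real.exp (-L) : ℂ)) * (SL L T / T) * (π / π) := by ring
    _ = _ := by rw [he, div_self hp]; ring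

lemma vv_le (n : ℕ) : vv n ≤ 4 * (n:ℝ) ^ (-(5/4):ℝ) := by
  rcases Nat.eq_zero_or_pos n with rfl | hn
  · simp [vv, vM]
  have hn0 : (0:ℝ) < n := by exact_mod_cast hn
  have h1 : vM n ≤ Real.log n := ArithmeticFunction.vonMangoldt_le_log
  have h2 : Real.log n ≤ (n:ℝ) ^ (1/4:ℝ) / (1/4) := Real.log_le_rpow_div hn0.le (by norm_num)
  have h3 : (n:ℝ) ^ (-(5/4):ℝ) = (n:ℝ) ^ (1/4:ℝ) * (n:ℝ) ^ (-(3/2):ℝ) := by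
    rw [← Real.rpow_add hn0]; norm_num
  rw [vv, h3, ← mul_assoc]
  apply mul_le_mul_of_nonneg_right _ (by positivity)
  linarith

lemma log_gap {L : ℝ} (hL : 0 < L) {n : ℕ} (hn : 1 ≤ n) (h1 : n ≠ ⌊Real.exp L⌋₊) (h2 : n ≠ ⌊Real.exp L⌋₊ + 1) :
    1 / (2 * Real.exp L) ≤ |L - Real.log n| := by
  set x := Real.exp L with hx
  have hx1 : 1 < x := Real.one_lt_exp_iff.2 hL
  have hx0 : 0 < x := by linarith
  have hf1 : (⌊x⌋₊ : ℝ) ≤ x := Nat.floor_le hx0.le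
  have hf2 : x < ⌊x⌋₊ + 1 := Nat.lt_floor_add_one x
  have hLx : L = Real.log x := by rw [hx, Real.log_exp]
  have hn0 : (0:ℝ) < n := by exact_mod_cast hn
  rcases lt_or_gt_of_ne h1 with h | h
  · have h3 : (n:ℝ) + 1 ≤ ⌊x⌋₊ := by exact_mod_cast h
    have h4 : Real.log (n / x) ≤ n / x - 1 := Real.log_le_sub_one_of_pos (by positivity)
    rw [Real.log_div hn0.ne' hx0.ne', ← hLx] at h4
    have h5 : n / x ≤ 1 - 1 / x := by
      rw [div_le_iff₀ hx0, sub_mul, div_mul_cancel₀ _ hx0.ne']; linarith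
    have h6 : 1 / (2 * x) ≤ 1 / x := one_div_le_one_div_of_le hx0 (by linarith)
    exact le_trans (by linarith) (le_abs_self _)
  · have h3 : (⌊x⌋₊ : ℝ) + 2 ≤ n := by
      have : ⌊x⌋₊ + 2 ≤ n := by omega
      exact_mod_cast this
    have h3' : x + 1 ≤ n := by linarith
    have h4 : Real.log (x / n) ≤ x / n - 1 := Real.log_le_sub_one_of_pos (by positivity)
    rw [Real.log_div hx0.ne' hn0.ne', ← hLx] at h4
    have h5 : x / n ≤ 1 - 1 / (2 * x) := by
      have : x / n ≤ x / (x + 1) := div_le_div_of_nonneg_left hx0.le (by linarith) h3'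
      refine this.trans ?_
      rw [div_le_iff₀ (by linarith)]
      have : 1 / (2 * x) * (x + 1) ≤ 1 := by
        rw [one_div_mul_eq_div, div_le_one (by linarith)]; linarith
      linarith
    exact le_trans (by linarith) (neg_le_abs _)

lemma ZZ_bound : ∃ C : ℝ, 1 ≤ C ∧ ∀ L T : ℝ, 0 < L → 0 ≤ T →
    ‖ZZ L T‖ ≤ C * (T * Real.exp (-(5/4) * L) + Real.exp L) := by
  set V := ∑' n : ℕ, vv n with hV
  have hsv : Summable vv := vM_summable
  have hV0 : 0 ≤ V := tsum_nonneg vv_nonneg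
  refine ⟨4 * V + 32, by linarith, fun L T hL hT => ?_⟩
  set x := Real.exp L with hx
  have hx1 : 1 < x := Real.one_lt_exp_iff.2 hL
  have hx0 : 0 < x := by linarith
  set B := T * (16 * x ^ (-(5/4):ℝ)) with hB
  have hB0 : 0 ≤ B := by positivity
  have hf2 : x < ⌊x⌋₊ + 1 := Nat.lt_floor_add_one x
  have hf3 : 1 ≤ ⌊x⌋₊ := by rw [Nat.one_le_floor_iff]; exact hx1.le
  have key : ∀ n : ℕ, (n = ⌊x⌋₊ ∨ n = ⌊x⌋₊ + 1) → vv n ≤ 16 * x ^ (-(5/4):ℝ) := by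
    intro n hn
    refine (vv_le n).trans ?_
    have h1 : (1:ℝ) ≤ ⌊x⌋₊ := by exact_mod_cast hf3
    have h2 : x / 2 ≤ n := by
      rcases hn with rfl | rfl
      · linarith
      · push_cast; linarith
    have h3 : (n:ℝ) ^ (-(5/4):ℝ) ≤ (x/2) ^ (-(5/4):ℝ) := Real.rpow_le_rpow_of_nonpos (by positivity) h2 (by norm_num)
    rw [div_eq_mul_inv x 2, Real.mul_rpow hx0.le (by norm_num), Real.inv_rpow (by norm_num), ← Real.rpow_neg (by norm_num)] at h3
    have h4 : (2:ℝ) ^ (-(-(5/4)):ℝ) ≤ 4 := by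
      calc (2:ℝ) ^ (-(-(5/4)):ℝ) ≤ (2:ℝ) ^ (2:ℝ) := Real.rpow_le_rpow_of_exponent_le (by norm_num) (by norm_num)
        _ = 4 := by norm_num
    have h5 : 0 ≤ x ^ (-(5/4):ℝ) := by positivity
    nlinarith
  have hterm : ∀ n : ℕ, ‖(vv n : ℂ) * cn L T n‖ ≤ 4 * x * vv n + ((if n = ⌊x⌋₊ then B else 0) + (if n = ⌊x⌋₊ + 1 then B else 0)) := by
    intro n
    rw [norm_mul, Complex.norm_real, Real.norm_eq_abs, abs_of_nonneg (vv_nonneg n)]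
    have hv := vv_nonneg n
    by_cases h1 : n = ⌊x⌋₊ ∨ n = ⌊x⌋₊ + 1
    · have a1 : vv n * ‖cn L T n‖ ≤ B := by
        calc vv n * ‖cn L T n‖ ≤ (16 * x ^ (-(5/4):ℝ)) * T :=
              mul_le_mul (key n h1) (cn_le hT L n) (norm_nonneg _) (by positivity)
          _ = B := by rw [hB]; ring
      have a2 : B ≤ (if n = ⌊x⌋₊ then B else 0) + (if n = ⌊x⌋₊ + 1 then B else 0) := by
        rcases h1 with h | h
        · rw [if_pos h]; split_ifs <;> linarith
        · rw [if_pos h]; split_ifs <;> linarith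
      have a3 : 0 ≤ 4 * x * vv n := by positivity
      linarith
    · push Not at h1
      rw [if_neg h1.1, if_neg h1.2]
      rcases Nat.eq_zero_or_pos n with rfl | hn
      · have : vv 0 = 0 := by simp [vv, vM]
        rw [this]; simp
      have hg := log_gap hL hn h1.1 h1.2
      rw [← hx] at hg
      have hpos : 0 < 1 / (2 * x) := by positivity
      have hne : L ≠ Real.log n := by
        intro h; rw [h, sub_self, abs_zero] at hg; linarith
      have h4 : ‖cn L T n‖ ≤ 4 * x := by
        refine (cn_le2 hL T n hne).trans ?_
        calc 2 / |L - Real.log n| ≤ 2 / (1 / (2 * x)) := div_le_div_of_nonneg_left (by norm_num) hpos hg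
          _ = 4 * x := by field_simp; norm_num
      have := mul_le_mul_of_nonneg_left h4 hv
      linarith
  have hs : HasSum (fun n : ℕ => 4 * x * vv n + ((if n = ⌊x⌋₊ then B else 0) + (if n = ⌊x⌋₊ + 1 then B else 0)))
      (4 * x * V + (B + B)) :=
    (hsv.hasSum.mul_left _).add ((hasSum_ite_eq _ _).add (hasSum_ite_eq _ _))
  have := tsum_of_norm_bounded hs hterm
  refine this.trans ?_
  have e : x ^ (-(5/4):ℝ) = Real.exp (-(5/4) * L) := by
    rw [hx, ← Real.exp_mul]; ring_nf
  rw [hB, e]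
  have : 0 ≤ V * (T * Real.exp (-(5/4) * L)) := by positivity
  nlinarith

lemma SL_bound (hRH : RiemannHypothesis) : ∃ C : ℝ, 1 ≤ C ∧ ∀ L T : ℝ, 0 < L → 1 ≤ T →
    ‖SL L T‖ ≤ C * (1 + 1/L) * (Real.exp L * T ^ (3/4:ℝ) + T * Real.exp (-(1/4) * L) + Real.exp (2 * L)) := by
  obtain ⟨C1, hC1, h1⟩ := landau_main hRH
  obtain ⟨C2, hC2, h2⟩ := ZZ_bound
  refine ⟨C1 + C2, by linarith, fun L T hL hT => ?_⟩
  have a1 := h1 L T hL hT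
  have a2 := h2 L T hL (by linarith)
  have hpi := Real.pi_gt_three
  have n1 := norm_sub_le (π * Real.exp (-L) * SL L T + ZZ L T) (ZZ L T)
  rw [add_sub_cancel_right, norm_mul, norm_mul, Complex.norm_real, Complex.norm_real, Real.norm_eq_abs,
    Real.norm_eq_abs, abs_of_pos (Real.exp_pos _), abs_of_pos (by linarith : 0 < π)] at n1
  have n2 : Real.exp (-L) * ‖SL L T‖ ≤ π * Real.exp (-L) * ‖SL L T‖ := by
    rw [mul_assoc]; exact le_mul_of_one_le_left (by positivity) (by linarith)
  have n3 : ‖SL L T‖ = Real.exp L * (Real.exp (-L) * ‖SL L T‖) := by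
    rw [← mul_assoc, ← Real.exp_add]; simp
  have n4 : Real.exp (-L) * ‖SL L T‖ ≤ C1 * (1 + 1/L) * T ^ (3/4:ℝ) + C2 * (T * Real.exp (-(5/4) * L) + Real.exp L) := by
    linarith
  have n5 := mul_le_mul_of_nonneg_left n4 (Real.exp_pos L).le
  rw [← n3] at n5
  have e1 : Real.exp L * Real.exp (-(5/4) * L) = Real.exp (-(1/4) * L) := by rw [← Real.exp_add]; ring_nf
  have e2 : Real.exp L * Real.exp L = Real.exp (2 * L) := by rw [← Real.exp_add]; ring_nf
  refine n5.trans ?_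
  have hM : 1 ≤ 1 + 1/L := by linarith [show 0 < 1/L by positivity]
  set M := 1 + 1/L
  have e3 : Real.exp L * (C1 * M * T ^ (3/4:ℝ) + C2 * (T * Real.exp (-(5/4) * L) + Real.exp L))
    = C1 * M * (Real.exp L * T ^ (3/4:ℝ)) + C2 * (T * Real.exp (-(1/4) * L) + Real.exp (2 * L)) := by
    rw [← e1, ← e2]; ring
  rw [e3]
  set A := Real.exp L * T ^ (3/4:ℝ)
  set B := T * Real.exp (-(1/4) * L) + Real.exp (2 * L) with hBd
  have hA : 0 ≤ A := by positivity
  have hB : 0 ≤ B := by positivity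
  have e4 : (C1 + C2) * M * (A + T * Real.exp (-(1/4) * L) + Real.exp (2 * L)) = C1 * M * A + C2 * M * B + C2 * M * A + C1 * M * B := by
    rw [hBd]; ring
  rw [e4]
  have i1 : C2 * B ≤ C2 * M * B := by
    rw [mul_right_comm]; exact le_mul_of_one_le_right (by positivity) hM
  have i2 : 0 ≤ C2 * M * A := by positivity
  have i3 : 0 ≤ C1 * M * B := by positivity
  linarith

end FZ

namespace FZ

lemma SL_sum (hRH : RiemannHypothesis) {L0 : ℝ} (hL0 : 0 < L0) : ∃ A T0 : ℝ, 1 ≤ A ∧ 1 ≤ T0 ∧ ∀ T : ℝ, T0 ≤ T →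
    ∃ K : ℕ, 1 ≤ K ∧ ∑ m ∈ Finset.range (2 * K), ‖SL ((m + 1 : ℕ) * L0) T‖ ≤ A * T ∧ ∑ ρ ∈ ZT T, mlt ρ ≤ A * T * K := by
  obtain ⟨C1, hC1, h1⟩ := SL_bound hRH
  obtain ⟨C2, hC2, h2⟩ := SL0_bound hRH
  set r := Real.exp (-(1/4) * L0) with hr
  have hr0 : 0 < r := Real.exp_pos _
  have hr1 : r < 1 := by rw [hr, Real.exp_lt_one_iff]; linarith
  set M := 1 + 1 / L0 with hM
  have hL' : 0 < 1 / L0 := by positivity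
  have hM1 : 1 ≤ M := by linarith
  have hg0 : 0 < (1 - r)⁻¹ := inv_pos.2 (by linarith)
  set A1 := C1 * M * (1/L0 + (1-r)⁻¹ + 1/L0) with hA1
  have hA10 : 0 ≤ A1 := by positivity
  set A2 := C2 * (96 * L0) with hA2
  have hA20 : 0 ≤ A2 := by positivity
  refine ⟨1 + A1 + A2, Real.exp (1 + 16 * L0), by linarith, Real.one_le_exp (by positivity), fun T hT => ?_⟩
  have hT1 : 1 ≤ T := (Real.one_le_exp (by positivity)).trans hT
  have hT0 : 0 < T := by linarith
  have hlog : 1 + 16 * L0 ≤ Real.log T := by rw [Real.le_log_iff_exp_le hT0]; exact hT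
  set K := ⌊Real.log T / (16 * L0)⌋₊ with hK
  have hK1 : 1 ≤ K := by
    rw [hK, Nat.one_le_floor_iff, le_div_iff₀ (by positivity)]; linarith
  have hK2 : (K:ℝ) ≤ Real.log T / (16 * L0) := Nat.floor_le (by apply div_nonneg <;> linarith)
  have hK3 : Real.log T / (16 * L0) < K + 1 := Nat.lt_floor_add_one _
  rw [le_div_iff₀ (by positivity)] at hK2
  rw [div_lt_iff₀ (by positivity)] at hK3
  have hK1' : (1:ℝ) ≤ K := by exact_mod_cast hK1
  refine ⟨K, hK1, ?_, ?_⟩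
  · have b : ∀ m ∈ Finset.range (2 * K), ‖SL ((m + 1 : ℕ) * L0) T‖ ≤
        C1 * M * (T ^ (1/8:ℝ) * T ^ (3/4:ℝ) + T * r ^ m + T ^ (1/4:ℝ)) := by
      intro m hm
      have hm' : ((m + 1 : ℕ) : ℝ) ≤ 2 * K := by
        have := Finset.mem_range.1 hm
        exact_mod_cast (by omega : m + 1 ≤ 2 * K)
      have hm0 : (1:ℝ) ≤ ((m + 1 : ℕ) : ℝ) := by exact_mod_cast Nat.succ_le_succ (Nat.zero_le m)
      have hLm : L0 ≤ ((m + 1 : ℕ) : ℝ) * L0 := le_mul_of_one_le_left hL0.le hm0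
      have hLm2 : ((m + 1 : ℕ) : ℝ) * L0 ≤ Real.log T * (1/8) := by nlinarith
      refine (h1 _ T (by linarith) hT1).trans ?_
      have i1 : 1 + 1 / (((m + 1 : ℕ) : ℝ) * L0) ≤ M := by
        rw [hM]; linarith [one_div_le_one_div_of_le hL0 hLm]
      have i2 : Real.exp (((m + 1 : ℕ) : ℝ) * L0) ≤ T ^ (1/8:ℝ) := by
        rw [Real.rpow_def_of_pos hT0]; exact Real.exp_le_exp.2 hLm2
      have i3 : Real.exp (2 * (((m + 1 : ℕ) : ℝ) * L0)) ≤ T ^ (1/4:ℝ) := by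
        rw [Real.rpow_def_of_pos hT0]; exact Real.exp_le_exp.2 (by linarith)
      have i4 : Real.exp (-(1/4) * (((m + 1 : ℕ) : ℝ) * L0)) ≤ r ^ m := by
        rw [hr, ← Real.exp_nat_mul]; apply Real.exp_le_exp.2
        push_cast; nlinarith
      apply mul_le_mul (mul_le_mul_of_nonneg_left i1 (by linarith)) _ (by positivity) (by positivity)
      gcongr
    refine (Finset.sum_le_sum b).trans ?_
    rw [← Finset.mul_sum, Finset.sum_add_distrib, Finset.sum_add_distrib, Finset.sum_const, Finset.sum_const,
      Finset.card_range, ← Finset.mul_sum, nsmul_eq_mul, nsmul_eq_mul]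
    have j1 : ∑ m ∈ Finset.range (2 * K), r ^ m ≤ (1 - r)⁻¹ := by
      rw [← tsum_geometric_of_lt_one hr0.le hr1]
      exact (summable_geometric_of_lt_one hr0.le hr1).sum_le_tsum _ (fun _ _ => by positivity)
    have j2 : ((2 * K : ℕ) : ℝ) ≤ T ^ (1/8:ℝ) * (1/L0) := by
      have : Real.log T ≤ T ^ (1/8:ℝ) / (1/8) := Real.log_le_rpow_div hT0.le (by norm_num)
      rw [mul_one_div, le_div_iff₀ hL0]; push_cast; linarith
    have j3 : ((2 * K : ℕ) : ℝ) * (T ^ (1/8:ℝ) * T ^ (3/4:ℝ)) ≤ (1/L0) * T := by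
      calc _ ≤ T ^ (1/8:ℝ) * (1/L0) * (T ^ (1/8:ℝ) * T ^ (3/4:ℝ)) := mul_le_mul_of_nonneg_right j2 (by positivity)
        _ = (1/L0) * (T ^ (1/8:ℝ) * T ^ (1/8:ℝ) * T ^ (3/4:ℝ)) := by ring
        _ = _ := by
          rw [← Real.rpow_add hT0, ← Real.rpow_add hT0]; norm_num
    have j4 : ((2 * K : ℕ) : ℝ) * T ^ (1/4:ℝ) ≤ (1/L0) * T := by
      calc _ ≤ T ^ (1/8:ℝ) * (1/L0) * T ^ (1/4:ℝ) := mul_le_mul_of_nonneg_right j2 (by positivity)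
        _ = (1/L0) * (T ^ (1/8:ℝ) * T ^ (1/4:ℝ)) := by ring
        _ ≤ (1/L0) * T := by
          apply mul_le_mul_of_nonneg_left _ hL'.le
          rw [← Real.rpow_add hT0]
          nth_rewrite 2 [← Real.rpow_one T]
          exact Real.rpow_le_rpow_of_exponent_le hT1 (by norm_num)
    have j5 : T * ∑ m ∈ Finset.range (2 * K), r ^ m ≤ (1 - r)⁻¹ * T := by
      rw [mul_comm]; exact mul_le_mul_of_nonneg_right j1 hT0.le
    calc _ ≤ C1 * M * ((1/L0) * T + (1 - r)⁻¹ * T + (1/L0) * T) := by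
          apply mul_le_mul_of_nonneg_left _ (by positivity); linarith
      _ = A1 * T := by rw [hA1]; ring
      _ ≤ _ := mul_le_mul_of_nonneg_right (by linarith) hT0.le
  · refine (h2 T hT1).trans ?_
    have k1 : Real.log (1 + T) ≤ 1 + Real.log T := by
      have : Real.log (1 + T) ≤ Real.log (2 * T) := Real.log_le_log (by linarith) (by linarith)
      rw [Real.log_mul (by norm_num) hT0.ne'] at this
      linarith [Real.log_two_lt_d9]
    have k2 : 1 + Real.log (1 + T) ≤ 96 * L0 * K := by nlinarith
    calc C2 * T * (1 + Real.log (1 + T)) ≤ C2 * T * (96 * L0 * K) := mul_le_mul_of_nonneg_left k2 (by positivity)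
      _ = A2 * (T * K) := by rw [hA2]; ring
      _ ≤ (1 + A1 + A2) * (T * K) := mul_le_mul_of_nonneg_right (by linarith) (by positivity)
      _ = _ := by ring

end FZ

namespace FZ

/-- additive character -/
noncomputable def ee (u : ℝ) : ℂ := cexp (2 * π * u * I)

lemma ee_norm (u : ℝ) : ‖ee u‖ = 1 := by
  rw [ee, show (2 * π * u * I : ℂ) = (2 * π * u : ℝ) * I by push_cast; ring, Complex.norm_exp_ofReal_mul_I]

lemma ee_add (u v : ℝ) : ee (u + v) = ee u * ee v := by
  rw [ee, ee, ee, ← Complex.exp_add]; push_cast; ring_nf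

lemma ee_zero : ee 0 = 1 := by simp [ee]

lemma ee_conj (u : ℝ) : (starRingEnd ℂ) (ee u) = ee (-u) := by
  rw [ee, ee, ← Complex.exp_conj]; simp [Complex.conj_ofNat]

lemma ee_int (m : ℤ) : ee m = 1 := by
  rw [ee, Complex.exp_eq_one_iff]
  exact ⟨m, by push_cast; ring⟩

lemma ee_half : ee (1/2) = -1 := by
  rw [ee, show (2 * π * ((1/2:ℝ):ℂ) * I : ℂ) = π * I by push_cast; ring, Complex.exp_pi_mul_I]

lemma ee_cont : Continuous ee := by unfold ee; fun_prop

lemma ee_periodic (m : ℤ) : Function.Periodic (fun u : ℝ => ee (m * u)) 1 := by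
  intro u
  simp only
  rw [mul_add, mul_one, ee_add, ee_int, mul_one]

lemma ee_sub_one (u : ℝ) : ‖ee u - 1‖ = 2 * |Real.sin (π * u)| := by
  have := Complex.norm_exp_I_mul_ofReal_sub_one (2 * π * u)
  rw [ee, show (2 * π * u * I : ℂ) = I * (2 * π * u : ℝ) by push_cast; ring, this, Real.norm_eq_abs, abs_mul]
  rw [show 2 * π * u / 2 = π * u by ring]; norm_num

lemma ee_sub_one_le (u : ℝ) : ‖ee u - 1‖ ≤ 2 * π * |u| := by
  rw [ee_sub_one]
  have : |Real.sin (π * u)| ≤ |π * u| := Real.abs_sin_le_abs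
  rw [abs_mul, abs_of_pos Real.pi_pos] at this
  linarith

lemma le_ee_sub_one {u : ℝ} (hu : |u| ≤ 1/2) : 4 * |u| ≤ ‖ee u - 1‖ := by
  rw [ee_sub_one]
  have hpi := Real.pi_pos
  have := Real.mul_abs_le_abs_sin (x := π * u) (by rw [abs_mul, abs_of_pos hpi]; nlinarith)
  rw [abs_mul, abs_of_pos hpi, ← mul_assoc, div_mul_cancel₀ _ hpi.ne'] at this
  linarith

noncomputable def DD (K : ℕ) (u : ℝ) : ℂ := ∑ j ∈ Finset.range K, ee ((j:ℤ) * u)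

noncomputable def pp (K : ℕ) (u : ℝ) : ℝ := ‖DD K u‖ ^ 2

lemma DD_cont (K : ℕ) : Continuous (DD K) := by
  have := ee_cont
  unfold DD; fun_prop

lemma pp_cont (K : ℕ) : Continuous (pp K) := by
  have := DD_cont K
  unfold pp; fun_prop

lemma pp_nonneg (K : ℕ) (u : ℝ) : 0 ≤ pp K u := by unfold pp; positivity

lemma DD_periodic (K : ℕ) : Function.Periodic (DD K) 1 := by
  intro u
  exact Finset.sum_congr rfl fun j _ => ee_periodic j u

lemma pp_periodic (K : ℕ) : Function.Periodic (pp K) 1 := by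
  intro u; simp only [pp, DD_periodic K u]

lemma DD_conj (K : ℕ) (u : ℝ) : (starRingEnd ℂ) (DD K u) = DD K (-u) := by
  simp only [DD, map_sum, ee_conj]
  refine Finset.sum_congr rfl fun j _ => by rw [mul_neg]

lemma pp_even (K : ℕ) (u : ℝ) : pp K (-u) = pp K u := by
  rw [pp, pp, ← DD_conj, RCLike.norm_conj]

lemma DD_mul (K : ℕ) (u : ℝ) : DD K u * (ee u - 1) = ee (K * u) - 1 := by
  have h : DD K u = ∑ j ∈ Finset.range K, ee u ^ j := by
    refine Finset.sum_congr rfl fun j _ => ?_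
    rw [ee, ee, ← Complex.exp_nat_mul]; push_cast; ring_nf
  have h2 : ee (K * u) = ee u ^ K := by
    rw [ee, ee, ← Complex.exp_nat_mul]; push_cast; ring_nf
  rw [h, h2, geom_sum_mul]

lemma pp_mul (K : ℕ) (u : ℝ) : pp K u * ‖ee u - 1‖ ^ 2 = ‖ee (K * u) - 1‖ ^ 2 := by
  rw [pp, ← mul_pow, ← norm_mul, DD_mul]

lemma pp_sq_le (K : ℕ) {u : ℝ} (hu : |u| ≤ 1/2) : pp K u * u ^ 2 ≤ 1/4 := by
  have h1 := pp_mul K u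
  have h2 : ‖ee (K * u) - 1‖ ≤ 2 := by
    refine (norm_sub_le _ _).trans ?_
    rw [ee_norm]; norm_num
  have h3 := le_ee_sub_one hu
  have h4 : (4 * |u|)^2 ≤ ‖ee u - 1‖ ^ 2 := by gcongr
  have h5 : ‖ee (K * u) - 1‖^2 ≤ 2^2 := by gcongr
  have h6 := mul_le_mul_of_nonneg_left h4 (pp_nonneg K u)
  rw [mul_pow, sq_abs] at h6
  linarith

lemma pp_cover {K : ℕ} (hK : 1 ≤ K) {s δ : ℝ} (hs : |s| ≤ δ) :
    1 ≤ π^2 * (δ + 1/(2*K))^2 * (pp K s + pp K (s + 1/(2*K))) := by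
  have hK0 : (0:ℝ) < K := by exact_mod_cast hK
  have hc : 0 < 1/(2*(K:ℝ)) := by positivity
  have hδ : 0 ≤ δ := (abs_nonneg s).trans hs
  have hpi := Real.pi_pos
  have h1 := pp_mul K s
  have h2 := pp_mul K (s + 1/(2*K))
  have e1 : ee (K * (s + 1/(2*K))) = - ee (K * s) := by
    rw [mul_add, ee_add, show (K:ℝ) * (1/(2*K)) = 1/2 by field_simp, ee_half]; ring
  rw [e1] at h2
  have e2 : ‖ee (K * s) - 1‖^2 + ‖-ee (K * s) - 1‖^2 = 4 := by
    have hh := parallelogram_law_with_norm ℝ (ee (K * s)) 1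
    rw [ee_norm, norm_one] at hh
    have : ‖-ee (K * s) - 1‖ = ‖ee (K * s) + 1‖ := by rw [← norm_neg]; congr 1; ring
    rw [this]; nlinarith
  set R := 2 * π * (δ + 1/(2*K)) with hR
  have b1 : ‖ee s - 1‖^2 ≤ R^2 := by
    have : ‖ee s - 1‖ ≤ R := (ee_sub_one_le s).trans (by rw [hR]; gcongr; linarith)
    gcongr
  have b2 : ‖ee (s + 1/(2*K)) - 1‖^2 ≤ R^2 := by
    have : ‖ee (s + 1/(2*K)) - 1‖ ≤ R := (ee_sub_one_le _).trans (by
      rw [hR]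
      have : |s + 1/(2*K)| ≤ δ + 1/(2*K) := (abs_add_le _ _).trans (by rw [abs_of_pos hc]; linarith)
      gcongr)
    gcongr
  have c1 := mul_le_mul_of_nonneg_left b1 (pp_nonneg K s)
  have c2 := mul_le_mul_of_nonneg_left b2 (pp_nonneg K (s + 1/(2*K)))
  have : R^2 = 4 * (π^2 * (δ + 1/(2*K))^2) := by rw [hR]; ring
  rw [this] at c1 c2
  linarith

lemma pp_expand (K : ℕ) (u : ℝ) : (pp K u : ℂ) =
    ∑ a ∈ Finset.range K ×ˢ Finset.range K, ee (((a.1 : ℤ) - (a.2 : ℤ) : ℤ) * u) := by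
  have : (pp K u : ℂ) = DD K u * (starRingEnd ℂ) (DD K u) := by
    rw [Complex.mul_conj, Complex.normSq_eq_norm_sq, pp]
  rw [this, DD_conj, DD, DD, Finset.sum_mul_sum, Finset.sum_product]
  refine Finset.sum_congr rfl fun i _ => Finset.sum_congr rfl fun j _ => ?_
  rw [← ee_add]; push_cast; ring_nf

noncomputable def QI (K : ℕ) : Finset ((ℕ × ℕ) × (ℕ × ℕ)) :=
  (Finset.range K ×ˢ Finset.range K) ×ˢ (Finset.range K ×ˢ Finset.range K)

def fr (b : (ℕ × ℕ) × (ℕ × ℕ)) : ℤ := ((b.1.1 : ℤ) - b.1.2) + ((b.2.1 : ℤ) - b.2.2)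

lemma qq_expand (K : ℕ) (u : ℝ) : ((pp K u ^ 2 : ℝ) : ℂ) = ∑ b ∈ QI K, ee (fr b * u) := by
  rw [sq, Complex.ofReal_mul, pp_expand, QI, Finset.sum_mul_sum]
  rw [Finset.sum_product (s := Finset.range K ×ˢ Finset.range K)]
  refine Finset.sum_congr rfl fun i _ => Finset.sum_congr rfl fun j _ => ?_
  rw [← ee_add, fr]; push_cast; ring_nf

noncomputable def n0 (K : ℕ) : ℝ := (((QI K).filter (fun b => fr b = 0)).card : ℝ)

open scoped Pointwise in
lemma n0_ge (K : ℕ) (hK : 1 ≤ K) : (K:ℝ)^3 ≤ 2 * n0 K := by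
  have h := Finset.le_card_add_mul_addEnergy (Finset.range K) (Finset.range K)
  have e : (Finset.range K).addEnergy (Finset.range K) = ((QI K).filter (fun b => fr b = 0)).card := by
    rw [Finset.addEnergy, QI]
    congr 1
    ext b
    rw [Finset.mem_filter, Finset.mem_filter]
    refine and_congr_right fun _ => ?_
    unfold fr
    omega
  rw [e] at h
  have h2 : (Finset.range K + Finset.range K).card ≤ 2 * K := by
    refine (Finset.card_le_card (t := Finset.range (2 * K)) ?_).trans (by simp)
    intro x hx
    obtain ⟨a, ha, b, hb, rfl⟩ := Finset.mem_add.1 hx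
    rw [Finset.mem_range] at *
    omega
  rw [Finset.card_range] at h
  have h3 : K^2 * K^2 ≤ 2 * K * ((QI K).filter (fun b => fr b = 0)).card := h.trans (Nat.mul_le_mul_right _ h2)
  have h4 : (K:ℝ)^2 * K^2 ≤ 2 * K * n0 K := by unfold n0; exact_mod_cast h3
  have hK0 : (0:ℝ) < K := by exact_mod_cast hK
  have : K * (K:ℝ)^3 ≤ K * (2 * n0 K) := by linarith [show (K:ℝ)^2 * K^2 = K * (K:ℝ)^3 by ring]
  exact le_of_mul_le_mul_left this hK0

lemma ee_integral (m : ℤ) (a : ℝ) : ∫ u in a..(a+1), ee (m * u) = if m = 0 then 1 else 0 := by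
  split_ifs with h
  · subst h; simp [ee_zero]
  · have hc : (2 * π * m * I : ℂ) ≠ 0 := by
      simp [Real.pi_ne_zero, h]
    have h1 := integral_exp_mul_complex (a := a) (b := a + 1) hc
    have h2 : ∀ u : ℝ, ee (m * u) = cexp (2 * π * m * I * u) := by
      intro u; rw [ee]; push_cast; ring_nf
    simp only [h2]
    rw [h1, ← h2, ← h2]
    have := ee_periodic m a
    simp only at this
    rw [this, sub_self, zero_div]

lemma pp_integral (K : ℕ) (a : ℝ) : ∫ u in a..(a+1), pp K u = K := by
  have h : ((∫ u in a..(a+1), pp K u : ℝ) : ℂ) = K := by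
    rw [← intervalIntegral.integral_ofReal]
    simp only [pp_expand]
    rw [intervalIntegral.integral_finsetSum]
    · simp only [ee_integral]
      rw [Finset.sum_product]
      have : ∀ i ∈ Finset.range K, ∑ j ∈ Finset.range K, (if ((i:ℤ) - (j:ℤ)) = 0 then (1:ℂ) else 0) = 1 := by
        intro i hi
        have : ∀ j : ℕ, ((i:ℤ) - (j:ℤ) = 0) ↔ i = j := by intro j; omega
        simp only [this, Finset.sum_ite_eq, hi, if_true]
      rw [Finset.sum_congr rfl this]; simp
    · intro i _
      have := ee_cont
      exact Continuous.intervalIntegrable (by fun_prop) _ _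
  exact_mod_cast h

lemma qq_integral (K : ℕ) (a : ℝ) : ∫ u in a..(a+1), pp K u ^ 2 = n0 K := by
  have h : ((∫ u in a..(a+1), pp K u ^ 2 : ℝ) : ℂ) = n0 K := by
    rw [← intervalIntegral.integral_ofReal]
    simp only [qq_expand]
    rw [intervalIntegral.integral_finsetSum]
    · simp only [ee_integral]
      rw [Finset.sum_ite]; simp [n0]
    · intro i _
      have := ee_cont
      exact Continuous.intervalIntegrable (by fun_prop) _ _
  exact_mod_cast h

lemma qq_moment {K : ℕ} (hK : 1 ≤ K) : ∫ u in (-(1/2):ℝ)..(1/2), pp K u ^ 2 * (1 + K * |u|)^2 ≤ 3 * n0 K := by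
  have hc := pp_cont K
  have i1 := qq_integral K (-(1/2))
  have i2 := pp_integral K (-(1/2))
  rw [show (-(1/2):ℝ) + 1 = 1/2 by norm_num] at i1 i2
  have hb : ∫ u in (-(1/2):ℝ)..(1/2), pp K u ^ 2 * (1 + K * |u|)^2 ≤
      ∫ u in (-(1/2):ℝ)..(1/2), (2 * pp K u ^ 2 + (K:ℝ)^2 / 2 * pp K u) := by
    refine intervalIntegral.integral_mono_on (by norm_num) (Continuous.intervalIntegrable (by fun_prop) _ _)
      (Continuous.intervalIntegrable (by fun_prop) _ _) ?_
    intro u hu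
    have hu' : |u| ≤ 1/2 := abs_le.2 hu
    have h1 := pp_sq_le K hu'
    have h2 := pp_nonneg K u
    have h3 : (1 + K * |u|)^2 ≤ 2 + 2 * (K:ℝ)^2 * u^2 := by
      have : |u|^2 = u^2 := sq_abs u
      nlinarith [sq_nonneg (1 - K * |u|)]
    have h4 : pp K u ^ 2 * u^2 ≤ pp K u * (1/4) := by
      rw [sq, mul_assoc]; exact mul_le_mul_of_nonneg_left h1 h2
    have h5 := mul_le_mul_of_nonneg_left h3 (sq_nonneg (pp K u))
    have h6 := mul_le_mul_of_nonneg_left h4 (sq_nonneg (K:ℝ))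
    linarith
  refine hb.trans ?_
  rw [intervalIntegral.integral_add (Continuous.intervalIntegrable (by fun_prop) _ _)
    (Continuous.intervalIntegrable (by fun_prop) _ _), intervalIntegral.integral_const_mul,
    intervalIntegral.integral_const_mul, i1, i2]
  have := n0_ge K hK
  have e : (K:ℝ)^2/2 * K = (K:ℝ)^3/2 := by ring
  rw [e]; linarith

end FZ

namespace FZ

variable {ι : Type*}

noncomputable def SS (s : Finset ι) (w x : ι → ℝ) (r : ℤ) : ℂ := ∑ i ∈ s, (w i : ℂ) * ee (r * x i)

lemma SS_zero (s : Finset ι) (w x : ι → ℝ) : SS s w x 0 = ((∑ i ∈ s, w i : ℝ) : ℂ) := by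
  simp [SS, ee_zero]

lemma inner_sum {K : ℕ} {f : ℤ → ℝ} (hf : ∀ r, 0 ≤ f r) {c : ℤ} (h1 : -K ≤ c) (h2 : c ≤ 2 * K) :
    ∑ k ∈ Finset.range K, f (c - k) ≤ ∑ r ∈ Finset.Icc (-(2 * K : ℤ)) (2 * K), f r := by
  have : ∑ k ∈ Finset.range K, f (c - k) = ∑ r ∈ (Finset.range K).image (fun k : ℕ => c - (k:ℤ)), f r := by
    rw [Finset.sum_image]
    intro a _ b _ h
    simp only at h
    omega
  rw [this]
  refine Finset.sum_le_sum_of_subset_of_nonneg ?_ (fun r _ _ => hf r)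
  intro r hr
  obtain ⟨k, hk, rfl⟩ := Finset.mem_image.1 hr
  rw [Finset.mem_range] at hk
  rw [Finset.mem_Icc]
  omega

lemma SS_shift (s : Finset ι) (w x : ι → ℝ) (r : ℤ) (y : ℝ) :
    ∑ i ∈ s, (w i : ℂ) * ee (r * (x i - y)) = SS s w x r * ee (-(r * y)) := by
  rw [SS, Finset.sum_mul]
  refine Finset.sum_congr rfl fun i _ => ?_
  rw [mul_assoc, ← ee_add]; ring_nf

lemma conv_p {s : Finset ι} {w x : ι → ℝ} {K : ℕ} {A : ℝ} (hK : 1 ≤ K) (hw : ∀ i ∈ s, 0 ≤ w i)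
    (hA : ∑ r ∈ Finset.Icc (-(2 * K : ℤ)) (2 * K), (if r = 0 then 0 else ‖SS s w x r‖) ≤ A)
    (hW : ∑ i ∈ s, w i ≤ A * K) (y : ℝ) :
    ∑ i ∈ s, w i * pp K (y - x i) ≤ 2 * A * K^2 := by
  have hK1 : (1:ℝ) ≤ K := by exact_mod_cast hK
  have hA0 : 0 ≤ A := le_trans (Finset.sum_nonneg fun r _ => by split_ifs <;> positivity) hA
  have e : ((∑ i ∈ s, w i * pp K (y - x i) : ℝ) : ℂ) =
      ∑ a ∈ Finset.range K ×ˢ Finset.range K, SS s w x ((a.1 : ℤ) - (a.2 : ℤ)) * ee (-(((a.1 : ℤ) - (a.2 : ℤ) : ℤ) * y)) := by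
    simp only [← SS_shift]
    rw [Finset.sum_comm]
    push_cast
    refine Finset.sum_congr rfl fun i _ => ?_
    rw [← Finset.mul_sum, ← neg_sub, pp_even, pp_expand]
    push_cast; rfl
  have h0 : 0 ≤ ∑ i ∈ s, w i * pp K (y - x i) := Finset.sum_nonneg fun i hi => mul_nonneg (hw i hi) (pp_nonneg _ _)
  rw [← abs_of_nonneg h0, ← Real.norm_eq_abs, ← Complex.norm_real, e]
  refine (norm_sum_le _ _).trans ?_
  simp only [norm_mul, ee_norm, mul_one]
  rw [Finset.sum_product]
  set f : ℤ → ℝ := fun r => if r = 0 then 0 else ‖SS s w x r‖ with hf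
  have hf0 : ∀ r, 0 ≤ f r := fun r => by simp only [hf]; split_ifs <;> positivity
  have hle : ∀ j ∈ Finset.range K, ∑ k ∈ Finset.range K, ‖SS s w x ((j:ℤ) - (k:ℤ))‖ ≤ A + A * K := by
    intro j hj
    have h1 : ∀ k ∈ Finset.range K, ‖SS s w x ((j:ℤ) - (k:ℤ))‖ = f ((j:ℤ) - k) + (if j = k then ∑ i ∈ s, w i else 0) := by
      intro k _
      simp only [hf]
      by_cases h : j = k
      · subst h
        rw [sub_self, SS_zero, if_pos rfl, if_pos rfl, Complex.norm_real, Real.norm_eq_abs,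
          abs_of_nonneg (Finset.sum_nonneg hw), zero_add]
      · rw [if_neg h, if_neg (by omega), add_zero]
    rw [Finset.sum_congr rfl h1, Finset.sum_add_distrib, Finset.sum_ite_eq, if_pos hj]
    rw [Finset.mem_range] at hj
    exact add_le_add ((inner_sum hf0 (by omega) (by omega)).trans hA) hW
  refine (Finset.sum_le_sum hle).trans ?_
  rw [Finset.sum_const, Finset.card_range, nsmul_eq_mul]
  have : A * K ≤ A * K^2 := mul_le_mul_of_nonneg_left (by nlinarith) hA0
  nlinarith

lemma conv_q {s : Finset ι} {w x : ι → ℝ} {K : ℕ} {A : ℝ}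
    (hA : ∑ r ∈ Finset.Icc (-(2 * K : ℤ)) (2 * K), (if r = 0 then 0 else ‖SS s w x r‖) ≤ A) (y : ℝ) :
    |∑ i ∈ s, w i * pp K (x i - y)^2 - (∑ i ∈ s, w i) * n0 K| ≤ A * K^3 := by
  set f : ℤ → ℝ := fun r => if r = 0 then 0 else ‖SS s w x r‖ with hf
  have hf0 : ∀ r, 0 ≤ f r := fun r => by simp only [hf]; split_ifs <;> positivity
  have e1 : ((∑ i ∈ s, w i * pp K (x i - y)^2 : ℝ) : ℂ) = ∑ b ∈ QI K, SS s w x (fr b) * ee (-(fr b * y)) := by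
    simp only [← SS_shift]
    rw [Finset.sum_comm, Complex.ofReal_sum]
    refine Finset.sum_congr rfl fun i _ => ?_
    rw [← Finset.mul_sum, ← qq_expand]
    push_cast; rfl
  have e2 : (((∑ i ∈ s, w i) * n0 K : ℝ) : ℂ) = ∑ b ∈ QI K, (if fr b = 0 then SS s w x 0 else 0) := by
    rw [Finset.sum_ite, Finset.sum_const, Finset.sum_const_zero, add_zero, SS_zero, nsmul_eq_mul, n0]
    push_cast; ring
  rw [← Real.norm_eq_abs, ← Complex.norm_real, Complex.ofReal_sub, e1, e2, ← Finset.sum_sub_distrib]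
  refine (norm_sum_le _ _).trans ?_
  have hle : ∀ b ∈ QI K, ‖SS s w x (fr b) * ee (-(fr b * y)) - (if fr b = 0 then SS s w x 0 else 0)‖ ≤ f (fr b) := by
    intro b _
    simp only [hf]
    split_ifs with h
    · rw [h]; simp [ee_zero]
    · rw [sub_zero, norm_mul, ee_norm, mul_one]
  refine (Finset.sum_le_sum hle).trans ?_
  rw [QI, Finset.sum_product]
  have hin : ∀ a ∈ Finset.range K ×ˢ Finset.range K, ∑ b ∈ Finset.range K ×ˢ Finset.range K, f (fr (a, b)) ≤ K * A := by
    intro a ha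
    rw [Finset.sum_product]
    have : ∀ j ∈ Finset.range K, ∑ k ∈ Finset.range K, f (fr (a, (j, k))) ≤ A := by
      intro j hj
      rw [Finset.mem_product, Finset.mem_range, Finset.mem_range] at ha
      rw [Finset.mem_range] at hj
      have := inner_sum (K := K) hf0 (c := (a.1:ℤ) - a.2 + j) (by omega) (by omega)
      refine le_trans (le_of_eq ?_) (this.trans hA)
      refine Finset.sum_congr rfl fun k _ => ?_
      congr 1
      simp only [fr]; ring
    refine (Finset.sum_le_sum this).trans ?_
    rw [Finset.sum_const, Finset.card_range, nsmul_eq_mul]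
  refine (Finset.sum_le_sum hin).trans (le_of_eq ?_)
  rw [Finset.sum_const, Finset.card_product, Finset.card_range, nsmul_eq_mul]
  push_cast; ring

noncomputable def MM (K : ℕ) (δ s : ℝ) : ℝ := π^2 * (δ + 1/(2*K))^2 * (pp K s + pp K (s + 1/(2*K)))

lemma MM_cont (K : ℕ) (δ : ℝ) : Continuous (MM K δ) := by
  have := pp_cont K
  unfold MM; fun_prop

lemma MM_nonneg (K : ℕ) (δ s : ℝ) : 0 ≤ MM K δ s :=
  mul_nonneg (by positivity) (add_nonneg (pp_nonneg _ _) (pp_nonneg _ _))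

lemma MM_periodic (K : ℕ) (δ : ℝ) : Function.Periodic (MM K δ) 1 := by
  intro s
  simp only [MM]
  rw [pp_periodic, show s + 1 + 1/(2*(K:ℝ)) = s + 1/(2*(K:ℝ)) + 1 by ring, pp_periodic]

lemma conv_M {s : Finset ι} {w x : ι → ℝ} {K : ℕ} {A : ℝ} (hK : 1 ≤ K) (hw : ∀ i ∈ s, 0 ≤ w i)
    (hA : ∑ r ∈ Finset.Icc (-(2 * K : ℤ)) (2 * K), (if r = 0 then 0 else ‖SS s w x r‖) ≤ A)
    (hW : ∑ i ∈ s, w i ≤ A * K) {δ : ℝ} (hδ : 0 ≤ δ) (y : ℝ) :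
    ∑ i ∈ s, w i * MM K δ (y - x i) ≤ 4 * π^2 * A * (1 + K * δ)^2 := by
  have hK0 : (0:ℝ) < K := by exact_mod_cast hK
  have hA0 : 0 ≤ A := le_trans (Finset.sum_nonneg fun r _ => by split_ifs <;> positivity) hA
  have h1 := conv_p hK hw hA hW y
  have h2 := conv_p hK hw hA hW (y + 1/(2*K))
  have e : ∑ i ∈ s, w i * MM K δ (y - x i) = π^2 * (δ + 1/(2*K))^2 *
      (∑ i ∈ s, w i * pp K (y - x i) + ∑ i ∈ s, w i * pp K (y + 1/(2*K) - x i)) := by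
    rw [← Finset.sum_add_distrib, Finset.mul_sum]
    refine Finset.sum_congr rfl fun i _ => ?_
    rw [MM, show y - x i + 1/(2*(K:ℝ)) = y + 1/(2*K) - x i by ring]; ring
  rw [e]
  calc _ ≤ π^2 * (δ + 1/(2*K))^2 * (2 * A * K^2 + 2 * A * K^2) :=
        mul_le_mul_of_nonneg_left (add_le_add h1 h2) (by positivity)
    _ = 4 * π^2 * A * (1/2 + K * δ)^2 := by field_simp; ring
    _ ≤ _ := by
      apply mul_le_mul_of_nonneg_left _ (by positivity)
      have : 0 ≤ K * δ := by positivity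
      gcongr; norm_num

end FZ

namespace FZ

lemma ac_diff {h h' : ℝ → ℂ} (hac : IsAbsContTorus h h') (a b : ℝ) : h b - h a = ∫ t in a..b, h' t := by
  obtain ⟨_, _, hi, he⟩ := hac
  rw [he b, he a, ← intervalIntegral.integral_interval_sub_left (hi 0 b) (hi 0 a)]
  ring

lemma ac_cont {h h' : ℝ → ℂ} (hac : IsAbsContTorus h h') : Continuous h := by
  obtain ⟨_, _, hi, he⟩ := hac
  have : h = fun y => h 0 + ∫ t in (0:ℝ)..y, h' t := funext he
  rw [this]
  exact continuous_const.add (intervalIntegral.continuous_primitive hi 0)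

lemma ac_point {h h' : ℝ → ℂ} (hac : IsAbsContTorus h h') {K : ℕ} (hK : 1 ≤ K) (x : ℝ) {u : ℝ} (hu : |u| ≤ 1/2) :
    ‖h x - h (x - u)‖ ≤ ∫ y in (0:ℝ)..1, MM K |u| (y - x) * ‖h' y‖ := by
  have hi := hac.2.2.1
  have hii : ∀ a b, IntervalIntegrable (fun y => MM K |u| (y - x) * ‖h' y‖) volume a b := fun a b =>
    (hi a b).norm.continuousOn_mul (((MM_cont K |u|).comp (continuous_id.sub continuous_const)).continuousOn)
  have hper : Function.Periodic (fun y => MM K |u| (y - x) * ‖h' y‖) 1 := by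
    intro y
    simp only
    rw [hac.2.1 y, show y + 1 - x = (y - x) + 1 by ring, MM_periodic]
  have e := hper.intervalIntegral_add_eq 0 (x - 1/2)
  rw [zero_add] at e
  rw [e, ac_diff hac]
  refine intervalIntegral.norm_integral_le_integral_norm_uIoc.trans ?_
  rw [intervalIntegral.integral_of_le (by linarith)]
  have hsub : Set.uIoc (x - u) x ⊆ Set.Ioc (x - 1/2) (x - 1/2 + 1) := by
    intro y hy
    rw [abs_le] at hu
    rcases Set.mem_uIoc.1 hy with h | h
    · exact ⟨by linarith [h.1], by linarith [h.2]⟩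
    · exact ⟨by linarith [h.1], by linarith [h.2]⟩
  calc ∫ y in Set.uIoc (x - u) x, ‖h' y‖ ≤ ∫ y in Set.uIoc (x - u) x, MM K |u| (y - x) * ‖h' y‖ := by
        refine setIntegral_mono_on ?_ ?_ measurableSet_uIoc ?_
        · exact ((hi (x-u) x).norm).def'
        · exact (hii (x-u) x).def'
        · intro y hy
          have : |y - x| ≤ |u| := by
            rcases Set.mem_uIoc.1 hy with h | h
            · rw [abs_of_nonpos (by linarith [h.2])]
              exact le_trans (by linarith [h.1]) (le_abs_self u)
            · rw [abs_of_nonneg (by linarith [h.1])]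
              exact le_trans (by linarith [h.2]) (neg_le_abs u)
          have h1 : 1 ≤ MM K |u| (y - x) := pp_cover hK this
          exact le_mul_of_one_le_left (norm_nonneg _) h1
    _ ≤ _ := by
        refine setIntegral_mono_set ?_ ?_ ?_
        · exact (intervalIntegrable_iff_integrableOn_Ioc_of_le (by linarith)).1 (hii _ _)
        · exact Filter.Eventually.of_forall fun y => mul_nonneg (MM_nonneg _ _ _) (norm_nonneg _)
        · exact hsub.eventuallyLE

variable {ι : Type*}

lemma F_bound {h h' : ℝ → ℂ} (hac : IsAbsContTorus h h') {s : Finset ι} {w x : ι → ℝ} {K : ℕ} {A : ℝ} (hK : 1 ≤ K) (hw : ∀ i ∈ s, 0 ≤ w i)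
    (hA : ∑ r ∈ Finset.Icc (-(2 * K : ℤ)) (2 * K), (if r = 0 then 0 else ‖SS s w x r‖) ≤ A)
    (hW : ∑ i ∈ s, w i ≤ A * K) {u : ℝ} (hu : |u| ≤ 1/2) :
    ‖∑ i ∈ s, (w i : ℂ) * (h (x i) - h (x i - u))‖ ≤ 4 * π^2 * A * (1 + K * |u|)^2 * ∫ y in (0:ℝ)..1, ‖h' y‖ := by
  have hi := hac.2.2.1
  have hii : ∀ c a b, IntervalIntegrable (fun y => MM K |u| (y - c) * ‖h' y‖) volume a b := fun c a b =>
    (hi a b).norm.continuousOn_mul (((MM_cont K |u|).comp (continuous_id.sub continuous_const)).continuousOn)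
  calc _ ≤ ∑ i ∈ s, w i * ∫ y in (0:ℝ)..1, MM K |u| (y - x i) * ‖h' y‖ := by
        refine norm_sum_le_of_le _ fun i hi => ?_
        rw [norm_mul, Complex.norm_real, Real.norm_of_nonneg (hw i hi)]
        exact mul_le_mul_of_nonneg_left (ac_point hac hK _ hu) (hw i hi)
    _ = ∫ y in (0:ℝ)..1, (∑ i ∈ s, w i * MM K |u| (y - x i)) * ‖h' y‖ := by
        simp only [← intervalIntegral.integral_const_mul]
        rw [← intervalIntegral.integral_finsetSum (fun i _ => (hii _ _ _).const_mul _)]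
        simp only [Finset.sum_mul, mul_assoc]
    _ ≤ ∫ y in (0:ℝ)..1, (4 * π^2 * A * (1 + K * |u|)^2) * ‖h' y‖ := by
        refine intervalIntegral.integral_mono_on zero_le_one ?_ ?_ ?_
        · refine (hi _ _).norm.continuousOn_mul (Continuous.continuousOn ?_)
          exact continuous_finsetSum _ fun i _ => continuous_const.mul ((MM_cont K |u|).comp (continuous_id.sub continuous_const))
        · exact (hi _ _).norm.const_mul _
        · intro y _
          exact mul_le_mul_of_nonneg_right (conv_M hK hw hA hW (abs_nonneg u) y) (norm_nonneg _)
    _ = _ := by rw [intervalIntegral.integral_const_mul]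

lemma ac_le {h h' : ℝ → ℂ} (hac : IsAbsContTorus h h') (h0 : h 0 = 0) {y : ℝ} (hy : y ∈ Set.Icc (0:ℝ) 1) :
    ‖h y‖ ≤ ∫ y in (0:ℝ)..1, ‖h' y‖ := by
  have := ac_diff hac 0 y
  rw [h0, sub_zero] at this
  rw [this]
  refine (intervalIntegral.norm_integral_le_integral_norm hy.1).trans ?_
  refine intervalIntegral.integral_mono_interval le_rfl hy.1 hy.2 ?_ (hac.2.2.1 _ _).norm
  exact Filter.Eventually.of_forall fun y => norm_nonneg _

lemma main_zero {h h' : ℝ → ℂ} (hac : IsAbsContTorus h h') (h0 : h 0 = 0) {s : Finset ι} {w x : ι → ℝ} {K : ℕ} {A : ℝ} (hK : 1 ≤ K) (hw : ∀ i ∈ s, 0 ≤ w i)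
    (hA : ∑ r ∈ Finset.Icc (-(2 * K : ℤ)) (2 * K), (if r = 0 then 0 else ‖SS s w x r‖) ≤ A)
    (hW : ∑ i ∈ s, w i ≤ A * K) :
    ‖∑ i ∈ s, (w i : ℂ) * h (x i) - (∑ i ∈ s, w i : ℝ) * ∫ y in (0:ℝ)..1, h y‖ ≤ (12 * π^2 + 2) * A * ∫ y in (0:ℝ)..1, ‖h' y‖ := by
  set N := ∫ y in (0:ℝ)..1, ‖h' y‖ with hN
  have hN0 : 0 ≤ N := intervalIntegral.integral_nonneg zero_le_one fun _ _ => norm_nonneg _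
  have hc := ac_cont hac
  have hA0 : 0 ≤ A := le_trans (Finset.sum_nonneg fun r _ => by split_ifs <;> positivity) hA
  have hK1 : (1:ℝ) ≤ K := by exact_mod_cast hK
  have hn := n0_ge K hK
  have hn0 : 0 < n0 K := by nlinarith [pow_pos (show (0:ℝ) < K by linarith) 3]
  have hqc : Continuous (fun u => pp K u ^ 2) := (pp_cont K).pow 2
  have hqC : Continuous (fun u => ((pp K u ^ 2 : ℝ) : ℂ)) := Complex.continuous_ofReal.comp hqc
  have hq : ∫ u in (-(1/2):ℝ)..(1/2), ((pp K u ^ 2 : ℝ) : ℂ) = (n0 K : ℂ) := by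
    rw [intervalIntegral.integral_ofReal]
    have := qq_integral K (-(1/2))
    rw [show -(1/2:ℝ) + 1 = 1/2 by norm_num] at this
    rw [this]
  -- decomposition
  set S := ∑ i ∈ s, (w i : ℂ) * h (x i) with hS
  have hFc : Continuous (fun u : ℝ => ∑ i ∈ s, (w i : ℂ) * (h (x i) - h (x i - u))) := by
    refine continuous_finsetSum _ fun i _ => continuous_const.mul (continuous_const.sub (hc.comp (continuous_const.sub continuous_id)))
  have hGc : ∀ i, Continuous (fun u : ℝ => (w i : ℂ) * (((pp K u ^ 2 : ℝ) : ℂ) * h (x i - u))) := fun i =>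
    continuous_const.mul (hqC.mul (hc.comp (continuous_const.sub continuous_id)))
  have hqF : Continuous (fun u : ℝ => ((pp K u ^ 2 : ℝ) : ℂ) * ∑ i ∈ s, (w i : ℂ) * (h (x i) - h (x i - u))) := hqC.mul hFc
  have d1 : (n0 K : ℂ) * S = (∫ u in (-(1/2):ℝ)..(1/2), ((pp K u ^ 2 : ℝ) : ℂ) * ∑ i ∈ s, (w i : ℂ) * (h (x i) - h (x i - u)))
      + ∑ i ∈ s, ∫ u in (-(1/2):ℝ)..(1/2), (w i : ℂ) * (((pp K u ^ 2 : ℝ) : ℂ) * h (x i - u)) := by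
    rw [← hq, ← intervalIntegral.integral_mul_const, ← intervalIntegral.integral_finsetSum (fun i _ => (hGc i).intervalIntegrable _ _),
      ← intervalIntegral.integral_add (hqF.intervalIntegrable _ _)
        ((continuous_finsetSum _ fun i _ => hGc i).intervalIntegrable _ _)]
    congr 1
    funext u
    rw [hS, Finset.mul_sum, Finset.mul_sum, ← Finset.sum_add_distrib]
    refine Finset.sum_congr rfl fun i _ => ?_
    ring
  have d2 : ∀ i, ∫ u in (-(1/2):ℝ)..(1/2), (w i : ℂ) * (((pp K u ^ 2 : ℝ) : ℂ) * h (x i - u)) =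
      ∫ y in (0:ℝ)..1, ((w i * pp K (x i - y) ^ 2 : ℝ) : ℂ) * h y := by
    intro i
    have hper : Function.Periodic (fun y => ((w i * pp K (x i - y) ^ 2 : ℝ) : ℂ) * h y) 1 := by
      intro y
      simp only
      rw [hac.1 y, show x i - (y + 1) = (x i - y) - 1 by ring, (pp_periodic K).sub_eq]
    have e := hper.intervalIntegral_add_eq 0 (x i - 1/2)
    rw [zero_add] at e
    rw [e]
    have := intervalIntegral.integral_comp_sub_left (a := -(1/2)) (b := 1/2) (fun y => ((w i * pp K (x i - y) ^ 2 : ℝ) : ℂ) * h y) (x i)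
    rw [show x i - -(1/2:ℝ) = x i - 1/2 + 1 by ring] at this
    rw [← this]
    congr 1
    funext u
    rw [sub_sub_cancel]
    push_cast; ring
  have hwc : ∀ i, Continuous (fun y : ℝ => w i * pp K (x i - y)^2) := fun i =>
    continuous_const.mul (hqc.comp (continuous_const.sub continuous_id))
  have hwC : ∀ i, Continuous (fun y : ℝ => ((w i * pp K (x i - y)^2 : ℝ) : ℂ) * h y) := fun i =>
    (Complex.continuous_ofReal.comp (hwc i)).mul hc
  have hch : Continuous (fun y => (n0 K : ℂ) * (∑ i ∈ s, w i : ℝ) * h y) := continuous_const.mul hc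
  have d3 : (n0 K : ℂ) * (S - (∑ i ∈ s, w i : ℝ) * ∫ y in (0:ℝ)..1, h y) =
     (∫ u in (-(1/2):ℝ)..(1/2), ((pp K u ^ 2 : ℝ) : ℂ) * ∑ i ∈ s, (w i : ℂ) * (h (x i) - h (x i - u)))
      + ∫ y in (0:ℝ)..1, ((∑ i ∈ s, w i * pp K (x i - y)^2 - (∑ i ∈ s, w i) * n0 K : ℝ) : ℂ) * h y := by
    rw [mul_sub, d1, Finset.sum_congr rfl fun i _ => d2 i, ← intervalIntegral.integral_finsetSum (fun i _ => (hwC i).intervalIntegrable _ _), add_sub_assoc]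
    congr 1
    rw [← mul_assoc, ← intervalIntegral.integral_const_mul, ← intervalIntegral.integral_sub
      ((continuous_finsetSum _ fun i _ => hwC i).intervalIntegrable _ _) (hch.intervalIntegrable _ _)]
    congr 1
    funext y
    rw [← Finset.sum_mul]
    push_cast; ring
  have b1 : ‖∫ u in (-(1/2):ℝ)..(1/2), ((pp K u ^ 2 : ℝ) : ℂ) * ∑ i ∈ s, (w i : ℂ) * (h (x i) - h (x i - u))‖ ≤ 4 * π^2 * A * N * (3 * n0 K) := by
    calc _ ≤ ∫ u in (-(1/2):ℝ)..(1/2), 4 * π^2 * A * N * (pp K u ^ 2 * (1 + K * |u|)^2) := by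
          refine intervalIntegral.norm_integral_le_of_norm_le (by norm_num) ?_ ?_
          · refine Filter.Eventually.of_forall fun u hu => ?_
            have hu' : |u| ≤ 1/2 := abs_le.2 ⟨hu.1.le, hu.2⟩
            rw [norm_mul, Complex.norm_real, Real.norm_of_nonneg (sq_nonneg _)]
            refine (mul_le_mul_of_nonneg_left (F_bound hac hK hw hA hW hu') (sq_nonneg _)).trans (le_of_eq ?_)
            rw [← hN]; ring
          · refine Continuous.intervalIntegrable ?_ _ _
            exact continuous_const.mul (hqc.mul ((continuous_const.add (continuous_const.mul continuous_abs)).pow 2))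
      _ = 4 * π^2 * A * N * ∫ u in (-(1/2):ℝ)..(1/2), (pp K u ^ 2 * (1 + K * |u|)^2) := by
          rw [intervalIntegral.integral_const_mul]
      _ ≤ _ := mul_le_mul_of_nonneg_left (qq_moment hK) (by positivity)
  have b2 : ‖∫ y in (0:ℝ)..1, ((∑ i ∈ s, w i * pp K (x i - y)^2 - (∑ i ∈ s, w i) * n0 K : ℝ) : ℂ) * h y‖ ≤ A * (2 * n0 K) * N := by
    have := intervalIntegral.norm_integral_le_of_norm_le_const (a := 0) (b := 1) (C := A * (2 * n0 K) * N) (f := fun y => ((∑ i ∈ s, w i * pp K (x i - y)^2 - (∑ i ∈ s, w i) * n0 K : ℝ) : ℂ) * h y) ?_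
    · simpa using this
    · intro y hy
      rw [Set.uIoc_of_le zero_le_one] at hy
      rw [norm_mul, Complex.norm_real, Real.norm_eq_abs]
      refine mul_le_mul ((conv_q hA y).trans (mul_le_mul_of_nonneg_left hn hA0)) (ac_le hac h0 ⟨hy.1.le, hy.2⟩) (norm_nonneg _) (by positivity)
  have fin : n0 K * ‖S - (∑ i ∈ s, w i : ℝ) * ∫ y in (0:ℝ)..1, h y‖ ≤ n0 K * ((12 * π^2 + 2) * A * N) := by
    calc _ = ‖(n0 K : ℂ) * (S - (∑ i ∈ s, w i : ℝ) * ∫ y in (0:ℝ)..1, h y)‖ := by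
          rw [norm_mul, Complex.norm_real, Real.norm_of_nonneg hn0.le]
      _ ≤ 4 * π^2 * A * N * (3 * n0 K) + A * (2 * n0 K) * N := by
          rw [d3]
          exact (norm_add_le _ _).trans (add_le_add b1 b2)
      _ = _ := by ring
  exact le_of_mul_le_mul_left fin hn0

lemma main_bound {h h' : ℝ → ℂ} (hac : IsAbsContTorus h h') {s : Finset ι} {w x : ι → ℝ} {K : ℕ} {A : ℝ} (hK : 1 ≤ K) (hw : ∀ i ∈ s, 0 ≤ w i)
    (hA : ∑ r ∈ Finset.Icc (-(2 * K : ℤ)) (2 * K), (if r = 0 then 0 else ‖SS s w x r‖) ≤ A)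
    (hW : ∑ i ∈ s, w i ≤ A * K) :
    ‖∑ i ∈ s, (w i : ℂ) * h (x i) - (∑ i ∈ s, w i : ℝ) * ∫ y in (0:ℝ)..1, h y‖ ≤ (12 * π^2 + 2) * A * ∫ y in (0:ℝ)..1, ‖h' y‖ := by
  have hc := ac_cont hac
  have hac2 : IsAbsContTorus (fun y => h y - h 0) h' := by
    obtain ⟨a, b, c, d⟩ := hac
    refine ⟨fun y => by simp only [a y], b, c, fun y => ?_⟩
    simp only [d y]; ring
  have := main_zero hac2 (sub_self _) hK hw hA hW
  convert this using 2
  rw [intervalIntegral.integral_sub (hc.intervalIntegrable _ _) (continuous_const.intervalIntegrable _ _)]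
  simp only [mul_sub, Finset.sum_sub_distrib, ← Finset.sum_mul]
  simp
end FZ

namespace FZ

lemma SS_SL (α T : ℝ) (r : ℤ) : SS (ZT T) mlt (fun ρ => α * ρ.1.im) r = SL (r * (2 * π * α)) T := by
  unfold SS SL ee
  refine Finset.sum_congr rfl fun ρ _ => ?_
  congr 2
  push_cast; ring

lemma SL_neg (L T : ℝ) : SL (-L) T = (starRingEnd ℂ) (SL L T) := by
  unfold SL
  rw [map_sum]
  refine Finset.sum_congr rfl fun ρ _ => ?_
  rw [map_mul, Complex.conj_ofReal, ← Complex.exp_conj]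
  simp

lemma zeta_bound (hRH : RiemannHypothesis) {α : ℝ} (hα : 0 < α) : ∃ C T0 : ℝ, 0 ≤ C ∧ 1 ≤ T0 ∧
    ∀ h h' : ℝ → ℂ, IsAbsContTorus h h' → ∀ T, T0 ≤ T →
      ‖∑ ρ ∈ ZT T, (mlt ρ : ℂ) * h (α * ρ.1.im) - (∑ ρ ∈ ZT T, mlt ρ : ℝ) * ∫ y in (0:ℝ)..1, h y‖
        ≤ C * T * ∫ y in (0:ℝ)..1, ‖h' y‖ := by
  obtain ⟨A, T0, hA, hT0, H⟩ := SL_sum hRH (L0 := 2 * π * α) (by positivity)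
  refine ⟨(12 * π^2 + 2) * (2 * A), T0, by positivity, hT0, ?_⟩
  intro h h' hac T hT
  obtain ⟨K, hK, h1, h2⟩ := H T hT
  have hTp : 0 < T := by linarith
  have := main_bound (s := ZT T) (w := mlt) (x := fun ρ => α * ρ.1.im) hac hK (A := 2 * A * T) (fun ρ _ => mlt_nonneg ρ) ?_ ?_
  · refine this.trans (le_of_eq ?_)
    ring
  · have he : Function.Even (fun r : ℤ => if r = 0 then 0 else ‖SS (ZT T) mlt (fun ρ => α * ρ.1.im) r‖) := by
      intro r
      simp only [SS_SL, neg_eq_zero, Int.cast_neg, neg_mul, SL_neg, RCLike.norm_conj]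
    have e := Finset.sum_Icc_of_even_eq_range he (2 * K)
    push_cast at e
    rw [e, Finset.sum_range_succ']
    have : ∀ m : ℕ, (if ((m + 1 : ℕ) : ℤ) = 0 then 0 else ‖SS (ZT T) mlt (fun ρ => α * ρ.1.im) ((m + 1 : ℕ) : ℤ)‖) = ‖SL ((m+1:ℕ)*(2 * π * α)) T‖ := by
      intro m
      rw [if_neg (by omega), SS_SL]
      push_cast; rfl
    rw [Finset.sum_congr rfl fun m _ => this m]
    simp only [Nat.cast_zero, if_true, nsmul_eq_mul, Nat.cast_ofNat]
    linarith
  · have : 0 ≤ A * T * K := by positivity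
    linarith

lemma zset_eq (T : ℝ) : zetaZerosUpTo T = ((ZT T).map ⟨fun ρ : ZI => ρ.1, Subtype.val_injective⟩ : Finset ℂ) := by
  ext z
  simp only [zetaZerosUpTo, Finset.coe_map, Set.mem_image, Finset.mem_coe, mem_ZT]
  constructor
  · rintro ⟨a, b, c, d, e⟩
    exact ⟨⟨z, X_zero_iff.2 ⟨a, b, c⟩⟩, ⟨d, e⟩, rfl⟩
  · rintro ⟨ρ, ⟨d, e⟩, rfl⟩
    obtain ⟨a, b, c⟩ := X_zero_iff.1 ρ.2
    exact ⟨a, b, c, d, e⟩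

lemma mlt_eq (ρ : ZI) : (zetaZeroMult ρ.1 : ℝ) = mlt ρ := by
  obtain ⟨a, b, c⟩ := X_zero_iff.1 ρ.2
  rw [mlt, X_order b c]

lemma zetaN_eq (T : ℝ) : (zetaN T : ℝ) = ∑ ρ ∈ ZT T, mlt ρ := by
  rw [zetaN, zset_eq, finsum_mem_coe_finset, Finset.sum_map]
  push_cast
  exact Finset.sum_congr rfl fun ρ _ => mlt_eq ρ

lemma zetaZeroSum_eq (α : ℝ) (h : ℝ → ℂ) (T : ℝ) : zetaZeroSum α h T = ∑ ρ ∈ ZT T, (mlt ρ : ℂ) * h (α * ρ.1.im) := by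
  rw [zetaZeroSum, zset_eq, finsum_mem_coe_finset, Finset.sum_map]
  refine Finset.sum_congr rfl fun ρ _ => ?_
  rw [← mlt_eq]
  simp

/-- the functional -/
noncomputable def LT (α : ℝ) (h : ℝ → ℂ) (T : ℝ) : ℂ :=
  (1 / (T : ℂ)) * zetaZeroSum α h T - ((zetaN T : ℂ) / (T : ℂ)) * ∫ u in (0:ℝ)..1, h u

lemma LT_eq (α : ℝ) (h : ℝ → ℂ) (T : ℝ) : LT α h T = (∑ ρ ∈ ZT T, (mlt ρ : ℂ) * h (α * ρ.1.im) - (∑ ρ ∈ ZT T, mlt ρ : ℝ) * ∫ y in (0:ℝ)..1, h y) / T := by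
  rw [LT, zetaZeroSum_eq, ← zetaN_eq]
  push_cast; ring

lemma LT_bound (hRH : RiemannHypothesis) {α : ℝ} (hα : 0 < α) : ∃ C T0 : ℝ, 0 ≤ C ∧ 1 ≤ T0 ∧
    ∀ h h' : ℝ → ℂ, IsAbsContTorus h h' → ∀ T, T0 ≤ T → ‖LT α h T‖ ≤ C * ∫ y in (0:ℝ)..1, ‖h' y‖ := by
  obtain ⟨C, T0, hC, hT0, H⟩ := zeta_bound hRH hα
  refine ⟨C, T0, hC, hT0, fun h h' hac T hT => ?_⟩
  have hTp : 0 < T := by linarith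
  rw [LT_eq, norm_div, Complex.norm_real, Real.norm_of_nonneg hTp.le, div_le_iff₀ hTp]
  refine (H h h' hac T hT).trans (le_of_eq ?_)
  ring

lemma LT_sub (α : ℝ) {h k : ℝ → ℂ} (hh : Continuous h) (hk : Continuous k) (T : ℝ) :
    LT α (fun y => h y - k y) T = LT α h T - LT α k T := by
  rw [LT_eq, LT_eq, LT_eq, intervalIntegral.integral_sub (hh.intervalIntegrable _ _) (hk.intervalIntegrable _ _)]
  simp only [mul_sub, Finset.sum_sub_distrib]
  ring

lemma LT_sum (α : ℝ) (F : Finset ℤ) (d : ℤ → ℂ) (T : ℝ) :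
    LT α (fun y => ∑ m ∈ F, d m * ee (m * y)) T = ∑ m ∈ F, d m * LT α (fun y => ee (m * y)) T := by
  have hc : ∀ m : ℤ, Continuous (fun y : ℝ => d m * ee (m * y)) := fun m => 
    continuous_const.mul (ee_cont.comp (continuous_const.mul continuous_id))
  simp only [LT_eq]
  rw [intervalIntegral.integral_finsetSum (fun m _ => (hc m).intervalIntegrable _ _)]
  simp only [intervalIntegral.integral_const_mul, Finset.mul_sum]
  rw [Finset.sum_comm, ← Finset.sum_sub_distrib, Finset.sum_div]
  refine Finset.sum_congr rfl fun m _ => ?_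
  rw [mul_div_assoc', mul_sub, Finset.mul_sum]
  congr 2
  · refine Finset.sum_congr rfl fun ρ _ => ?_
    ring
  · ring

lemma LT_ee (α T : ℝ) {m : ℤ} (hm : m ≠ 0) : LT α (fun y => ee (m * y)) T = SL (m * (2 * π * α)) T / T := by
  rw [LT_eq]
  have := ee_integral m 0
  rw [zero_add, if_neg hm] at this
  rw [this, mul_zero, sub_zero, ← SS_SL]
  rfl

lemma LT_ee_zero (α T : ℝ) : LT α (fun y => ee ((0:ℤ) * y)) T = 0 := by
  rw [LT_eq]
  simp [ee_zero]
end FZ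

namespace FZ

lemma hs_conv {f g : ℕ → ℂ} {a b : ℂ} (h : HasSum f a) (hf : g = f) (hab : b = a) : HasSum g b := by
  rw [hf, hab]; exact h

lemma ee_cos (u : ℝ) : ee u + ee (-u) = 2 * (Real.cos (2 * π * u) : ℂ) := by
  unfold ee
  rw [Complex.ofReal_cos, Complex.cos]
  push_cast
  ring_nf

lemma ee_inv (u : ℝ) : ee u * ee (-u) = 1 := by
  rw [← ee_add, add_neg_cancel, ee_zero]

lemma ee_pow (u : ℝ) (k : ℕ) : ee u ^ k = ee (k * u) := by
  unfold ee
  rw [← Complex.exp_nat_mul]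
  congr 1; push_cast; ring

lemma R_gt {p a : ℕ} (hp : p.Prime) (ha : 0 < a) : 1 < (p:ℝ) ^ ((a:ℝ)/2) :=
  Real.one_lt_rpow (by exact_mod_cast hp.one_lt) (by positivity)

lemma den_pos {R c : ℝ} (hR : 1 < R) (hc : c ≤ 1) : 0 < R^2 - 2 * R * c + 1 := by nlinarith

lemma g_hasSum {p a q : ℕ} (hp : p.Prime) (ha : 0 < a) (t : ℝ) :
    HasSum (fun k : ℕ => (-(Real.log p / (2 * π)) * ((p:ℝ) ^ ((a:ℝ)/2))⁻¹ ^ (k+1) : ℝ) *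
      (ee (((q * (k+1) : ℕ) : ℤ) * t) + ee (-(((q * (k+1) : ℕ) : ℤ)) * t))) (gPAQ p a q t : ℂ) := by
  have hR := R_gt hp ha
  have hRR : (p:ℝ) ^ (a:ℝ) = ((p:ℝ) ^ ((a:ℝ)/2))^2 := by
    rw [← Real.rpow_natCast, ← Real.rpow_mul (by positivity)]
    congr 1; push_cast; ring
  unfold gPAQ
  rw [hRR]
  set R := (p:ℝ) ^ ((a:ℝ)/2)
  have hR0 : (R:ℂ) ≠ 0 := by exact_mod_cast (by linarith : R ≠ 0)
  have key : ∀ u : ℝ, HasSum (fun k : ℕ => ((R:ℂ)⁻¹ * ee u)^(k+1)) (ee u / (R - ee u)) := by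
    intro u
    have hz : ‖(R:ℂ)⁻¹ * ee u‖ < 1 := by
      rw [norm_mul, ee_norm, mul_one, norm_inv, Complex.norm_real, Real.norm_of_nonneg (by linarith)]
      exact inv_lt_one_of_one_lt₀ hR
    have := (hasSum_geometric_of_norm_lt_one hz).mul_left ((R:ℂ)⁻¹ * ee u)
    refine hs_conv this ?_ ?_
    · funext k; rw [pow_succ, mul_comm]
    · rw [show 1 - (R:ℂ)⁻¹ * ee u = (R:ℂ)⁻¹ * (R - ee u) by rw [mul_sub, inv_mul_cancel₀ hR0]]
      rw [mul_inv, inv_inv]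
      field_simp
  have hs := ((key (q * t)).add (key (-(q * t)))).mul_left (-(Real.log p / (2 * π)) : ℂ)
  refine hs_conv hs ?_ ?_
  · funext k
    rw [mul_pow, mul_pow, ee_pow, ee_pow]
    push_cast
    rw [show ((q:ℝ) * (k+1)) * t = (k+1) * (q * t) by ring, show -((q:ℝ) * (k+1)) * t = (k+1) * -(q * t) by ring]
    ring
  · have h1 := ee_cos (q * t)
    have h2 := ee_inv (q * t)
    rw [show 2 * π * (q * t) = 2 * π * q * t by ring] at h1
    have hd := den_pos hR (Real.cos_le_one (2 * π * q * t))
    set c := Real.cos (2 * π * q * t)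
    set e := ee (q * t) with he
    set f := ee (-(q * t)) with hf
    have hne : ∀ u, (R:ℂ) - ee u ≠ 0 := by
      intro u hu
      have : ‖(R:ℂ)‖ = ‖ee u‖ := by rw [sub_eq_zero.1 hu]
      rw [ee_norm, Complex.norm_real, Real.norm_of_nonneg (by linarith)] at this
      linarith
    have hdc : ((R:ℂ)^2 - 2 * R * c + 1) ≠ 0 := by exact_mod_cast hd.ne'
    have hprod : (R - e) * (R - f) = (R:ℂ)^2 - 2 * R * c + 1 := by
      linear_combination h2 - R * h1
    have : e / (R - e) + f / (R - f) = (2 * (R * c - 1)) / ((R:ℂ)^2 - 2 * R * c + 1) := by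
      rw [div_add_div _ _ (hne _) (hne _), hprod]
      congr 1
      linear_combination R * h1 - 2 * h2
    rw [this]
    have hpi : (π:ℂ) ≠ 0 := by exact_mod_cast Real.pi_ne_zero
    push_cast
    field_simp

lemma g_cont {p a : ℕ} (q : ℕ) (hp : p.Prime) (ha : 0 < a) : Continuous (gPAQ p a q) := by
  have hR := R_gt hp ha
  have hRR : (p:ℝ) ^ (a:ℝ) = ((p:ℝ) ^ ((a:ℝ)/2))^2 := by
    rw [← Real.rpow_natCast, ← Real.rpow_mul (by positivity)]
    congr 1; push_cast; ring
  unfold gPAQ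
  refine Continuous.div (by fun_prop) (by fun_prop) fun t => ?_
  rw [hRR]
  exact (mul_pos Real.pi_pos (den_pos hR (Real.cos_le_one _))).ne'

lemma g_coeff {p a q : ℕ} (hp : p.Prime) (ha : 0 < a) (m : ℤ) :
    HasSum (fun k : ℕ => (-(Real.log p / (2 * π)) * ((p:ℝ) ^ ((a:ℝ)/2))⁻¹ ^ (k+1) : ℝ) *
      ((if (((q * (k+1) : ℕ) : ℤ) + m) = 0 then (1:ℂ) else 0) + (if (-((q * (k+1) : ℕ) : ℤ) + m) = 0 then 1 else 0)))
      (∫ u in (0:ℝ)..1, (gPAQ p a q u : ℂ) * ee (m * u)) := by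
  have hR := R_gt hp ha
  set R := (p:ℝ) ^ ((a:ℝ)/2) with hRdef
  have hlog : 0 ≤ Real.log p := Real.log_natCast_nonneg p
  have hec : ∀ m : ℤ, Continuous (fun u : ℝ => ee (m * u)) := fun m => 
    (ee_cont.comp (continuous_const.mul continuous_id))
  have hsm : Summable (fun k : ℕ => Real.log p / (2 * π) * R⁻¹ ^ (k+1) * 2) := by
    have h1 : Summable (fun k : ℕ => R⁻¹ ^ k) :=
      summable_geometric_of_lt_one (by positivity) (inv_lt_one_of_one_lt₀ hR)
    have h2 := h1.mul_left (Real.log p / (2 * π) * R⁻¹ * 2)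
    refine h2.congr fun k => ?_
    rw [pow_succ]; ring
  have := intervalIntegral.hasSum_integral_of_dominated_convergence (μ := volume) (a := 0) (b := 1)
    (F := fun (k : ℕ) (u : ℝ) => ((-(Real.log p / (2 * π)) * R⁻¹ ^ (k+1) : ℝ) *
      (ee (((q * (k+1) : ℕ) : ℤ) * u) + ee (((-((q * (k+1) : ℕ) : ℤ) : ℤ)) * u))) * ee (m * u))
    (f := fun u => (gPAQ p a q u : ℂ) * ee (m * u))
    (fun k _ => Real.log p / (2 * π) * R⁻¹ ^ (k+1) * 2) ?_ ?_ ?_ ?_ ?_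
  · refine hs_conv this ?_ rfl
    funext k
    have e : ∀ u : ℝ, ((-(Real.log p / (2 * π)) * R⁻¹ ^ (k+1) : ℝ) *
      (ee (((q * (k+1) : ℕ) : ℤ) * u) + ee (((-((q * (k+1) : ℕ) : ℤ) : ℤ)) * u))) * ee (m * u) =
      ((-(Real.log p / (2 * π)) * R⁻¹ ^ (k+1) : ℝ) : ℂ) * (ee (((((q * (k+1) : ℕ) : ℤ) + m : ℤ)) * u) + ee (((-((q * (k+1) : ℕ) : ℤ) + m : ℤ)) * u)) := by
      intro u
      rw [mul_assoc, add_mul, ← ee_add, ← ee_add, ← add_mul, ← add_mul, Int.cast_add, Int.cast_add]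
    simp only [e]
    rw [intervalIntegral.integral_const_mul, intervalIntegral.integral_add ((hec _).intervalIntegrable _ _) ((hec _).intervalIntegrable _ _)]
    have h1 := ee_integral (((q * (k+1) : ℕ) : ℤ) + m) 0
    have h2 := ee_integral (-((q * (k+1) : ℕ) : ℤ) + m) 0
    rw [zero_add] at h1 h2
    rw [h1, h2]
  · intro k
    exact ((continuous_const.mul ((hec _).add (hec _))).mul (hec m)).aestronglyMeasurable
  · intro k
    refine Filter.Eventually.of_forall fun u _ => ?_
    rw [norm_mul, ee_norm, mul_one, norm_mul, Complex.norm_real, neg_mul, norm_neg, Real.norm_of_nonneg (by positivity)]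
    refine mul_le_mul_of_nonneg_left ?_ (by positivity)
    refine (norm_add_le _ _).trans ?_
    rw [ee_norm, ee_norm]; norm_num
  · exact Filter.Eventually.of_forall fun u _ => hsm
  · exact continuous_const.intervalIntegrable _ _
  · refine Filter.Eventually.of_forall fun u _ => ?_
    have := (g_hasSum (q := q) hp ha u).mul_right (ee (m * u))
    simpa only [Int.cast_neg] using this

lemma g_coeff_zero {p a q : ℕ} (hp : p.Prime) (ha : 0 < a) (m : ℤ) (h : ¬ ((q:ℤ) ∣ m) ∨ (m = 0 ∧ 0 < q)) :
    ∫ u in (0:ℝ)..1, (gPAQ p a q u : ℂ) * ee (m * u) = 0 := by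
  refine HasSum.unique (g_coeff hp ha m) ?_
  refine hs_conv hasSum_zero ?_ rfl
  funext k
  have h1 : ¬ (((q * (k+1) : ℕ) : ℤ) + m) = 0 := by
    intro hh
    rcases h with h | ⟨h, hq⟩
    · exact h ⟨-(k+1), by push_cast at hh; linarith⟩
    · have : 0 < q * (k+1) := by positivity
      omega
  have h2 : ¬ (-((q * (k+1) : ℕ) : ℤ) + m) = 0 := by
    intro hh
    rcases h with h | ⟨h, hq⟩
    · exact h ⟨(k+1), by push_cast at hh; linarith⟩
    · have : 0 < q * (k+1) := by positivity
      omega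
  rw [if_neg h1, if_neg h2]; simp

lemma g_coeff_pos {p a q : ℕ} (hp : p.Prime) (ha : 0 < a) (hq : 0 < q) (k : ℕ) :
    ∫ u in (0:ℝ)..1, (gPAQ p a q u : ℂ) * ee (((q * (k+1) : ℕ) : ℤ) * u) = 
      ((-(Real.log p / (2 * π)) * ((p:ℝ) ^ ((a:ℝ)/2))⁻¹ ^ (k+1) : ℝ) : ℂ) := by
  refine HasSum.unique (g_coeff hp ha _) ?_
  refine hs_conv (hasSum_single k ?_) rfl ?_
  rotate_left
  · rw [if_neg, if_pos]
    · simp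
    · ring
    · have : 0 < q * (k+1) := by positivity
      omega
  · intro j hj
    rw [if_neg, if_neg]
    · simp
    · intro h
      have : q * (j+1) = q * (k+1) := by omega
      have := Nat.eq_of_mul_eq_mul_left hq this
      omega
    · have : 0 < q * (k+1) := by positivity
      omega
end FZ

namespace FZ

lemma term_zero {L : ℝ} (H : ∀ p k : ℕ, p.Prime → 0 < k → L ≠ k * Real.log p) (n : ℕ) :
    (vv n : ℂ) * (if L = Real.log n then 1/2 else 0) = 0 := by
  by_cases hn : vM n = 0
  · simp [vv, hn]
  · obtain ⟨p, k, hp, hk, rfl⟩ := (isPrimePow_nat_iff n).1 (ArithmeticFunction.vonMangoldt_ne_zero_iff.1 hn)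
    rw [if_neg, mul_zero]
    rw [Nat.cast_pow, Real.log_pow]
    exact H p k hp hk

lemma special_dvd {α : ℝ} {p a q : ℕ} (hs : IsSpecialForm α p a q) {m : ℕ} (hm : 0 < m) {p' k : ℕ} (hp' : p'.Prime) (hk : 0 < k)
    (h : (m:ℝ) * (2 * π * α) = k * Real.log p') : q ∣ m := by
  obtain ⟨hp, ha, hq, hco, hα⟩ := hs
  have hq0 : (q:ℝ) ≠ 0 := by exact_mod_cast hq.ne'
  have hpi := Real.pi_ne_zero
  have e1 : ((m * a : ℕ) : ℝ) * Real.log p = ((k * q : ℕ) : ℝ) * Real.log p' := by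
    rw [hα] at h
    push_cast
    field_simp at h
    linarith
  rw [← Real.log_pow, ← Real.log_pow] at e1
  have e2 : ((p ^ (m * a) : ℕ) : ℝ) = ((p' ^ (k * q) : ℕ) : ℝ) := by
    push_cast
    refine Real.log_injOn_pos ?_ ?_ e1
    · exact Set.mem_Ioi.2 (pow_pos (Nat.cast_pos.2 hp.pos) _)
    · exact Set.mem_Ioi.2 (pow_pos (Nat.cast_pos.2 hp'.pos) _)
  have e3 : p ^ (m * a) = p' ^ (k * q) := by exact_mod_cast e2
  have hd : p ∣ p' ^ (k * q) := by rw [← e3]; exact dvd_pow_self _ (by positivity)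
  have e4 : p = p' := (Nat.prime_dvd_prime_iff_eq hp hp').1 (hp.dvd_of_dvd_pow hd)
  rw [← e4] at e3
  have e5 := Nat.pow_right_injective hp.two_le e3
  have : q ∣ m * a := ⟨k, by rw [e5]; ring⟩
  exact (Nat.Coprime.dvd_of_dvd_mul_right hco.symm this)

lemma special_of {α : ℝ} {m p k : ℕ} (hm : 0 < m) (hp : p.Prime) (hk : 0 < k)
    (h : (m:ℝ) * (2 * π * α) = k * Real.log p) : ∃ p a q : ℕ, IsSpecialForm α p a q := by
  obtain ⟨g, a, q, hg, hco, hka, hmq⟩ := Nat.exists_coprime' (m := k) (n := m) (Nat.gcd_pos_of_pos_left _ hk)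
  have ha : 0 < a := by
    rcases Nat.eq_zero_or_pos a with h0 | h0
    · simp [h0] at hka; omega
    · exact h0
  have hq : 0 < q := by
    rcases Nat.eq_zero_or_pos q with h0 | h0
    · simp [h0] at hmq; omega
    · exact h0
  refine ⟨p, a, q, hp, ha, hq, hco, ?_⟩
  have hg0 : (g:ℝ) ≠ 0 := by exact_mod_cast hg.ne'
  have hq0 : (q:ℝ) ≠ 0 := by exact_mod_cast hq.ne'
  have hpi := Real.pi_ne_zero
  rw [hka, hmq] at h
  push_cast at h
  field_simp
  have : (g:ℝ) * (q * 2 * π * α) = g * (a * Real.log p) := by linarith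
  have := mul_left_cancel₀ hg0 this
  linarith

lemma landau_val {p a : ℕ} (hp : p.Prime) (ha : 0 < a) (k : ℕ) :
   (-((Real.exp ((a * (k+1) : ℕ) * Real.log p) : ℝ) / π) * ∑' n : ℕ, (vv n : ℂ) * (if (a * (k+1) : ℕ) * Real.log p = Real.log n then 1/2 else 0) : ℂ)
    = ((-(Real.log p / (2 * π)) * ((p:ℝ) ^ ((a:ℝ)/2))⁻¹ ^ (k+1) : ℝ) : ℂ) := by
  have hM : 0 < a * (k+1) := by positivity
  have hp0 : (0:ℝ) < p := by exact_mod_cast hp.pos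
  have hL : 0 < (a * (k+1) : ℕ) * Real.log p := mul_pos (by exact_mod_cast hM) (Real.log_pos (by exact_mod_cast hp.one_lt))
  rw [tsum_eq_single (p ^ (a * (k+1)))]
  · rw [if_pos (by rw [Nat.cast_pow, Real.log_pow])]
    have h1 : Real.exp ((a * (k+1) : ℕ) * Real.log p) = (p:ℝ) ^ (a * (k+1)) := by
      rw [← Real.log_pow, Real.exp_log (by positivity)]
    have h2 : vv (p ^ (a * (k+1))) = Real.log p * ((p:ℝ) ^ (a * (k+1)))⁻¹ * ((p:ℝ) ^ ((a:ℝ)/2))⁻¹ ^ (k+1) := by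
      rw [vv, vM, ArithmeticFunction.vonMangoldt_apply_pow hM.ne', ArithmeticFunction.vonMangoldt_apply_prime hp, mul_assoc]
      congr 1
      rw [Nat.cast_pow, ← Real.rpow_natCast, ← Real.rpow_neg hp0.le, ← Real.rpow_neg hp0.le, ← Real.rpow_natCast, ← Real.rpow_mul hp0.le, ← Real.rpow_mul hp0.le, ← Real.rpow_add hp0]
      congr 1
      push_cast; ring
    rw [h1, h2]
    have hpc : ((p:ℝ):ℂ) ≠ 0 := by exact_mod_cast hp0.ne'
    have hpi : (π:ℂ) ≠ 0 := by exact_mod_cast Real.pi_ne_zero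
    have h3 : ((p:ℂ)) ^ (a * (k+1)) ≠ 0 := pow_ne_zero _ (by exact_mod_cast hp0.ne')
    push_cast
    generalize (((p:ℝ) ^ ((a:ℝ)/2) : ℝ) : ℂ)⁻¹ ^ (k+1) = Y
    field_simp
  · intro n hn
    rw [if_neg, mul_zero]
    intro h
    apply hn
    rw [h] at hL
    have hn0 : n ≠ 0 := by
      rintro rfl; simp at hL
    rw [← Real.log_pow] at h
    have := Real.log_injOn_pos (Set.mem_Ioi.2 (pow_pos hp0 _)) (Set.mem_Ioi.2 (Nat.cast_pos.2 (Nat.pos_of_ne_zero hn0))) h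
    exact_mod_cast this.symm

lemma mono_pos (hRH : RiemannHypothesis) {α : ℝ} (hα : 0 < α) {g : ℝ → ℝ} (hg : IsDensityOf α g) {m : ℕ} (hm : 0 < m) :
    Tendsto (fun T => LT α (fun y => ee ((m:ℤ) * y)) T) atTop (nhds (∫ u in (0:ℝ)..1, (g u : ℂ) * ee ((m:ℤ) * u))) := by
  have hmz : (m:ℤ) ≠ 0 := by omega
  simp only [LT_ee _ _ hmz]
  have hL : 0 < (m:ℝ) * (2 * π * α) := by positivity
  have ht := landau_tendsto hRH hL
  simp only [Int.cast_natCast] at *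
  suffices hh : (-(Real.exp ((m:ℝ) * (2 * π * α)) / π) * ∑' n : ℕ, (vv n : ℂ) * (if (m:ℝ) * (2 * π * α) = Real.log n then 1/2 else 0) : ℂ)
      = ∫ u in (0:ℝ)..1, (g u : ℂ) * ee (m * u) by
    rw [hh] at ht; exact ht
  by_cases ex : ∃ p a q : ℕ, IsSpecialForm α p a q
  · obtain ⟨p, a, q, hs⟩ := ex
    rw [hg.1 p a q hs]
    obtain ⟨hp, ha, hq, hco, hα'⟩ := id hs
    by_cases hd : q ∣ m
    · obtain ⟨j, hj⟩ := hd
      obtain ⟨k, rfl⟩ : ∃ k, j = k + 1 := by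
        refine ⟨j - 1, ?_⟩
        have : j ≠ 0 := by rintro rfl; omega
        omega
      have hLe : (m:ℝ) * (2 * π * α) = (a * (k+1) : ℕ) * Real.log p := by
        have hq0 : (q:ℝ) ≠ 0 := by exact_mod_cast hq.ne'
        have hpi := Real.pi_ne_zero
        rw [hα', hj]; push_cast; field_simp
      rw [hLe, landau_val hp ha k, ← g_coeff_pos hp ha hq k, hj]
      simp only [Int.cast_natCast]
    · have := g_coeff_zero (q := q) hp ha (m:ℤ) (Or.inl (by exact_mod_cast hd))
      simp only [Int.cast_natCast] at this
      rw [this]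
      have h0 : ∀ n : ℕ, (vv n : ℂ) * (if (m:ℝ) * (2 * π * α) = Real.log n then 1/2 else 0) = 0 :=
        term_zero fun p' k hp' hk h => hd (special_dvd hs hm hp' hk h)
      simp only [h0, tsum_zero, mul_zero]
  · rw [hg.2 ex]
    have h0 : ∀ n : ℕ, (vv n : ℂ) * (if (m:ℝ) * (2 * π * α) = Real.log n then 1/2 else 0) = 0 :=
      term_zero fun p' k hp' hk h => ex (special_of hm hp' hk h)
    simp only [h0, tsum_zero, mul_zero]
    simp

lemma mono_lim (hRH : RiemannHypothesis) {α : ℝ} (hα : 0 < α) {g : ℝ → ℝ} (hg : IsDensityOf α g) (m : ℤ) :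
    Tendsto (fun T => LT α (fun y => ee (m * y)) T) atTop (nhds (∫ u in (0:ℝ)..1, (g u : ℂ) * ee (m * u))) := by
  rcases lt_trichotomy m 0 with h | h | h
  · obtain ⟨n, hn⟩ : ∃ n : ℕ, m = -(n:ℤ) := ⟨m.natAbs, by omega⟩
    have hn0 : 0 < n := by omega
    have := (Complex.continuous_conj.tendsto _).comp (mono_pos hRH hα hg hn0)
    have e : (starRingEnd ℂ) (∫ u in (0:ℝ)..1, (g u : ℂ) * ee ((n:ℤ) * u)) = ∫ u in (0:ℝ)..1, (g u : ℂ) * ee (m * u) := by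
      rw [intervalIntegral.integral_of_le zero_le_one, intervalIntegral.integral_of_le zero_le_one, ← integral_conj]
      congr 1
      funext u
      rw [map_mul, Complex.conj_ofReal, ee_conj, hn]
      push_cast; ring_nf
    rw [e] at this
    refine this.congr fun T => ?_
    simp only [Function.comp]
    rw [LT_ee _ _ (by omega), LT_ee _ _ (by omega), map_div₀, Complex.conj_ofReal, ← SL_neg, hn]
    push_cast; ring_nf
  · subst h
    simp only [LT_ee_zero]
    have : ∫ u in (0:ℝ)..1, (g u : ℂ) * ee ((0:ℤ) * u) = 0 := by
      by_cases ex : ∃ p a q : ℕ, IsSpecialForm α p a q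
      · obtain ⟨p, a, q, hs⟩ := ex
        rw [hg.1 p a q hs]
        exact g_coeff_zero hs.1 hs.2.1 0 (Or.inr ⟨rfl, hs.2.2.1⟩)
      · rw [hg.2 ex]; simp
    rw [this]
    exact tendsto_const_nhds
  · obtain ⟨n, rfl⟩ : ∃ n : ℕ, m = (n:ℤ) := ⟨m.natAbs, by omega⟩
    exact mono_pos hRH hα hg (by omega)

lemma dens_cont {α : ℝ} {g : ℝ → ℝ} (hg : IsDensityOf α g) : Continuous g := by
  by_cases ex : ∃ p a q : ℕ, IsSpecialForm α p a q
  · obtain ⟨p, a, q, hs⟩ := ex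
    rw [hg.1 p a q hs]
    exact g_cont q hs.1 hs.2.1
  · rw [hg.2 ex]; exact continuous_const

lemma trig_lim (hRH : RiemannHypothesis) {α : ℝ} (hα : 0 < α) {g : ℝ → ℝ} (hg : IsDensityOf α g) (F : Finset ℤ) (d : ℤ → ℂ) :
    Tendsto (fun T => LT α (fun y => ∑ m ∈ F, d m * ee (m * y)) T) atTop
      (nhds (∫ u in (0:ℝ)..1, (g u : ℂ) * ∑ m ∈ F, d m * ee (m * u))) := by
  simp only [LT_sum]
  have hc := dens_cont hg
  have e : ∫ u in (0:ℝ)..1, (g u : ℂ) * ∑ m ∈ F, d m * ee (m * u) = ∑ m ∈ F, d m * ∫ u in (0:ℝ)..1, (g u : ℂ) * ee (m * u) := by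
    simp only [← intervalIntegral.integral_const_mul]
    rw [← intervalIntegral.integral_finsetSum]
    · congr 1
      funext u
      rw [Finset.mul_sum]
      refine Finset.sum_congr rfl fun m _ => ?_
      ring
    · intro m _
      refine Continuous.intervalIntegrable ?_ _ _
      exact continuous_const.mul ((Complex.continuous_ofReal.comp hc).mul (ee_cont.comp (continuous_const.mul continuous_id)))
  rw [e]
  exact tendsto_finsetSum _ fun m _ => (mono_lim hRH hα hg m).const_mul _
end FZ

namespace FZ

lemma ee_deriv (m : ℤ) (y : ℝ) : HasDerivAt (fun y : ℝ => ee (m * y)) (2 * π * I * m * ee (m * y)) y := by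
  unfold ee
  have h1 : HasDerivAt (fun y : ℝ => (2 * π * I * m : ℂ) * (y : ℂ)) (2 * π * I * m) y := by
    simpa using (Complex.ofRealCLM.hasDerivAt (x := y)).const_mul (2 * π * I * m : ℂ)
  have h2 := h1.cexp
  convert h2 using 1
  · funext y; congr 1; push_cast; ring
  · rw [mul_comm]; congr 2; push_cast; ring

lemma trig_cont (F : Finset ℤ) (d : ℤ → ℂ) : Continuous (fun y : ℝ => ∑ m ∈ F, d m * ee (m * y)) :=
  continuous_finsetSum _ fun m _ => continuous_const.mul (ee_cont.comp (continuous_const.mul continuous_id))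

lemma trig_per (F : Finset ℤ) (d : ℤ → ℂ) : Function.Periodic (fun y : ℝ => ∑ m ∈ F, d m * ee (m * y)) 1 := by
  intro y
  refine Finset.sum_congr rfl fun m _ => ?_
  have := ee_periodic m y
  simp only at this
  rw [this]

lemma trig_ac (F : Finset ℤ) (d : ℤ → ℂ) : IsAbsContTorus (fun y => ∑ m ∈ F, d m * ee (m * y))
    (fun y => ∑ m ∈ F, (d m * (2 * π * I * m)) * ee (m * y)) := by
  refine ⟨trig_per F d, trig_per F _, fun a b => (trig_cont F _).intervalIntegrable _ _, fun y => ?_⟩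
  have hd : ∀ y : ℝ, HasDerivAt (fun y : ℝ => ∑ m ∈ F, d m * ee (m * y)) (∑ m ∈ F, (d m * (2 * π * I * m)) * ee (m * y)) y := by
    intro y
    have := HasDerivAt.fun_sum (u := F) (A := fun m (y : ℝ) => d m * ee (m * y)) (x := y) fun m _ => (ee_deriv m y).const_mul (d m)
    have e : (∑ m ∈ F, (d m * (2 * π * I * m)) * ee (m * y)) = ∑ m ∈ F, d m * (2 * π * I * m * ee (m * y)) :=
      Finset.sum_congr rfl fun m _ => by ring
    rw [e]
    exact this
  rw [intervalIntegral.integral_eq_sub_of_hasDerivAt (fun y _ => hd y) ((trig_cont F _).intervalIntegrable _ _)]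
  ring

lemma approx {f : ℝ → ℂ} (hf : IntervalIntegrable f volume 0 1) {ε : ℝ} (hε : 0 < ε) :
    ∃ (F : Finset ℤ) (c : ℤ → ℂ), ∫ t in (0:ℝ)..1, ‖f t - ∑ m ∈ F, c m * ee (m * t)‖ < ε := by
  have h1 : MemLp f 1 (volume.restrict (Ioc (0:ℝ) (0 + 1))) := by
    rw [memLp_one_iff_integrable, zero_add]
    exact (intervalIntegrable_iff_integrableOn_Ioc_of_le zero_le_one).1 hf
  have h2 : MemLp (AddCircle.liftIoc 1 0 f) 1 (AddCircle.haarAddCircle (T := 1)) := h1.memLp_liftIoc.haarAddCircle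
  have hd := span_fourierLp_closure_eq_top (T := 1) (p := 1) (by simp)
  have hm : h2.toLp ∈ (Submodule.span ℂ (Set.range (@fourierLp 1 _ 1 _))).topologicalClosure := by
    rw [hd]; trivial
  rw [← SetLike.mem_coe, Submodule.topologicalClosure_coe, Metric.mem_closure_iff] at hm
  obtain ⟨P, hP, hdist⟩ := hm ε hε
  obtain ⟨c, hc⟩ := Finsupp.mem_span_range_iff_exists_finsupp.1 hP
  refine ⟨c.support, c, ?_⟩
  set Q : C(AddCircle (1:ℝ), ℂ) := ∑ m ∈ c.support, c m • fourier m with hQ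
  have hPQ : P = ContinuousMap.toLp 1 AddCircle.haarAddCircle ℂ Q := by
    rw [← hc, hQ, map_sum, Finsupp.sum]
    refine Finset.sum_congr rfl fun m _ => ?_
    rw [map_smul]
  rw [dist_eq_norm, L1.norm_eq_integral_norm] at hdist
  have e : ∫ x, ‖(h2.toLp - P : Lp ℂ 1 (AddCircle.haarAddCircle (T := 1))) x‖ ∂AddCircle.haarAddCircle = ∫ x, ‖AddCircle.liftIoc 1 0 f x - Q x‖ ∂AddCircle.haarAddCircle := by
    refine integral_congr_ae ?_
    filter_upwards [Lp.coeFn_sub h2.toLp P, h2.coeFn_toLp, ContinuousMap.coeFn_toLp (p := 1) (𝕜 := ℂ) AddCircle.haarAddCircle Q] with x hx1 hx2 hx3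
    rw [hx1, Pi.sub_apply, hx2, hPQ, hx3]
  rw [e, AddCircle.integral_haarAddCircle, ← AddCircle.intervalIntegral_preimage 1 0] at hdist
  simp only [inv_one, one_smul, zero_add] at hdist
  refine lt_of_eq_of_lt ?_ hdist
  refine intervalIntegral.integral_congr_ae (Filter.Eventually.of_forall fun t ht => ?_)
  rw [Set.uIoc_of_le zero_le_one] at ht
  rw [AddCircle.liftIoc_coe_apply (by simpa using ht), hQ]
  congr 2
  rw [ContinuousMap.sum_apply]
  refine Finset.sum_congr rfl fun m _ => ?_
  rw [ContinuousMap.smul_apply, fourier_coe_apply, smul_eq_mul, ee]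
  congr 2
  push_cast; ring

lemma approx_ac {h h' : ℝ → ℂ} (hac : IsAbsContTorus h h') {ε : ℝ} (hε : 0 < ε) :
    ∃ (F : Finset ℤ) (d : ℤ → ℂ), (∑ m ∈ F, d m * ee (m * 0)) = h 0 ∧
      ∫ t in (0:ℝ)..1, ‖h' t - ∑ m ∈ F, (d m * (2 * π * I * m)) * ee (m * t)‖ < ε := by
  have hi := hac.2.2.1 0 1
  obtain ⟨F, c, hF⟩ := approx hi (half_pos hε)
  have h0 : ∫ t in (0:ℝ)..1, h' t = 0 := by
    rw [← ac_diff hac 0 1]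
    have := hac.1 0
    rw [zero_add] at this
    rw [this, sub_self]
  -- replace F by a set containing zero
  classical
  set c0 : ℂ := if (0:ℤ) ∈ F then c 0 else 0 with hc0
  have hsplit : ∀ t : ℝ, ∑ m ∈ F, c m * ee (m * t) = c0 + ∑ m ∈ F.erase 0, c m * ee (m * t) := by
    intro t
    by_cases h : (0:ℤ) ∈ F
    · rw [← Finset.add_sum_erase _ _ h, hc0, if_pos h]; simp [ee_zero]
    · rw [hc0, if_neg h, Finset.erase_eq_of_notMem h, zero_add]
  have hmc : ∀ m : ℤ, Continuous (fun t : ℝ => c m * ee (m * t)) := fun m =>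
    continuous_const.mul (ee_cont.comp (continuous_const.mul continuous_id))
  have hintg : ∫ t in (0:ℝ)..1, (h' t - ∑ m ∈ F, c m * ee (m * t)) = -c0 := by
    rw [intervalIntegral.integral_sub hi ((trig_cont F c).intervalIntegrable _ _), h0]
    simp only [hsplit]
    rw [intervalIntegral.integral_add (continuous_const.intervalIntegrable _ _) ((trig_cont _ c).intervalIntegrable _ _)]
    rw [intervalIntegral.integral_finsetSum (fun m _ => (hmc m).intervalIntegrable _ _)]
    rw [Finset.sum_eq_zero]
    · simp
    · intro m hm
      rw [intervalIntegral.integral_const_mul]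
      have := ee_integral m 0
      rw [zero_add, if_neg (Finset.ne_of_mem_erase hm)] at this
      rw [this, mul_zero]
  have hc0n : ‖c0‖ < ε / 2 := by
    rw [← norm_neg, ← hintg]
    exact (intervalIntegral.norm_integral_le_integral_norm zero_le_one).trans_lt hF
  set d : ℤ → ℂ := fun m => if m = 0 then h 0 - ∑ j ∈ F.erase 0, c j / (2 * π * I * j) else c m / (2 * π * I * m) with hdd
  have hdm : ∀ m ∈ F.erase 0, d m = c m / (2 * π * I * m) := by
    intro m hm
    simp only [hdd, if_neg (Finset.ne_of_mem_erase hm)]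
  have hpi : (π:ℂ) ≠ 0 := by exact_mod_cast Real.pi_ne_zero
  refine ⟨insert 0 (F.erase 0), d, ?_, ?_⟩
  · rw [Finset.sum_insert (by simp)]
    simp only [mul_zero, ee_zero, mul_one]
    rw [Finset.sum_congr rfl hdm]
    simp [hdd]
  · have e : ∀ t : ℝ, h' t - ∑ m ∈ insert 0 (F.erase 0), (d m * (2 * π * I * m)) * ee (m * t) =
        (h' t - ∑ m ∈ F, c m * ee (m * t)) + c0 := by
      intro t
      rw [Finset.sum_insert (by simp), hsplit]
      have : ∑ m ∈ F.erase 0, (d m * (2 * π * I * m)) * ee (m * t) = ∑ m ∈ F.erase 0, c m * ee (m * t) := by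
        refine Finset.sum_congr rfl fun m hm => ?_
        have hm0 : (m:ℂ) ≠ 0 := by exact_mod_cast Finset.ne_of_mem_erase hm
        rw [hdm m hm, div_mul_cancel₀]
        exact mul_ne_zero (mul_ne_zero (mul_ne_zero two_ne_zero hpi) I_ne_zero) hm0
      rw [this]
      simp only [Int.cast_zero, mul_zero, zero_mul, zero_add]
      ring
    simp only [e]
    have hi2 : IntervalIntegrable (fun t => h' t - ∑ m ∈ F, c m * ee (m * t)) volume 0 1 := hi.sub ((trig_cont F c).intervalIntegrable _ _)
    calc ∫ t in (0:ℝ)..1, ‖(h' t - ∑ m ∈ F, c m * ee (m * t)) + c0‖ ≤ ∫ t in (0:ℝ)..1, (‖(h' t - ∑ m ∈ F, c m * ee (m * t))‖ + ‖c0‖) := by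
          refine intervalIntegral.integral_mono_on zero_le_one ?_ ?_ fun t _ => norm_add_le _ _
          · exact (hi2.add (continuous_const.intervalIntegrable _ _)).norm
          · exact hi2.norm.add (continuous_const.intervalIntegrable _ _)
      _ = (∫ t in (0:ℝ)..1, ‖(h' t - ∑ m ∈ F, c m * ee (m * t))‖) + ‖c0‖ := by
          rw [intervalIntegral.integral_add hi2.norm (continuous_const.intervalIntegrable _ _)]
          simp
      _ < ε := by linarith

theorem final (hRH : RiemannHypothesis) (α : ℝ) (hα : 0 < α)
    (h h' : ℝ → ℂ) (hac : IsAbsContTorus h h')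
    (g : ℝ → ℝ) (hg : IsDensityOf α g) :
    Tendsto (fun T : ℝ => LT α h T) atTop (nhds (∫ u in (0:ℝ)..1, (g u : ℂ) * h u)) := by
  obtain ⟨C, T0, hC, hT0, HB⟩ := LT_bound hRH hα
  have hgc := dens_cont hg
  have hhc := ac_cont hac
  set G := ∫ u in (0:ℝ)..1, ‖(g u : ℂ)‖ with hG
  have hG0 : 0 ≤ G := intervalIntegral.integral_nonneg zero_le_one fun _ _ => norm_nonneg _
  rw [Metric.tendsto_atTop]
  intro ε hε
  set η := ε / (3 * (C + G + 1)) with hη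
  have hden : 0 < 3 * (C + G + 1) := by linarith
  have hη0 : 0 < η := div_pos hε hden
  have hηe : η * (C + G + 1) = ε / 3 := by rw [hη]; field_simp
  obtain ⟨F, d, hF0, hF⟩ := approx_ac hac hη0
  set k : ℝ → ℂ := fun y => ∑ m ∈ F, d m * ee (m * y) with hk
  set k' : ℝ → ℂ := fun y => ∑ m ∈ F, (d m * (2 * π * I * m)) * ee (m * y) with hk'
  have hkac : IsAbsContTorus k k' := trig_ac F d
  have hkc : Continuous k := trig_cont F d
  have hD : IsAbsContTorus (fun y => h y - k y) (fun y => h' y - k' y) := by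
    obtain ⟨a1, a2, a3, a4⟩ := hac
    obtain ⟨b1, b2, b3, b4⟩ := hkac
    refine ⟨fun y => ?_, fun y => ?_, fun a b => (a3 a b).sub (b3 a b), fun y => ?_⟩
    · simp only [a1 y, b1 y]
    · simp only [a2 y, b2 y]
    · simp only
      rw [intervalIntegral.integral_sub (a3 _ _) (b3 _ _), a4 y, b4 y]; ring
  have hD0 : (fun y => h y - k y) 0 = 0 := by
    simp only [hk]; rw [hF0, sub_self]
  have hlim : Tendsto (fun T => LT α k T) atTop (nhds (∫ u in (0:ℝ)..1, (g u : ℂ) * k u)) := trig_lim hRH hα hg F d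
  obtain ⟨T1, hT1⟩ := Metric.tendsto_atTop.1 hlim (ε/3) (by linarith)
  have hgb : ‖(∫ u in (0:ℝ)..1, (g u : ℂ) * h u) - ∫ u in (0:ℝ)..1, (g u : ℂ) * k u‖ ≤ G * η := by
    have hgC : Continuous (fun u => (g u : ℂ)) := Complex.continuous_ofReal.comp hgc
    have hgh : Continuous (fun u => (g u : ℂ) * h u) := hgC.mul hhc
    have hgk : Continuous (fun u => (g u : ℂ) * k u) := hgC.mul hkc
    rw [← intervalIntegral.integral_sub (hgh.intervalIntegrable _ _) (hgk.intervalIntegrable _ _)]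
    rw [hG, ← intervalIntegral.integral_mul_const]
    refine intervalIntegral.norm_integral_le_of_norm_le zero_le_one ?_ ((hgC.norm.mul continuous_const).intervalIntegrable _ _)
    refine Filter.Eventually.of_forall fun u hu => ?_
    rw [← mul_sub, norm_mul]
    refine mul_le_mul_of_nonneg_left ?_ (norm_nonneg _)
    exact (ac_le hD hD0 ⟨hu.1.le, hu.2⟩).trans hF.le
  refine ⟨max T0 T1, fun T hT => ?_⟩
  have b1 : ‖LT α h T - LT α k T‖ ≤ C * η := by
    rw [← LT_sub α hhc hkc]
    exact (HB _ _ hD T ((le_max_left _ _).trans hT)).trans (mul_le_mul_of_nonneg_left hF.le hC)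
  have b2 := hT1 T ((le_max_right _ _).trans hT)
  rw [dist_eq_norm] at b2 ⊢
  have e : LT α h T - (∫ u in (0:ℝ)..1, (g u : ℂ) * h u) = (LT α h T - LT α k T) + (LT α k T - ∫ u in (0:ℝ)..1, (g u : ℂ) * k u)
    - ((∫ u in (0:ℝ)..1, (g u : ℂ) * h u) - ∫ u in (0:ℝ)..1, (g u : ℂ) * k u) := by ring
  rw [e]
  have n1 := norm_sub_le ((LT α h T - LT α k T) + (LT α k T - ∫ u in (0:ℝ)..1, (g u : ℂ) * k u)) ((∫ u in (0:ℝ)..1, (g u : ℂ) * h u) - ∫ u in (0:ℝ)..1, (g u : ℂ) * k u)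
  have n2 := norm_add_le (LT α h T - LT α k T) (LT α k T - ∫ u in (0:ℝ)..1, (g u : ℂ) * k u)
  nlinarith
end FZ

/-- Corollary 3 of Ford–Zaharescu. -/
theorem ford_zaharescu_cor3 (hRH : RiemannHypothesis) (α : ℝ) (hα : 0 < α)
    (h h' : ℝ → ℂ) (hac : IsAbsContTorus h h')
    (g : ℝ → ℝ) (hg : IsDensityOf α g) :
    Filter.Tendsto (fun T : ℝ =>
        (1 / (T : ℂ)) * zetaZeroSum α h T - ((zetaN T : ℂ) / (T : ℂ)) * ∫ u in (0:ℝ)..1, h u)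
      Filter.atTop (nhds (∫ u in (0:ℝ)..1, (g u : ℂ) * h u)) := by
  exact FZ.final hRH α hα h h' hac g hg
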